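/- Let μ be a singular strong limit cardinal. If B is a Boolean algebra of cardinality ≥ μ and λ is the cardinality of the set of ideals of B, then λ = λ^μ. -/

import Mathlib

section
open Cardinal Set
universe u
namespace ClosedCount


section basics
variable {X : Type u} [TopologicalSpace X]

/-- number of closures of subsets of `Y` with property `P` -/
def nP (P : Set X → Prop) (Y : Set X) : Cardinal.{u} :=
  #(closure '' {S : Set X | S ⊆ Y ∧ P S} : Set (Set X))

/-- number of relatively closed subsets -/
def oo (Y : Set X) : Cardinal.{u} := nP (fun _ => True) Y

/-- number of clopen traces -/
def ww (Y : Set X) : Cardinal.{u} := #((fun b => b ∩ Y) '' {b : Set X | IsClopen b} : Set (Set X))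

/-- separated families -/
def Sep {ι : Type u} (G : ι → Set X) : Prop :=
  ∃ v : ι → Set X, ∀ j, IsOpen (v j) ∧ G j ⊆ v j ∧ ∀ k, k ≠ j → v j ∩ G k = ∅

/-- discrete families of points -/
def Disc {ι : Type u} (x : ι → X) : Prop := Sep (fun i => ({x i} : Set X))

theorem nP_mono {P : Set X → Prop} {Y Z : Set X} (h : Y ⊆ Z) : nP P Y ≤ nP P Z :=
  mk_le_mk_of_subset (image_mono fun _ hS => ⟨hS.1.trans h, hS.2⟩)

theorem nP_le_oo {P : Set X → Prop} {Y : Set X} : nP P Y ≤ oo Y :=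
  mk_le_mk_of_subset (image_mono fun _ hS => ⟨hS.1, trivial⟩)

theorem oo_mono {Y Z : Set X} (h : Y ⊆ Z) : oo Y ≤ oo Z := nP_mono h

theorem nP_eq_oo {P : Set X → Prop} {Y : Set X} (h : ∀ S, S ⊆ Y → P S) : nP P Y = oo Y := by
  refine le_antisymm nP_le_oo (mk_le_mk_of_subset (image_mono fun _ hS => ⟨hS.1, h _ hS.1⟩))

theorem nP_iUnion_le {P : Set X → Prop} (hP : ∀ S T, S ⊆ T → P T → P S) {ι : Type u}
    (Y : ι → Set X) : nP P (⋃ i, Y i) ≤ Cardinal.prod fun i => nP P (Y i) := by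
  unfold nP
  rw [← mk_pi]
  have key : ∀ K : (closure '' {S : Set X | S ⊆ ⋃ i, Y i ∧ P S} : Set (Set X)),
      ∃ f : (∀ i, (closure '' {S : Set X | S ⊆ Y i ∧ P S} : Set (Set X))),
        K.1 = closure (⋃ i, (f i).1) := by
    rintro ⟨_, S, ⟨hS, hPS⟩, rfl⟩
    refine ⟨fun i => ⟨closure (S ∩ Y i), S ∩ Y i, ⟨inter_subset_right, hP _ _ inter_subset_left hPS⟩, rfl⟩, ?_⟩
    apply le_antisymm
    · apply closure_mono
      intro x hx
      obtain ⟨i, hi⟩ := mem_iUnion.1 (hS hx)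
      exact mem_iUnion.2 ⟨i, subset_closure ⟨hx, hi⟩⟩
    · apply closure_minimal _ isClosed_closure
      apply iUnion_subset
      intro i
      exact closure_mono inter_subset_left
  choose f hf using key
  refine mk_le_of_injective (f := f) fun K L h => ?_
  apply Subtype.ext
  rw [hf K, hf L, h]

theorem oo_iUnion_le {ι : Type u} (Y : ι → Set X) :
    oo (⋃ i, Y i) ≤ Cardinal.prod fun i => oo (Y i) :=
  nP_iUnion_le (fun _ _ _ _ => trivial) Y

theorem nP_union_le {P : Set X → Prop} (hP : ∀ S T, S ⊆ T → P T → P S)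
    (Y Z : Set X) : nP P (Y ∪ Z) ≤ nP P Y * nP P Z := by
  have h := nP_iUnion_le hP (fun b : ULift.{u} Bool => cond b.down Y Z)
  have e : (⋃ b : ULift.{u} Bool, cond b.down Y Z) = Y ∪ Z := by
    ext x; simp [or_comm]
  rw [e] at h
  refine h.trans (le_of_eq ?_)
  rw [prod_eq_of_fintype]
  simp
  rw [← Fintype.prod_equiv (Equiv.ulift.symm) (fun b => nP P (cond b Y Z)) _ (fun b => rfl)]
  simp

theorem oo_union_le (Y Z : Set X) : oo (Y ∪ Z) ≤ oo Y * oo Z :=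
  nP_union_le (fun _ _ _ _ => trivial) Y Z

theorem oo_ne_zero (Y : Set X) : oo Y ≠ 0 := by
  unfold oo nP
  rw [mk_ne_zero_iff]
  exact ⟨⟨_, ∅, ⟨empty_subset _, trivial⟩, rfl⟩⟩

theorem one_le_oo (Y : Set X) : 1 ≤ oo Y := Cardinal.one_le_iff_ne_zero.2 (oo_ne_zero Y)

theorem two_le_oo {Y : Set X} (h : Y.Nonempty) : 2 ≤ oo Y := by
  unfold oo nP
  obtain ⟨y, hy⟩ := h
  rw [Cardinal.two_le_iff]
  refine ⟨⟨_, ∅, ⟨empty_subset _, trivial⟩, rfl⟩, ⟨_, {y}, ⟨singleton_subset_iff.2 hy, trivial⟩, rfl⟩, ?_⟩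
  intro h
  have h := congrArg Subtype.val h
  simp only [closure_empty] at h
  have : y ∈ closure ({y} : Set X) := subset_closure rfl
  rw [← h] at this
  exact this

theorem oo_empty : oo (∅ : Set X) = 1 := by
  apply le_antisymm _ (one_le_oo _)
  unfold oo nP
  rw [Cardinal.le_one_iff_subsingleton]
  constructor
  rintro ⟨_, S, ⟨hS, -⟩, rfl⟩ ⟨_, T, ⟨hT, -⟩, rfl⟩
  apply Subtype.ext
  show closure S = closure T
  rw [subset_empty_iff.1 hS, subset_empty_iff.1 hT]

theorem oo_le_two_pow (Y : Set X) : oo Y ≤ 2 ^ #Y := by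
  unfold oo nP
  refine mk_image_le.trans ?_
  rw [← mk_powerset]
  exact mk_le_mk_of_subset fun S hS => hS.1

theorem prod_nP_le {P : Set X → Prop} {ι : Type u} {G : ι → Set X} (h : Sep G) :
    (Cardinal.prod fun i => nP P (G i)) ≤ oo (⋃ i, G i) := by
  obtain ⟨v, hv⟩ := h
  unfold oo nP
  rw [← mk_pi]
  have key : ∀ f : (∀ i, (closure '' {S : Set X | S ⊆ G i ∧ P S} : Set (Set X))),
      ∃ K : (closure '' {S : Set X | S ⊆ ⋃ i, G i ∧ True} : Set (Set X)),
        ∀ i, (f i).1 = closure (K.1 ∩ v i) := by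
    intro f
    choose S hS hSf using fun i => (f i).2
    refine ⟨⟨closure (⋃ i, S i), ⋃ i, S i, ⟨iUnion_mono fun i => (hS i).1, trivial⟩, rfl⟩, fun i => ?_⟩
    rw [← hSf i]
    apply le_antisymm
    · apply closure_mono
      intro x hx
      exact ⟨subset_closure (mem_iUnion.2 ⟨i, hx⟩), (hv i).2.1 ((hS i).1 hx)⟩
    · apply closure_minimal _ isClosed_closure
      have h0 : closure (⋃ i, S i) ∩ v i ⊆ closure (v i ∩ ⋃ i, S i) := by
        rw [inter_comm]
        exact (hv i).1.inter_closure
      refine h0.trans (closure_mono ?_)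
      rintro x ⟨hxv, hx⟩
      obtain ⟨k, hk⟩ := mem_iUnion.1 hx
      by_cases hki : k = i
      · subst hki; exact hk
      · have : x ∈ v i ∩ G k := ⟨hxv, (hS k).1 hk⟩
        rw [(hv i).2.2 k hki] at this
        exact this.elim
  choose F hF using key
  refine mk_le_of_injective (f := F) fun f g h => ?_
  funext i
  apply Subtype.ext
  rw [hF f, hF g, h]

theorem prod_oo_le {ι : Type u} {G : ι → Set X} (h : Sep G) :
    (Cardinal.prod fun i => oo (G i)) ≤ oo (⋃ i, G i) := prod_nP_le h

theorem prod_oo_le_univ {ι : Type u} {G : ι → Set X} (h : Sep G) :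
    (Cardinal.prod fun i => oo (G i)) ≤ oo (univ : Set X) :=
  (prod_oo_le h).trans (oo_mono (subset_univ _))

theorem Sep.mono {ι : Type u} {G G' : ι → Set X} (h : Sep G) (hs : ∀ i, G' i ⊆ G i) : Sep G' := by
  obtain ⟨v, hv⟩ := h
  refine ⟨v, fun j => ⟨(hv j).1, (hs j).trans (hv j).2.1, fun k hk => ?_⟩⟩
  exact subset_empty_iff.1 ((inter_subset_inter_right _ (hs k)).trans ((hv j).2.2 k hk).subset)

theorem Sep.comp {ι ι' : Type u} {G : ι → Set X} (h : Sep G) {f : ι' → ι} (hf : Function.Injective f) :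
    Sep (G ∘ f) := by
  obtain ⟨v, hv⟩ := h
  exact ⟨v ∘ f, fun j => ⟨(hv _).1, (hv _).2.1, fun k hk => (hv _).2.2 _ (fun e => hk (hf e))⟩⟩

theorem two_pow_le_of_sep {ι : Type u} {G : ι → Set X} (h : Sep G) (hn : ∀ i, (G i).Nonempty) :
    2 ^ #ι ≤ oo (⋃ i, G i) := by
  refine le_trans ?_ (prod_oo_le h)
  rw [← Cardinal.prod_const']
  exact prod_le_prod _ _ fun i => two_le_oo (hn i)

theorem Disc.injective {ι : Type u} {x : ι → X} (h : Disc x) : Function.Injective x := by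
  obtain ⟨v, hv⟩ := h
  intro i j hij
  by_contra hne
  have := (hv j).2.2 i hne
  have h2 : x i ∈ v j ∩ {x i} := ⟨(hv j).2.1 (by simp [hij]), rfl⟩
  rw [this] at h2
  exact h2

theorem Sep.choose_disc {ι : Type u} {G : ι → Set X} (h : Sep G) (hn : ∀ i, (G i).Nonempty) :
    ∃ x : ι → X, (∀ i, x i ∈ G i) ∧ Disc x := by
  choose x hx using hn
  exact ⟨x, hx, h.mono fun i => singleton_subset_iff.2 (hx i)⟩

/-- glueing of separated families -/
theorem Sep.sigma {ι : Type u} {J : ι → Type u} {W : ι → Set X} (hW : Sep W)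
    {G : ∀ i, J i → Set X} (hG : ∀ i, Sep (G i)) (hs : ∀ i j, G i j ⊆ W i) :
    Sep (fun p : (Σ i, J i) => G p.1 p.2) := by
  obtain ⟨v, hv⟩ := hW
  choose t ht using hG
  refine ⟨fun p => v p.1 ∩ t p.1 p.2, ?_⟩
  rintro ⟨i, j⟩
  refine ⟨(hv i).1.inter (ht i j).1, subset_inter ((hs i j).trans (hv i).2.1) (ht i j).2.1, ?_⟩
  rintro ⟨i', j'⟩ hne
  by_cases hi : i' = i
  · subst hi
    have : j' ≠ j := fun e => hne (by rw [e])
    have h2 := (ht i' j).2.2 j' this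
    apply subset_empty_iff.1
    rw [← h2]
    exact inter_subset_inter_left _ inter_subset_right
  · have h2 := (hv i).2.2 i' hi
    apply subset_empty_iff.1
    rw [← h2]
    exact inter_subset_inter inter_subset_left (hs _ _)

/-! ### weight -/

theorem ww_mono {Y Z : Set X} (h : Y ⊆ Z) : ww Y ≤ ww Z := by
  unfold ww
  have : ((fun b => b ∩ Y) '' {b : Set X | IsClopen b}) =
      (fun b => b ∩ Y) '' ((fun b => b ∩ Z) '' {b : Set X | IsClopen b}) := by
    rw [image_image]
    apply image_congr
    intro b _
    show b ∩ Y = (b ∩ Z) ∩ Y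
    rw [inter_assoc, inter_eq_right.2 h]
  rw [this]
  exact mk_image_le

theorem clopen_inter_eq_of_dense {Y Z b c : Set X} (h : Z ⊆ closure Y) (_hYZ : Y ⊆ Z) (hb : IsClopen b) (hc : IsClopen c)
    (e : b ∩ Y = c ∩ Y) : b ∩ Z = c ∩ Z := by
  have main : ∀ b c : Set X, IsClopen b → IsClopen c → b ∩ Y = c ∩ Y → b ∩ Z ⊆ c ∩ Z := by
    rintro b c hb hc e x ⟨hx, hxZ⟩
    refine ⟨?_, hxZ⟩
    have h1 : x ∈ closure (b ∩ Y) := by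
      have := hb.isOpen.inter_closure (t := Y)
      exact this ⟨hx, h hxZ⟩
    rw [e] at h1
    exact closure_minimal inter_subset_left hc.isClosed h1
  exact le_antisymm (main b c hb hc e) (main c b hc hb e.symm)

theorem ww_closure_le {Y Z : Set X} (h : Z ⊆ closure Y) (hYZ : Y ⊆ Z) : ww Z ≤ ww Y := by
  unfold ww
  have key : ∀ t : ((fun b => b ∩ Z) '' {b : Set X | IsClopen b} : Set (Set X)),
      ∃ b, IsClopen b ∧ b ∩ Z = t.1 := fun t => t.2
  choose b hb hbt using key
  refine mk_le_of_injective (f := fun t => (⟨b t ∩ Y, b t, hb t, rfl⟩ :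
    ((fun b => b ∩ Y) '' {b : Set X | IsClopen b} : Set (Set X)))) fun s t hst => ?_
  apply Subtype.ext
  rw [← hbt s, ← hbt t]
  exact clopen_inter_eq_of_dense h hYZ (hb s) (hb t) (congrArg Subtype.val hst)

theorem ww_iUnion_le {ι : Type u} (Y : ι → Set X) : ww (⋃ i, Y i) ≤ Cardinal.prod fun i => ww (Y i) := by
  unfold ww
  rw [← mk_pi]
  have key : ∀ t : ((fun b => b ∩ ⋃ i, Y i) '' {b : Set X | IsClopen b} : Set (Set X)),
      ∃ b, IsClopen b ∧ (b ∩ ⋃ i, Y i) = t.1 := fun t => t.2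
  choose b hb hbt using key
  refine mk_le_of_injective (f := fun t i => (⟨b t ∩ Y i, b t, hb t, rfl⟩ :
    ((fun b => b ∩ Y i) '' {b : Set X | IsClopen b} : Set (Set X)))) fun s t hst => ?_
  apply Subtype.ext
  rw [← hbt s, ← hbt t, inter_iUnion, inter_iUnion]
  congr 1
  funext i
  exact congrArg Subtype.val (congrFun hst i)

theorem ww_le_oo (Y : Set X) : ww Y ≤ oo Y := by
  unfold ww oo nP
  have key : ∀ t : ((fun b => b ∩ Y) '' {b : Set X | IsClopen b} : Set (Set X)),
      ∃ b, IsClopen b ∧ b ∩ Y = t.1 := fun t => t.2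
  choose b hb hbt using key
  refine mk_le_of_injective (f := fun t => (⟨closure (b t ∩ Y), _, ⟨inter_subset_right, trivial⟩, rfl⟩ :
    (closure '' {S : Set X | S ⊆ Y ∧ True} : Set (Set X)))) fun s t hst => ?_
  have h := congrArg Subtype.val hst
  simp only at h
  have main : ∀ s t, closure (b s ∩ Y) = closure (b t ∩ Y) → b s ∩ Y ⊆ b t ∩ Y := by
    intro s t h x hx
    refine ⟨?_, hx.2⟩
    have : x ∈ closure (b s ∩ Y) := subset_closure hx
    rw [h] at this
    exact closure_minimal inter_subset_left (hb t).isClosed this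
  apply Subtype.ext
  rw [← hbt s, ← hbt t]
  exact le_antisymm (main s t h) (main t s h.symm)

theorem ww_le_two_pow (Y : Set X) : ww Y ≤ 2 ^ #Y := (ww_le_oo Y).trans (oo_le_two_pow Y)

theorem ww_ne_zero (Y : Set X) : ww Y ≠ 0 := by
  unfold ww
  rw [mk_ne_zero_iff]
  exact ⟨⟨_, univ, isClopen_univ, rfl⟩⟩

end basics

section compact
variable {X : Type u} [TopologicalSpace X] [CompactSpace X] [T2Space X] [TotallyDisconnectedSpace X]

theorem exists_clopen {x : X} {U : Set X} (hU : IsOpen U) (hx : x ∈ U) :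
    ∃ b, IsClopen b ∧ x ∈ b ∧ b ⊆ U := by
  obtain ⟨V, hV, h1, h2⟩ := compact_exists_isClopen_in_isOpen hU hx
  exact ⟨V, hV, h1, h2⟩

theorem exists_clopen_sep {x y : X} (h : x ≠ y) : ∃ b, IsClopen b ∧ x ∈ b ∧ y ∉ b := by
  obtain ⟨b, hb, hx, hs⟩ := exists_clopen (isOpen_compl_singleton (x := y)) (show x ∈ ({y}ᶜ : Set X) from h)
  exact ⟨b, hb, hx, fun hy => hs hy rfl⟩

/-- disjoint closed sets separated by a clopen -/
theorem exists_clopen_sep_closed {F G : Set X} (hF : IsClosed F) (hG : IsClosed G) (h : Disjoint F G) :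
    ∃ b, IsClopen b ∧ F ⊆ b ∧ b ∩ G = ∅ := by
  have key : ∀ x : F, ∃ b, IsClopen b ∧ x.1 ∈ b ∧ b ⊆ Gᶜ := fun x =>
    exists_clopen hG.isOpen_compl (fun hx => (Set.disjoint_left.1 h x.2) hx)
  choose b hb hx hs using key
  obtain ⟨t, ht⟩ := hF.isCompact.elim_finite_subcover b (fun i => (hb i).isOpen)
    (fun x hxF => mem_iUnion.2 ⟨⟨x, hxF⟩, hx ⟨x, hxF⟩⟩)
  refine ⟨⋃ i ∈ t, b i, t.finite_toSet.isClopen_biUnion fun i _ => hb i, ht, ?_⟩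
  rw [← subset_empty_iff]
  rintro x ⟨hx1, hx2⟩
  simp only [mem_iUnion] at hx1
  obtain ⟨i, _, hi⟩ := hx1
  exact hs i hi hx2

theorem mk_closure_le (K : Set X) : #(closure K) ≤ 2 ^ ((2 : Cardinal.{u}) ^ #K) := by
  have : #(closure K) ≤ #(Set (Set K)) := by
    refine mk_le_of_injective (f := fun x => {s : Set K | ∃ b, IsClopen b ∧ x.1 ∈ b ∧ s = {k : K | k.1 ∈ b}}) ?_
    intro x y h
    by_contra hne
    obtain ⟨b, hb, hx, hy⟩ := exists_clopen_sep (fun e => hne (Subtype.ext e) : x.1 ≠ y.1)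
    have h1 : {k : K | k.1 ∈ b} ∈ {s : Set K | ∃ b, IsClopen b ∧ x.1 ∈ b ∧ s = {k : K | k.1 ∈ b}} := ⟨b, hb, hx, rfl⟩
    simp only at h
    rw [h] at h1
    obtain ⟨c, hc, hyc, e⟩ := h1
    have hn : (c \ b ∩ K).Nonempty := by
      have := mem_closure_iff.1 y.2 (c \ b) (hc.isOpen.sdiff hb.isClosed) ⟨hyc, hy⟩
      exact this
    obtain ⟨z, hz, hzK⟩ := hn
    have : (⟨z, hzK⟩ : K) ∈ {k : K | k.1 ∈ b} := by rw [e]; exact hz.1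
    exact hz.2 this
  simpa using this

end compact


/-! ### well-ordered types of cardinal length -/

/-- the canonical well-ordered type of order type `c.ord` -/
abbrev WO (c : Cardinal.{u}) : Type u := c.ord.ToType

theorem mk_WO (c : Cardinal.{u}) : #(WO c) = c := by simp

theorem mk_Iio_WO {c : Cardinal.{u}} (i : WO c) : #(Iio i) < c := by
  exact mk_Iio_toType_ord_lt i

theorem mk_Iic_WO {c : Cardinal.{u}} (hc : ℵ₀ ≤ c) (i : WO c) : #(Iic i) < c := by
  rw [← Iio_insert]
  refine (mk_insert_le).trans_lt ?_
  exact add_lt_of_lt hc (mk_Iio_WO i) (one_lt_aleph0.trans_le hc)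

theorem exists_mk_Iio_WO {c d : Cardinal.{u}} (h : d < c) : ∃ i : WO c, #(Iio i) = d := by
  have h1 : d.ord < Ordinal.type (α := WO c) (· < ·) := by
    rw [Ordinal.type_toType]; exact ord_lt_ord.2 h
  obtain ⟨i, hi⟩ := Ordinal.typein_surj (α := WO c) (· < ·) h1
  refine ⟨i, ?_⟩
  have := Ordinal.card_typein (r := fun a b : WO c => a < b) i
  rw [hi, card_ord] at this
  exact this.symm

theorem exists_cofinal_WO (c : Cardinal.{u}) : ∃ s : Set (WO c), IsCofinal s ∧ #s = c.ord.cof := by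
  obtain ⟨s, hs, h⟩ := Order.exists_cof_eq (WO c)
  exact ⟨s, hs, by rw [h, Ordinal.cof_toType]⟩

theorem exists_bound_WO {c : Cardinal.{u}} {ι : Type u} (f : ι → WO c) (h : #ι < c.ord.cof) :
    ∃ i, ∀ j, f j < i := by
  have : ¬ IsCofinal (range f) := by
    intro hc
    have h1 := Order.cof_le hc
    rw [Ordinal.cof_toType] at h1
    exact absurd (h1.trans mk_range_le) (not_le.2 h)
  rw [not_isCofinal_iff] at this
  obtain ⟨x, hx⟩ := this
  exact ⟨x, fun j => hx _ ⟨j, rfl⟩⟩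

theorem exists_gt_WO {c : Cardinal.{u}} (hc : ℵ₀ ≤ c) (i : WO c) : ∃ j, i < j := by
  by_contra! h
  have : #(WO c) ≤ #(Iic i) := by
    rw [← mk_univ]
    exact mk_le_mk_of_subset fun j _ => h j
  rw [mk_WO] at this
  exact absurd this (not_le.2 (mk_Iic_WO hc i))

theorem aleph0_le_cof {c : Cardinal.{u}} (hc : ℵ₀ ≤ c) : ℵ₀ ≤ c.ord.cof :=
  (isRegular_cof (isSuccLimit_ord hc)).1

theorem cof_isRegular {c : Cardinal.{u}} (hc : ℵ₀ ≤ c) : c.ord.cof.IsRegular :=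
  isRegular_cof (isSuccLimit_ord hc)

theorem cof_le_self (c : Cardinal.{u}) : c.ord.cof ≤ c := by
  have := Order.cof_le_cardinalMk (WO c)
  rwa [Ordinal.cof_toType, mk_WO] at this

theorem nonempty_WO {c : Cardinal.{u}} (hc : ℵ₀ ≤ c) : Nonempty (WO c) := by
  rw [← mk_ne_zero_iff, mk_WO]
  exact (aleph0_pos.trans_le hc).ne'

/-! ### greedy injections -/

theorem exists_injective_choice {I J : Type u} (S : I → Set J) (h : ∀ i, #I ≤ #(S i)) :
    ∃ f : I → J, Function.Injective f ∧ ∀ i, f i ∈ S i := by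
  classical
  obtain ⟨e⟩ : Nonempty (I ≃ WO #I) := by rw [← Cardinal.eq, mk_WO]
  have step : ∀ (a : WO #I) (g : ∀ b, b < a → J), ∃ y, y ∈ S (e.symm a) ∧ ∀ b (hb : b < a), g b hb ≠ y := by
    intro a g
    by_contra! hcon
    have h1 : S (e.symm a) ⊆ range (fun b : Iio a => g b.1 b.2) := by
      intro y hy
      obtain ⟨b, hb, hby⟩ := hcon y hy
      exact ⟨⟨b, hb⟩, hby⟩
    have h2 := (mk_le_mk_of_subset h1).trans mk_range_le
    exact absurd ((h (e.symm a)).trans h2) (not_le.2 (mk_Iio_WO a))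
  choose F hF1 hF2 using step
  let G : WO #I → J := WellFounded.fix (wellFounded_lt (α := WO #I)) F
  have hG : ∀ a, G a = F a (fun b _ => G b) := fun a => WellFounded.fix_eq _ _ _
  refine ⟨fun i => G (e i), ?_, ?_⟩
  · have main : ∀ a b : WO #I, a < b → G a ≠ G b := by
      intro a b hab
      rw [hG b]
      exact hF2 b (fun c _ => G c) a hab
    intro i j hij
    simp only at hij
    rcases lt_trichotomy (e i) (e j) with h | h | h
    · exact absurd hij (main _ _ h)
    · exact e.injective h
    · exact absurd hij.symm (main _ _ h)
  · intro i
    have := hF1 (e i) (fun b _ => G b)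
    rw [← hG, e.symm_apply_apply] at this
    exact this

/-! ### closure lemma -/

theorem closure_lemma {α : Type u} {ψ Λ : Cardinal.{u}} (hψΛ : ψ ≤ Λ) (hΛ : ℵ₀ ≤ Λ)
    (hpow : ∀ s < ψ, Λ ^ s ≤ Λ) (Op : Set α → Set α) (hOp : ∀ N : Set α, #N < ψ → #(Op N) ≤ Λ) :
    ∃ M : Set α, #M ≤ Λ ∧ ∀ N ⊆ M, #N < ψ → Op N ⊆ M := by
  classical
  rcases isEmpty_or_nonempty α with hα | ⟨⟨d⟩⟩
  · exact ⟨∅, by simp, fun N _ _ x _ => isEmptyElim x⟩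
  -- enumerate `Op N`
  have enum : ∀ N : Set α, ∃ g : Λ.out → α, #N < ψ → Op N ⊆ range g := by
    intro N
    by_cases hN : #N < ψ
    · by_cases hne : (Op N).Nonempty
      · have h1 := hOp N hN
        have := hne.to_subtype
        have h2 : #(Op N) ≤ #(Λ.out) := by simpa using h1
        obtain ⟨j⟩ := h2
        refine ⟨fun l => (Function.invFun j l : Op N).1, fun _ x hx => ⟨j ⟨x, hx⟩, ?_⟩⟩
        have := Function.leftInverse_invFun j.injective ⟨x, hx⟩
        exact congrArg Subtype.val this
      · refine ⟨fun _ => d, fun _ x hx => absurd ⟨x, hx⟩ hne⟩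
    · exact ⟨fun _ => d, fun h => absurd h hN⟩
  choose g hg using enum
  let Sh := WO ψ × Λ.out
  let ar : Sh → Type u := fun p => Iio p.1
  let ev : WType ar → α := WType.elim α (fun p : (Σ a : Sh, ar a → α) => g (range p.2) p.1.2)
  refine ⟨range ev, mk_range_le.trans ?_, ?_⟩
  · apply WType.cardinalMk_le_of_le
    have : ∀ a : Sh, Λ ^ #(ar a) ≤ Λ := fun a => hpow _ (mk_Iio_WO a.1)
    refine (sum_le_sum _ (fun _ => Λ) this).trans ?_
    rw [sum_const']
    have : #Sh ≤ Λ := by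
      show #(WO ψ × Λ.out) ≤ Λ
      rw [mk_prod, lift_id, lift_id, mk_WO, mk_out]
      exact (mul_le_mul_left hψΛ Λ).trans (mul_eq_self hΛ).le
    exact (mul_le_mul_left this Λ).trans (mul_eq_self hΛ).le
  · intro N hN hNψ x hx
    obtain ⟨i, hi⟩ := exists_mk_Iio_WO hNψ
    obtain ⟨e⟩ := Cardinal.eq.1 hi
    have : ∀ n : N, ∃ w, ev w = n.1 := fun n => hN n.2
    choose w hw using this
    obtain ⟨l, hl⟩ := hg N hNψ hx
    refine ⟨WType.mk (β := ar) (i, l) (fun b => w (e b)), ?_⟩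
    show g (range fun b => ev (w (e b))) l = x
    rw [← hl]
    congr 1
    congr 1
    ext y
    constructor
    · rintro ⟨b, rfl⟩
      simp only [hw]
      exact (e b).2
    · intro hy
      exact ⟨e.symm ⟨y, hy⟩, by simp [hw]⟩

/-! ### cardinal arithmetic -/

theorem prod_split {J : Type u} (χ : J → Cardinal.{u}) (p : J → Prop) :
    Cardinal.prod χ = (Cardinal.prod fun j : {j // p j} => χ j) * Cardinal.prod fun j : {j // ¬ p j} => χ j := by
  classical
  have e := Equiv.piEquivPiSubtypeProd p (fun j => (χ j).out)
  have := Cardinal.mk_congr e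
  simpa [mk_pi] using this

theorem one_le_prod {J : Type u} {χ : J → Cardinal.{u}} (h : ∀ j, 1 ≤ χ j) : 1 ≤ Cardinal.prod χ := by
  rw [Cardinal.one_le_iff_ne_zero, prod_ne_zero]
  exact fun i => Cardinal.one_le_iff_ne_zero.1 (h i)

theorem prod_sub_le {J : Type u} {χ : J → Cardinal.{u}} (h : ∀ j, 1 ≤ χ j) (p : J → Prop) :
    (Cardinal.prod fun j : {j // p j} => χ j) ≤ Cardinal.prod χ := by
  rw [prod_split χ p]
  conv_lhs => rw [← mul_one (Cardinal.prod fun j : {j // p j} => χ j)]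
  exact mul_le_mul_right (one_le_prod (χ := fun j : {j // ¬ p j} => χ j) fun j => h j) _

theorem prod_comp_le {I J : Type u} {χ : J → Cardinal.{u}} (h : ∀ j, 1 ≤ χ j) {f : I → J}
    (hf : Function.Injective f) : (Cardinal.prod fun i => χ (f i)) ≤ Cardinal.prod χ := by
  refine le_trans ?_ (prod_sub_le h (fun j => j ∈ range f))
  have e := Equiv.ofInjective f hf
  have : (Cardinal.prod fun i => χ (f i)) = (Cardinal.prod fun j : {j // j ∈ range f} => χ j) := by
    have := Cardinal.mk_pi_congr (f := fun i => (χ (f i)).out)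
      (g := fun j : {j // j ∈ range f} => (χ j).out) (Equiv.ofInjective f hf) (fun i => by simp)
    simpa [mk_pi] using this
  exact this.le

theorem prod_le_pow {J : Type u} {χ : J → Cardinal.{u}} {τ : Cardinal.{u}} (h : ∀ j, χ j ≤ τ) :
    Cardinal.prod χ ≤ τ ^ #J := by
  rw [← prod_const']
  exact prod_le_prod _ _ h

theorem le_prod_of_one_le {J : Type u} {χ : J → Cardinal.{u}} (h : ∀ j, 1 ≤ χ j) (j : J) :
    χ j ≤ Cardinal.prod χ := by
  have := prod_comp_le h (f := fun _ : PUnit.{u+1} => j) (fun _ _ _ => rfl)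
  simpa [prod_const'] using this

/-- `p^T ≤ ∏_{i ∈ s} (#(Iic i))^T` for a cofinal `s` -/
theorem pow_le_prod_cofinal {p : Cardinal.{u}} (T : Cardinal.{u}) {s : Set (WO p)} (hs : IsCofinal s) :
    p ^ T ≤ Cardinal.prod fun i : s => #(Iic i.1) ^ T := by
  classical
  have : #(T.out → WO p) ≤ #(∀ i : s, (T.out → Iic i.1)) := by
    refine mk_le_of_injective (f := fun f i t => if h : f t ≤ i.1 then ⟨f t, h⟩ else ⟨i.1, mem_Iic.2 le_rfl⟩) ?_
    intro f f' h
    funext t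
    obtain ⟨i, hi, hfi⟩ := hs (max (f t) (f' t))
    have := congrFun (congrFun h ⟨i, hi⟩) t
    simp only [(le_max_left _ _).trans hfi, (le_max_right _ _).trans hfi, dif_pos] at this
    exact congrArg Subtype.val this
  simpa [mk_pi] using this

theorem PW {p T : Cardinal.{u}} (hp : ℵ₀ ≤ p) (h : ∀ χ < p, χ ^ T ≤ p) : p ^ T ≤ p ^ p.ord.cof := by
  obtain ⟨s, hs, hc⟩ := exists_cofinal_WO p
  refine (pow_le_prod_cofinal T hs).trans ?_
  rw [← hc]
  exact prod_le_pow fun i => h _ (mk_Iic_WO hp _)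

theorem BF {p t : Cardinal.{u}} (hp : ℵ₀ ≤ p) (ht : t < p.ord.cof) (h : ∀ χ < p, χ ^ t ≤ p) : p ^ t ≤ p := by
  have : #(t.out → WO p) ≤ #(Σ i : WO p, (t.out → Iic i)) := by
    have : ∀ f : t.out → WO p, ∃ i, ∀ a, f a < i := fun f => exists_bound_WO f (by simpa using ht)
    choose b hb using this
    refine mk_le_of_injective (f := fun f => ⟨b f, fun a => ⟨f a, (hb f a).le⟩⟩) ?_
    intro f f' h
    have h1 : b f = b f' := congrArg Sigma.fst h
    have h2 : ∀ (i : WO p) (x : Σ i : WO p, (t.out → Iic i)), True := fun _ _ => trivial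
    have h3 : (fun a => ((⟨b f, fun a => ⟨f a, (hb f a).le⟩⟩ : Σ i : WO p, (t.out → Iic i)).2 a).1) =
      (fun a => ((⟨b f', fun a => ⟨f' a, (hb f' a).le⟩⟩ : Σ i : WO p, (t.out → Iic i)).2 a).1) := by
      simp only at h
      rw [h]
    exact h3
  rw [mk_sigma] at this
  have h2 : (Cardinal.sum fun i : WO p => #(t.out → Iic i)) ≤ p := by
    refine (sum_le_sum _ (fun _ => p) fun i => ?_).trans ?_
    · rw [mk_arrow]; simpa using h _ (mk_Iic_WO hp i)
    · rw [sum_const', mk_WO, mul_eq_self hp]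
  have := this.trans h2
  simpa using this

theorem L1 {p t : Cardinal.{u}} {J : Type u} {χ : J → Cardinal.{u}} (ht : ℵ₀ ≤ t)
    (hc : p.ord.cof ≤ t) (h1 : ∀ j, 1 ≤ χ j) (h : ∀ ν < p, t ≤ #{j // ν < χ j}) : p ^ t ≤ Cardinal.prod χ := by
  obtain ⟨s, hs, hsc⟩ := exists_cofinal_WO p
  have hI : #(t.out × s) ≤ t := by
    rw [mk_prod, lift_id, lift_id, mk_out, hsc]
    exact (mul_le_mul_right hc t).trans (mul_eq_self ht).le
  obtain ⟨f, hf, hfS⟩ := exists_injective_choice (fun q : t.out × s => {j | #(Iio q.2.1) < χ j})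
    (fun q => hI.trans (h _ (mk_Iio_WO _)))
  refine le_trans ?_ (prod_comp_le h1 hf)
  have h2 : (Cardinal.prod fun q : t.out × s => #(Iic q.2.1)) ≤ Cardinal.prod fun q => χ (f q) := by
    apply prod_le_prod
    intro q
    have := hfS q
    simp only [mem_ofPred_eq] at this
    rw [← Iio_insert]
    refine mk_insert_le.trans ?_
    exact add_one_le_of_lt this
  refine le_trans ?_ h2
  have h3 : #(t.out → ∀ i : s, Iic i.1) ≤ #(∀ q : t.out × s, Iic q.2.1) := by
    refine mk_le_of_injective (f := fun F q => F q.1 q.2) ?_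
    intro F G h
    funext a i
    exact congrFun h (a, i)
  have h4 := pow_le_prod_cofinal 1 hs
  simp only [power_one] at h4
  calc p ^ t ≤ (Cardinal.prod fun i : s => #(Iic i.1)) ^ t := power_le_power_right h4
    _ = #(t.out → ∀ i : s, Iic i.1) := by simp [mk_pi]
    _ ≤ _ := h3
    _ = _ := by rw [mk_pi]

/-- the gap rule -/
theorem gap {κ θ χ T : Cardinal.{u}} (hT : ℵ₀ ≤ T) (hθ : θ ≤ T) (hθ0 : θ ≠ 0) (h : κ ≤ χ ^ T) : κ ^ θ ≤ χ ^ T := by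
  calc κ ^ θ ≤ (χ ^ T) ^ θ := power_le_power_right h
    _ = χ ^ T := by rw [← power_mul, mul_eq_left hT hθ hθ0]



theorem exists_least {P : Cardinal.{u} → Prop} (h : ∃ c, P c) : ∃ c, P c ∧ ∀ d < c, ¬ P d := by
  obtain ⟨m, hm, hmin⟩ := WellFounded.has_min (wellFounded_lt (α := Cardinal.{u})) {c | P c} h
  exact ⟨m, hm, fun d hd hP => hmin d hP hd⟩

/-- the cardinal context -/
structure Ctx (μ κ r0 : Cardinal.{u}) : Prop where
  sl : μ.IsStrongLimit
  inf : ℵ₀ ≤ κ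
  cof : κ.ord.cof < μ
  pow : ∀ χ < κ, ∀ s < μ, χ ^ s < κ
  r0_le : κ ≤ 2 ^ r0
  lt_r0 : ∀ r < r0, 2 ^ r < κ

namespace Ctx
variable {μ κ r0 : Cardinal.{u}}

theorem two_lt (C : Ctx μ κ r0) : 2 < κ := lt_of_lt_of_le (by exact_mod_cast natCast_lt_aleph0 (n := 2)) C.inf
theorem inf_θ (C : Ctx μ κ r0) : ℵ₀ ≤ κ.ord.cof := aleph0_le_cof C.inf
theorem θ0 (C : Ctx μ κ r0) : κ.ord.cof ≠ 0 := (aleph0_pos.trans_le C.inf_θ).ne'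
theorem inf_μ (C : Ctx μ κ r0) : ℵ₀ ≤ μ := C.inf_θ.trans C.cof.le
theorem two_pow (C : Ctx μ κ r0) {s : Cardinal.{u}} (hs : s < μ) : 2 ^ s < κ := C.pow 2 C.two_lt s hs
theorem μ_le (C : Ctx μ κ r0) : μ ≤ κ := by
  by_contra! h
  exact absurd (cantor κ) (not_lt.2 (C.two_pow h).le)
theorem μ_le_r0 (C : Ctx μ κ r0) : μ ≤ r0 := by
  by_contra! h
  exact absurd C.r0_le (not_le.2 (C.two_pow h))
theorem inf_r0 (C : Ctx μ κ r0) : ℵ₀ ≤ r0 := C.inf_μ.trans C.μ_le_r0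
theorem θ_lt_r0 (C : Ctx μ κ r0) : κ.ord.cof < r0 := C.cof.trans_le C.μ_le_r0
theorem r0_le_κ (C : Ctx μ κ r0) : r0 ≤ κ := by
  by_contra! h
  exact absurd (cantor κ) (not_lt.2 (C.lt_r0 κ h).le)
theorem mul_lt (C : Ctx μ κ r0) {a b : Cardinal.{u}} (ha : a < κ) (hb : b < κ) : a * b < κ := mul_lt_of_lt C.inf ha hb

/-- small exponents -/
theorem μ_le_of_pow (C : Ctx μ κ r0) {ν t : Cardinal.{u}} (hν : ν < κ) (h : κ ≤ ν ^ t) : μ ≤ t := by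
  by_contra! ht
  exact absurd h (not_le.2 (C.pow ν hν t ht))

theorem lemmaQ {τ r : Cardinal.{u}} (hΛ : 2 ^< r0 < κ) (hτ : τ < κ) (hr : r ≤ r0) (hri : ℵ₀ ≤ r)
    (h : ∀ T < r, τ ^ T < κ) : ∃ b < κ, ∀ T < r, τ ^ T ≤ b := by
  by_contra hcon
  obtain ⟨p, hp, hmin⟩ := exists_least (P := fun p => ¬ ∃ b < κ, ∀ T < r, p ^ T ≤ b) ⟨τ, hcon⟩
  have hpτ : p ≤ τ := by
    by_contra! hlt
    exact hmin τ hlt hcon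
  have hpκ : p < κ := hpτ.trans_lt hτ
  have key : ∀ χ < p, ∀ T < r, χ ^ T < p := by
    intro χ hχ T hT
    by_contra! hle
    obtain ⟨b, hb, hbT⟩ := not_not.1 (hmin χ hχ)
    apply hp
    refine ⟨b, hb, fun T' hT' => ?_⟩
    calc p ^ T' ≤ (χ ^ T) ^ T' := power_le_power_right hle
      _ = χ ^ (T * T') := by rw [power_mul]
      _ ≤ b := hbT _ (mul_lt_of_lt hri hT hT')
  have hp2 : 2 < p := by
    by_contra! h2
    apply hp
    exact ⟨_, hΛ, fun T hT => (power_le_power_right h2).trans (le_powerlt 2 (hT.trans_le hr))⟩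
  have hpi : ℵ₀ ≤ p := by
    by_contra! hf
    have := key 2 hp2 p (hf.trans_le hri)
    exact absurd (cantor p) (not_lt.2 this.le)
  by_cases hcof : p.ord.cof < r
  · apply hp
    refine ⟨p ^ p.ord.cof, (power_le_power_right hpτ).trans_lt (h _ hcof), fun T hT => ?_⟩
    exact PW hpi fun χ hχ => (key χ hχ T hT).le
  · apply hp
    refine ⟨p, hpκ, fun T hT => ?_⟩
    exact BF hpi (hT.trans_le (not_lt.1 hcof)) fun χ hχ => (key χ hχ T hT).le

theorem lemmaE1 (C : Ctx μ κ r0) {t ν : Cardinal.{u}} (ht : t < r0) (hν : ν < κ) (h : κ ≤ ν ^ t) :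
    ∃ p ≤ ν, ℵ₀ ≤ p ∧ κ ≤ p ^ t ∧ (∀ χ < p, χ ^ t < κ) ∧
      ∀ (J : Type u) (χ : J → Cardinal.{u}), (∀ j, 1 ≤ χ j) → Cardinal.prod χ < κ ^ κ.ord.cof →
        ∃ ν2 < p, #{j // ν2 < χ j} < t := by
  have hμt := C.μ_le_of_pow hν h
  have hti := C.inf_μ.trans hμt
  have hθt : κ.ord.cof ≤ t := C.cof.le.trans hμt
  obtain ⟨p, hp, hmin⟩ := exists_least (P := fun p => κ ≤ p ^ t) ⟨ν, h⟩
  have hpν : p ≤ ν := by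
    by_contra! hlt
    exact hmin ν hlt h
  have hlt : ∀ χ < p, χ ^ t < κ := fun χ hχ => not_le.1 (hmin χ hχ)
  have hltp : ∀ χ < p, χ ^ t < p := by
    intro χ hχ
    by_contra! hle
    have : p ^ t ≤ χ ^ t := by
      calc p ^ t ≤ (χ ^ t) ^ t := power_le_power_right hle
        _ = χ ^ t := by rw [← power_mul, mul_eq_self hti]
    exact absurd (hp.trans this) (not_le.2 (hlt χ hχ))
  have hp2 : 2 < p := by
    by_contra! h2
    exact absurd (hp.trans (power_le_power_right h2)) (not_le.2 (C.lt_r0 t ht))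
  have hpi : ℵ₀ ≤ p := hti.trans ((cantor t).le.trans (hltp 2 hp2).le)
  have hcof : p.ord.cof ≤ t := by
    by_contra! hc
    have := BF hpi hc fun χ hχ => (hltp χ hχ).le
    exact absurd (hp.trans (this.trans hpν)) (not_le.2 hν)
  refine ⟨p, hpν, hpi, hp, hlt, fun J χ h1 hprod => ?_⟩
  by_contra! hcon
  have := L1 hti hcof h1 hcon
  exact absurd ((gap hti hθt C.θ0 hp).trans this) (not_le.2 hprod)

theorem lemmaS (C : Ctx μ κ r0) (p : Cardinal.{u}) : ∀ t < r0, p < κ → ℵ₀ ≤ p → κ ≤ p ^ t → (∀ χ < p, χ ^ t < κ) →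
    ∀ (J : Type u) (χ : J → Cardinal.{u}) (ν : Cardinal.{u}), ν < p → (∀ j, 1 ≤ χ j) → (∀ j, χ j ≤ ν) →
      #J < r0 → Cardinal.prod χ < κ ^ κ.ord.cof → Cardinal.prod χ < p := by
  induction p using WellFoundedLT.induction with
  | ind p ih =>
  intro t ht hpκ hpi hpt hlt J χ ν hν h1 hle hJ hprod
  have hμt := C.μ_le_of_pow hpκ hpt
  have hti := C.inf_μ.trans hμt
  have hltp : ∀ χ < p, χ ^ t < p := by
    intro χ hχ
    by_contra! hle
    have : p ^ t ≤ χ ^ t := by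
      calc p ^ t ≤ (χ ^ t) ^ t := power_le_power_right hle
        _ = χ ^ t := by rw [← power_mul, mul_eq_self hti]
    exact absurd (hpt.trans this) (not_le.2 (hlt χ hχ))
  have small : ∀ s : Cardinal.{u}, ν ^ s < κ → ν ^ s < p := by
    intro s hs
    rcases le_total s t with hst | hst
    · rcases eq_or_ne ν 0 with h0 | h0
      · refine lt_of_le_of_lt (b := 1) ?_ (one_lt_aleph0.trans_le hpi)
        rw [h0]; exact zero_power_le s
      · exact (power_le_power_left h0 hst).trans_lt (hltp ν hν)
    · by_contra! hle
      have : p ^ t ≤ ν ^ s := by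
        calc p ^ t ≤ (ν ^ s) ^ t := power_le_power_right hle
          _ = ν ^ s := by
            rw [← power_mul, mul_eq_left (hti.trans hst) hst (aleph0_pos.trans_le hti).ne']
      exact absurd (hpt.trans this) (not_le.2 hs)
  by_cases hJκ : ν ^ #J < κ
  · exact (prod_le_pow hle).trans_lt (small _ hJκ)
  · obtain ⟨t2, ht2, ht2min⟩ := exists_least (P := fun s => κ ≤ ν ^ s) ⟨#J, not_lt.1 hJκ⟩
    have ht2J : t2 ≤ #J := by
      by_contra! hlt2
      exact ht2min _ hlt2 (not_lt.1 hJκ)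
    have ht2r : t2 < r0 := ht2J.trans_lt hJ
    have hνκ := hν.trans hpκ
    obtain ⟨p2, hp2ν, hp2i, hp2t, hp2lt, hfam⟩ := C.lemmaE1 ht2r hνκ ht2
    obtain ⟨ν2, hν2, hexc⟩ := hfam J χ h1 hprod
    rw [prod_split χ (fun j => ν2 < χ j)]
    apply mul_lt_of_lt hpi
    · refine (prod_le_pow (fun j : {j // ν2 < χ j} => hle j)).trans_lt (small _ ?_)
      exact not_le.1 (ht2min _ hexc)
    · have hp2p : p2 < p := hp2ν.trans_lt hν
      refine lt_trans (ih p2 hp2p t2 ht2r (hp2p.trans hpκ) hp2i hp2t hp2lt _ _ ν2 hν2 (fun j => h1 j)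
        (fun j => not_lt.1 j.2) ?_ ?_) hp2p
      · exact (mk_subtype_le _).trans_lt hJ
      · exact (prod_sub_le h1 (fun j => ¬ ν2 < χ j)).trans_lt hprod

theorem lemmaE (C : Ctx μ κ r0) {τ : Cardinal.{u}} (hΛ : 2 ^< r0 < κ) (hτ : τ < κ) :
    ∃ κs < κ, ∀ (J : Type u) (χ : J → Cardinal.{u}), #J < r0 → (∀ j, 1 ≤ χ j) → (∀ j, χ j ≤ τ) →
      Cardinal.prod χ < κ ^ κ.ord.cof → Cardinal.prod χ ≤ κs := by
  by_cases hall : ∀ T < r0, τ ^ T < κ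
  · obtain ⟨b, hb, hbT⟩ := lemmaQ hΛ hτ le_rfl C.inf_r0 hall
    exact ⟨b, hb, fun J χ hJ _ hle _ => (prod_le_pow hle).trans (hbT _ hJ)⟩
  · push Not at hall
    obtain ⟨t, ⟨ht, htκ⟩, htmin⟩ := exists_least (P := fun t => t < r0 ∧ κ ≤ τ ^ t) hall
    have htlt : ∀ T < t, τ ^ T < κ := by
      intro T hT
      by_contra! hle
      exact htmin T hT ⟨hT.trans ht, hle⟩
    have hti := C.inf_μ.trans (C.μ_le_of_pow hτ htκ)
    obtain ⟨b, hb, hbT⟩ := lemmaQ hΛ hτ ht.le hti htlt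
    obtain ⟨p, hpτ, hpi, hpt, hplt, hfam⟩ := C.lemmaE1 ht hτ htκ
    refine ⟨b * p, C.mul_lt hb (hpτ.trans_lt hτ), fun J χ hJ h1 hle hprod => ?_⟩
    obtain ⟨ν2, hν2, hexc⟩ := hfam J χ h1 hprod
    rw [prod_split χ (fun j => ν2 < χ j)]
    apply mul_le_mul'
    · exact (prod_le_pow (fun j : {j // ν2 < χ j} => hle j)).trans (hbT _ hexc)
    · exact (C.lemmaS p t ht (hpτ.trans_lt hτ) hpi hpt hplt {j // ¬ ν2 < χ j} (fun j => χ j) ν2 hν2 (fun j => h1 j)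
        (fun j => not_lt.1 j.2) ((mk_subtype_le _).trans_lt hJ)
        ((prod_sub_le h1 (fun j => ¬ ν2 < χ j)).trans_lt hprod)).le

end Ctx

/-! ### the weak power -/

theorem r0_le_powerlt {r : Cardinal.{u}} : r ≤ 2 ^< r := by
  by_contra! h
  exact absurd (cantor (2 ^< r)) (not_lt.2 (le_powerlt 2 h))

theorem powerlt_pow {r s : Cardinal.{u}} (hr : ℵ₀ < r) (hs : s < r.ord.cof) : (2 ^< r) ^ s ≤ 2 ^< r := by
  have hri := hr.le
  set Λ := 2 ^< r with hΛ
  have hrΛ : r ≤ Λ := r0_le_powerlt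
  have hΛi : ℵ₀ ≤ Λ := hri.trans hrΛ
  have hsr : s < r := hs.trans_le (cof_le_self r)
  let V := Σ a : WO r, Set (Iio a)
  have hV : Λ ≤ #V := by
    rw [hΛ, powerlt_le]
    intro T hT
    obtain ⟨a, ha⟩ := exists_mk_Iio_WO hT
    rw [← ha, ← mk_set]
    exact mk_le_of_injective (f := fun S : Set (Iio a) => (⟨a, S⟩ : V)) fun S S' h => by
      exact eq_of_heq (Sigma.mk.inj h).2
  have h1 : #(s.out → V) ≤ #(Σ a : WO r, (s.out → (Σ b : Iic a, Set (Iio b.1)))) := by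
    have : ∀ f : s.out → V, ∃ a, ∀ x, (f x).1 < a := fun f =>
      exists_bound_WO (fun x => (f x).1) (by simpa using hs)
    choose b hb using this
    refine mk_le_of_injective (f := fun f => ⟨b f, fun x => ⟨⟨(f x).1, (hb f x).le⟩, (f x).2⟩⟩) ?_
    intro f f' h
    let dec : (Σ a : WO r, (s.out → (Σ b : Iic a, Set (Iio b.1)))) → (s.out → V) :=
      fun q x => ⟨(q.2 x).1.1, (q.2 x).2⟩
    exact congrArg dec h
  have h2 : #(Σ a : WO r, (s.out → (Σ b : Iic a, Set (Iio b.1)))) ≤ Λ := by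
    rw [mk_sigma]
    refine (sum_le_sum _ (fun _ => Λ) fun a => ?_).trans ?_
    · rw [mk_arrow, lift_id, lift_id, mk_out]
      have ha := mk_Iic_WO hri a
      set T := max ℵ₀ (max s #(Iic a)) with hT
      have hTr : T < r := max_lt hr (max_lt hsr ha)
      have hTi : ℵ₀ ≤ T := le_max_left _ _
      have h3 : #(Σ b : Iic a, Set (Iio b.1)) ≤ 2 ^ T := by
        rw [mk_sigma]
        refine (sum_le_sum _ (fun _ => 2 ^ T) fun b => ?_).trans ?_
        · rw [mk_set]
          apply power_le_power_left two_ne_zero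
          refine le_trans ?_ ((le_max_right _ _).trans (le_max_right _ _))
          exact mk_le_mk_of_subset fun c (hc : c < b.1) => (le_of_lt hc).trans (show b.1 ≤ a from b.2)
        · rw [sum_const']
          refine (mul_le_mul_left (((le_max_right _ _).trans (le_max_right _ _)).trans (cantor T).le) _).trans ?_
          rw [mul_eq_self (hTi.trans (cantor T).le)]
      calc #(Σ b : Iic a, Set (Iio b.1)) ^ s ≤ (2 ^ T) ^ s := power_le_power_right h3
        _ = 2 ^ (T * s) := by rw [power_mul]
        _ ≤ 2 ^ T := power_le_power_left two_ne_zero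
            ((mul_le_mul_right ((le_max_left _ _).trans (le_max_right _ _)) T).trans (mul_eq_self hTi).le)
        _ ≤ Λ := le_powerlt 2 hTr
    · rw [sum_const', mk_WO]
      exact (mul_le_mul_left hrΛ Λ).trans (mul_eq_self hΛi).le
  calc Λ ^ s ≤ #V ^ s := power_le_power_right hV
    _ = #(s.out → V) := by simp
    _ ≤ Λ := h1.trans h2



theorem Ctx.succ_lt {μ κ r0 : Cardinal.{u}} (C : Ctx μ κ r0) {χ : Cardinal.{u}} (h : χ < κ) : Order.succ χ < κ := by
  rcases (Order.succ_le_of_lt h).lt_or_eq with h1 | h1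
  · exact h1
  · exfalso
    have hχ : ℵ₀ ≤ χ := by
      by_contra! hlt
      have := isSuccLimit_aleph0.succ_lt hlt
      rw [h1] at this
      exact absurd C.inf (not_le.2 this)
    have h2 := (isRegular_succ hχ).cof_ord
    rw [h1] at h2
    have := C.cof.trans_le C.μ_le
    rw [h2] at this
    exact lt_irrefl _ this

theorem Ctx.aleph0_lt {μ κ r0 : Cardinal.{u}} (C : Ctx μ κ r0) : ℵ₀ < κ :=
  (C.inf_θ.trans_lt C.cof).trans_le C.μ_le

/-- strictly monotone maps into an unbounded set -/
theorem exists_strictMono {I : Type u} [LinearOrder I] [WellFoundedLT I] {c : Cardinal.{u}} (hI : #I < c.ord.cof)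
    {H : Set (WO c)} (hH : ∀ x, ∃ y ∈ H, x < y) : ∃ h : I → WO c, StrictMono h ∧ ∀ i, h i ∈ H := by
  have step : ∀ (i : I) (f : ∀ j, j < i → WO c), ∃ y ∈ H, ∀ j (hj : j < i), f j hj < y := by
    intro i f
    obtain ⟨x, hx⟩ := exists_bound_WO (fun j : Iio i => f j.1 j.2) ((mk_set_le _).trans_lt hI)
    obtain ⟨y, hy, hxy⟩ := hH x
    exact ⟨y, hy, fun j hj => (hx ⟨j, hj⟩).trans hxy⟩
  choose F hF1 hF2 using step
  let G : I → WO c := WellFounded.fix (wellFounded_lt (α := I)) F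
  have hG : ∀ a, G a = F a (fun b _ => G b) := fun a => WellFounded.fix_eq _ _ _
  refine ⟨G, fun a b hab => ?_, fun i => ?_⟩
  · rw [hG b]
    exact hF2 b (fun c _ => G c) a hab
  · rw [hG i]; exact hF1 _ _

theorem EH {C : Type u} {S lam : Cardinal.{u}} (hS : ℵ₀ ≤ S) (hC : #C ≤ 2 ^ S) (hl : 2 ^ S ≤ lam)
    (g : WO (Order.succ lam) → WO (Order.succ lam) → WO (Order.succ lam) → C) :
    ∃ (h : WO (Order.succ S) → WO (Order.succ lam)) (g' : WO (Order.succ S) → WO (Order.succ S) → C),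
      StrictMono h ∧ ∀ a b c, a < c → b < c → g (h a) (h b) (h c) = g' a b := by
  classical
  have hSS : S ≤ 2 ^ S := (cantor S).le
  have h2S : ℵ₀ ≤ 2 ^ S := hS.trans hSS
  have hlam : ℵ₀ ≤ lam := h2S.trans hl
  have hreg := (isRegular_succ hlam).cof_ord
  let Good (N : Set (WO (Order.succ lam))) (t : N → N → C) (x : WO (Order.succ lam)) : Prop :=
    (∀ n ∈ N, n < x) ∧ ∀ n n' : N, g n n' x = t n n'
  obtain ⟨x0⟩ := nonempty_WO (hlam.trans (Order.le_succ lam))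
  let R (N : Set (WO (Order.succ lam))) (t : N → N → C) : WO (Order.succ lam) :=
    if h : ∃ x, Good N t x then h.choose else x0
  have hR : ∀ N t, (∃ x, Good N t x) → Good N t (R N t) := by
    intro N t h
    simp only [R, dif_pos h]
    exact h.choose_spec
  obtain ⟨M, hM, hcl⟩ := closure_lemma (α := WO (Order.succ lam)) (ψ := Order.succ S) (Λ := 2 ^ S)
    (Order.succ_le_of_lt (cantor S)) h2S
    (fun s hs => by
      rw [Order.lt_succ_iff] at hs
      rw [← power_mul]
      exact power_le_power_left two_ne_zero ((mul_le_mul_right hs S).trans (mul_eq_self hS).le))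
    (fun N => range (R N)) (by
      intro N hN
      rw [Order.lt_succ_iff] at hN
      refine mk_range_le.trans ?_
      rw [mk_arrow, mk_arrow]
      simp only [lift_id]
      have : #C ^ #N ≤ 2 ^ S := by
        refine (power_le_power_right hC).trans ?_
        rw [← power_mul]
        exact power_le_power_left two_ne_zero ((mul_le_mul_right hN S).trans (mul_eq_self hS).le)
      refine (power_le_power_right this).trans ?_
      rw [← power_mul]
      exact power_le_power_left two_ne_zero ((mul_le_mul_right hN S).trans (mul_eq_self hS).le))
  obtain ⟨xs, hxs⟩ := exists_bound_WO (c := Order.succ lam) (fun m : M => m.1) (by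
    rw [hreg]; exact (hM.trans hl).trans_lt (Order.lt_succ lam))
  have step : ∀ (a : WO (Order.succ S)) (f : ∀ b, b < a → M), ∃ y : M, (∀ b (hb : b < a), (f b hb).1 < y.1) ∧
      ∀ b b' (hb : b < a) (hb' : b' < a), g (f b hb).1 (f b' hb').1 y.1 = g (f b hb).1 (f b' hb').1 xs := by
    intro a f
    let N : Set (WO (Order.succ lam)) := range (fun b : Iio a => (f b.1 b.2).1)
    have hNM : N ⊆ M := by rintro _ ⟨b, rfl⟩; exact (f b.1 b.2).2
    have hNc : #N < Order.succ S := mk_range_le.trans_lt (mk_Iio_WO a)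
    have hG : Good N (fun n n' => g n n' xs) (R N (fun n n' => g n n' xs)) := by
      apply hR
      exact ⟨xs, fun n hn => hxs ⟨n, hNM hn⟩, fun _ _ => rfl⟩
    refine ⟨⟨R N (fun n n' => g n n' xs), hcl N hNM hNc ⟨_, rfl⟩⟩, ?_, ?_⟩
    · intro b hb
      exact hG.1 _ ⟨⟨b, hb⟩, rfl⟩
    · intro b b' hb hb'
      exact hG.2 ⟨_, ⟨b, hb⟩, rfl⟩ ⟨_, ⟨b', hb'⟩, rfl⟩
  choose F hF1 hF2 using step
  let G : WO (Order.succ S) → M := WellFounded.fix (wellFounded_lt (α := WO (Order.succ S))) F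
  have hG : ∀ a, G a = F a (fun b _ => G b) := fun a => WellFounded.fix_eq _ _ _
  refine ⟨fun a => (G a).1, fun a b => g (G a).1 (G b).1 xs, ?_, ?_⟩
  · intro a b hab
    show (G a).1 < (G b).1
    rw [hG b]
    exact hF1 b (fun c _ => G c) a hab
  · intro a b c hac hbc
    show g (G a).1 (G b).1 (G c).1 = g (G a).1 (G b).1 xs
    rw [hG c]
    exact hF2 c (fun c _ => G c) a b hac hbc

/-- the big cardinal used for homogeneous sets -/
noncomputable def big (θ : Cardinal.{u}) : Cardinal.{u} := Order.succ (2 ^ ((2 : Cardinal.{u}) ^ ((2 : Cardinal.{u}) ^ θ)))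

theorem ER3 {C : Type u} {θ : Cardinal.{u}} (hθ : ℵ₀ ≤ θ) (hC : #C ≤ 2 ^ θ) {I : Type u} [LinearOrder I]
    [WellFoundedLT I] (hI : #I ≤ 2 ^ θ) (g : WO (big θ) → WO (big θ) → WO (big θ) → C) :
    ∃ (h : I → WO (big θ)) (c0 : C), StrictMono h ∧ ∀ a b c, a < b → b < c → g (h a) (h b) (h c) = c0 := by
  set S0 := (2 : Cardinal.{u}) ^ θ with hS0
  have hS0i : ℵ₀ ≤ S0 := hθ.trans (cantor θ).le
  set S1 := (2 : Cardinal.{u}) ^ S0 with hS1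
  have hS1i : ℵ₀ ≤ S1 := hS0i.trans (cantor S0).le
  obtain ⟨h1, g1, hm1, hg1⟩ := EH (S := S1) (lam := 2 ^ S1) hS1i
    (hC.trans ((cantor S0).le.trans (cantor S1).le)) le_rfl g
  obtain ⟨h2, g2, hm2, hg2⟩ := EH (S := S0) (lam := S1) hS0i
    (hC.trans (cantor S0).le) le_rfl (fun a _ c => g1 a c)
  have hreg := isRegular_succ hS0i
  -- pigeonhole
  have hp : ∃ c0 : C, ∀ x : WO (Order.succ S0), ∃ y ∈ {y | g2 y y = c0}, x < y := by
    by_contra! hcon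
    choose x hx using hcon
    obtain ⟨z, hz⟩ := exists_bound_WO x (by rw [hreg.cof_ord]; exact hC.trans_lt (Order.lt_succ _))
    exact absurd (hx (g2 z z) z rfl) (not_le.2 (hz _))
  obtain ⟨c0, hc0⟩ := hp
  obtain ⟨h3, hm3, hH⟩ := exists_strictMono (I := I) (c := Order.succ S0)
    (by rw [hreg.cof_ord]; exact hI.trans_lt (Order.lt_succ _)) hc0
  refine ⟨fun i => h1 (h2 (h3 i)), c0, fun a b hab => hm1 (hm2 (hm3 hab)), ?_⟩
  intro a b c hab hbc
  rw [hg1 _ _ _ (hm2 (hm3 (hab.trans hbc))) (hm2 (hm3 hbc))]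
  have := hg2 (h3 a) (h3 a) (h3 b) (hm3 hab) (hm3 hab)
  have h4 : g2 (h3 a) (h3 a) = c0 := hH a
  rw [this, h4]

section
variable {X : Type u} [TopologicalSpace X] [CompactSpace X] [T2Space X] [TotallyDisconnectedSpace X]
variable {μ κ r0 : Cardinal.{u}}

theorem Ctx.big_lt (C : Ctx μ κ r0) : big κ.ord.cof < μ :=
  C.sl.isSuccLimit.succ_lt (C.sl.isStrongPrelimit (C.sl.isStrongPrelimit (C.sl.isStrongPrelimit C.cof)))

theorem Ctx.R1 (C : Ctx μ κ r0)
    (H : ∀ ν < κ, ∃ Z : WO (big κ.ord.cof) → Set X, (∀ j, IsClosed (Z j)) ∧ (∀ j k, j ≠ k → Disjoint (Z j) (Z k)) ∧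
      ∀ j, ν ≤ oo (Z j)) : κ ^ κ.ord.cof ≤ oo (univ : Set X) := by
  classical
  set θ := κ.ord.cof with hθ
  set σ := big θ with hσ
  have hθi := C.inf_θ
  have hσμ : σ < μ := C.big_lt
  have h2σ : (2 : Cardinal.{u}) ^ σ < μ := C.sl.isStrongPrelimit hσμ
  obtain ⟨s, hs, hsc⟩ := exists_cofinal_WO κ
  let ν : s → Cardinal.{u} := fun i => max ℵ₀ (#(Iic i.1) ^ θ)
  have hν : ∀ i, ν i < κ := fun i => max_lt C.aleph0_lt (C.pow _ (mk_Iic_WO C.inf _) _ C.cof)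
  have hrow : ∀ i : s, ∃ Z : WO σ → Set X, (∀ j, IsClosed (Z j)) ∧ (∀ j k, j ≠ k → Disjoint (Z j) (Z k)) ∧
      ∀ j, ν i ^ ((2 : Cardinal.{u}) ^ σ) < oo (Z j) := by
    intro i
    obtain ⟨Z, h1, h2, h3⟩ := H _ (C.succ_lt (C.pow _ (hν i) _ h2σ))
    exact ⟨Z, h1, h2, fun j => (Order.lt_succ _).trans_le (h3 j)⟩
  choose Z hZc hZd hZo using hrow
  have hb : ∀ (i : s) (j k : WO σ), ∃ b : Set X, IsClopen b ∧ (j ≠ k → Z i j ⊆ b ∧ b ∩ Z i k = ∅) := by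
    intro i j k
    by_cases hjk : j = k
    · exact ⟨univ, isClopen_univ, fun h => absurd hjk h⟩
    · obtain ⟨b, hb1, hb2, hb3⟩ := exists_clopen_sep_closed (hZc i j) (hZc i k) (hZd i j k hjk)
      exact ⟨b, hb1, fun _ => ⟨hb2, hb3⟩⟩
  choose b hbc hbs using hb
  -- pattern cells
  have hcell : ∀ (i : s) (j : WO σ), ∃ G ⊆ Z i j, ν i ≤ oo G ∧
      ∀ x ∈ G, ∀ y ∈ G, ∀ i' k l, x ∈ b i' k l → y ∈ b i' k l := by
    intro i j
    let pat : X → Set (s × WO σ × WO σ) := fun x => {q | x ∈ b q.1 q.2.1 q.2.2}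
    by_contra! hcon
    have hlt : ∀ P : Set (s × WO σ × WO σ), oo (Z i j ∩ pat ⁻¹' {P}) ≤ ν i := by
      intro P
      by_contra! hlt
      obtain ⟨x, hx, y, hy, i', k, l, h1, h2⟩ := hcon (Z i j ∩ pat ⁻¹' {P}) inter_subset_left hlt.le
      apply h2
      have hxP : pat x = P := hx.2
      have hyP : pat y = P := hy.2
      have : (i', k, l) ∈ pat x := h1
      rw [hxP, ← hyP] at this
      exact this
    have hU : Z i j = ⋃ P : Set (s × WO σ × WO σ), Z i j ∩ pat ⁻¹' {P} := by
      ext x; simp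
    have h1 := oo_iUnion_le (fun P : Set (s × WO σ × WO σ) => Z i j ∩ pat ⁻¹' {P})
    rw [← hU] at h1
    have h2 := h1.trans (prod_le_pow hlt)
    have h3 : #(Set (s × WO σ × WO σ)) ≤ 2 ^ σ := by
      rw [mk_set]
      apply power_le_power_left two_ne_zero
      rw [mk_prod, mk_prod]
      simp only [lift_id]
      rw [mk_WO, hsc]
      have hθσ : θ ≤ σ := by
        have := (cantor θ).le.trans ((cantor _).le.trans (cantor ((2 : Cardinal.{u}) ^ ((2 : Cardinal.{u}) ^ θ))).le)
        exact this.trans (Order.le_succ _)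
      have hσi : ℵ₀ ≤ σ := hθi.trans hθσ
      rw [mul_eq_self hσi]
      exact (mul_le_mul_left hθσ σ).trans (mul_eq_self hσi).le
    have h4 : ν i ≠ 0 := (aleph0_pos.trans_le (le_max_left _ _)).ne'
    exact absurd (h2.trans (power_le_power_left h4 h3)) (not_le.2 (hZo i j))
  choose G hGZ hGo hGp using hcell
  have hne : ∀ i j, (G i j).Nonempty := by
    intro i j
    by_contra! hemp
    have := hGo i j
    rw [hemp, oo_empty] at this
    exact absurd (one_lt_aleph0.trans_le (le_max_left ℵ₀ (#(Iic i.1) ^ θ))) (not_lt.2 this)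
  choose g hg using hne
  let col : WO σ → WO σ → WO σ → (Set (s × s) × Set (s × s)) := fun x1 x2 x3 =>
    ({q | g q.2 x3 ∈ b q.1 x1 x2}, {q | g q.2 x1 ∈ b q.1 x2 x3})
  have hssθ : #(s × s) = θ := by
    rw [mk_prod, lift_id, hsc, mul_eq_self hθi]
  have h2θ : ℵ₀ ≤ (2 : Cardinal.{u}) ^ θ := hθi.trans (cantor θ).le
  obtain ⟨h, c0, hm, hh⟩ := ER3 (C := Set (s × s) × Set (s × s)) (θ := θ) hθi (by
    rw [mk_prod, mk_set, hssθ, lift_id, mul_eq_self h2θ]) (I := s ×ₗ Fin 3) (by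
    show #(s × Fin 3) ≤ _
    rw [mk_prod, hsc]
    simp only [lift_uzero, mk_fin, Cardinal.lift_natCast]
    refine (mul_le_max_of_aleph0_le_left hθi).trans (max_le (cantor θ).le ?_)
    exact (natCast_lt_aleph0 (n := 3)).le.trans h2θ) col
  let jm : s → WO σ := fun i => h (toLex (i, 0))
  let j0 : s → WO σ := fun i => h (toLex (i, 1))
  let jp : s → WO σ := fun i => h (toLex (i, 2))
  have l01 : ∀ i, (toLex (i, 0) : s ×ₗ Fin 3) < toLex (i, 1) := fun i => by
    rw [Prod.Lex.toLex_lt_toLex]; right; simp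
  have l12 : ∀ i, (toLex (i, 1) : s ×ₗ Fin 3) < toLex (i, 2) := fun i => by
    rw [Prod.Lex.toLex_lt_toLex]; right; simp
  have lb : ∀ i k, i < k → ∀ x y : Fin 3, (toLex (i, x) : s ×ₗ Fin 3) < toLex (k, y) := fun i k hik x y => by
    rw [Prod.Lex.toLex_lt_toLex]; left; exact hik
  have hsep : Sep (fun i : s => G i (j0 i)) := by
    refine ⟨fun i => b i (j0 i) (jp i) \ b i (jm i) (j0 i), fun i => ⟨?_, ?_, ?_⟩⟩
    · exact (hbc _ _ _).isOpen.sdiff (hbc _ _ _).isClosed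
    · intro x hx
      refine ⟨(hbs i (j0 i) (jp i) (hm (l12 i)).ne).1 (hGZ _ _ hx), fun hx2 => ?_⟩
      have := (hbs i (jm i) (j0 i) (hm (l01 i)).ne).2
      have h3 : x ∈ b i (jm i) (j0 i) ∩ Z i (j0 i) := ⟨hx2, hGZ _ _ hx⟩
      rw [this] at h3
      exact h3
    · intro k hk
      rw [← subset_empty_iff]
      rintro y ⟨⟨hy1, hy2⟩, hyG⟩
      have hg1 : g k (j0 k) ∈ b i (j0 i) (jp i) := hGp k (j0 k) y hyG _ (hg _ _) _ _ _ hy1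
      have hg2 : g k (j0 k) ∉ b i (jm i) (j0 i) := fun hc => hy2 (hGp k (j0 k) _ (hg _ _) y hyG _ _ _ hc)
      rcases lt_or_gt_of_ne hk with hki | hik
      · have e1 := hh (toLex (k, 1)) (toLex (i, 1)) (toLex (i, 2)) (lb k i hki _ _) (l12 i)
        have e2 := hh (toLex (k, 1)) (toLex (i, 0)) (toLex (i, 1)) (lb k i hki _ _) (l01 i)
        have e : (i, k) ∈ (col (j0 k) (j0 i) (jp i)).2 := hg1
        rw [show col (j0 k) (j0 i) (jp i) = c0 from e1, ← e2] at e
        exact hg2 e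
      · have e1 := hh (toLex (i, 1)) (toLex (i, 2)) (toLex (k, 1)) (l12 i) (lb i k hik _ _)
        have e2 := hh (toLex (i, 0)) (toLex (i, 1)) (toLex (k, 1)) (l01 i) (lb i k hik _ _)
        have e : (i, k) ∈ (col (j0 i) (jp i) (j0 k)).1 := hg1
        rw [show col (j0 i) (jp i) (j0 k) = c0 from e1, ← e2] at e
        exact hg2 e
  refine (pow_le_prod_cofinal θ hs).trans (le_trans ?_ (prod_oo_le_univ hsep))
  exact prod_le_prod _ _ fun i => (le_max_right _ _).trans (hGo i (j0 i))

end


section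
variable {X : Type u} [TopologicalSpace X]

/-- the union of all clopen sets with at most `τ` closed subsets -/
def AA (X : Type u) [TopologicalSpace X] (τ : Cardinal.{u}) : Set X := ⋃₀ {e | IsClopen e ∧ oo e ≤ τ}

theorem isOpen_AA (τ : Cardinal.{u}) : IsOpen (AA X τ) := isOpen_sUnion fun _ h => h.1.isOpen

theorem oo_finset_lt {ν : Cardinal.{u}} (hν : ℵ₀ ≤ ν) {ι : Type*} (t : Finset ι) (Y : ι → Set X)
    (h : ∀ i, oo (Y i) < ν) : oo (⋃ i ∈ t, Y i) < ν := by
  classical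
  induction t using Finset.induction_on with
  | empty => simp only [Finset.notMem_empty, iUnion_of_empty, iUnion_empty, oo_empty]; exact one_lt_aleph0.trans_le hν
  | insert a t _ ih =>
    rw [Finset.set_biUnion_insert]
    exact (oo_union_le _ _).trans_lt (mul_lt_of_lt hν (h a) ih)

variable [CompactSpace X] [T2Space X] [TotallyDisconnectedSpace X]
variable {μ κ r0 : Cardinal.{u}}

theorem Ctx.R2 (C : Ctx μ κ r0) {ν : Cardinal.{u}} (hνκ : ν < κ) (hν : ℵ₀ ≤ ν)
    (H : ¬ ∃ Z : WO (big κ.ord.cof) → Set X, (∀ j, IsClosed (Z j)) ∧ (∀ j k, j ≠ k → Disjoint (Z j) (Z k)) ∧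
      ∀ j, ν ≤ oo (Z j)) : ∃ τ < κ, #((AA X τ)ᶜ : Set X) < μ := by
  classical
  set σ := big κ.ord.cof with hσ
  have hσμ : σ < μ := C.big_lt
  have hσi : ℵ₀ ≤ σ := by
    have := (cantor κ.ord.cof).le.trans ((cantor _).le.trans (cantor ((2 : Cardinal.{u}) ^ ((2 : Cardinal.{u}) ^ κ.ord.cof))).le)
    exact C.inf_θ.trans (this.trans (Order.le_succ _))
  have h2σ : ℵ₀ ≤ (2 : Cardinal.{u}) ^ σ := hσi.trans (cantor σ).le
  let Spl (Y b : Set X) : Prop := IsClopen b ∧ ν ≤ oo (Y ∩ b) ∧ ν ≤ oo (Y \ b)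
  let sp (Y : Set X) : Set X := if h : ∃ b, Spl Y b then h.choose else ∅
  have hsp : ∀ Y, (∃ b, Spl Y b) → Spl Y (sp Y) := by
    intro Y h
    simp only [sp, dif_pos h]
    exact h.choose_spec
  obtain ⟨M0, hM0, hcl0⟩ := closure_lemma (α := Set X) (ψ := σ) (Λ := 2 ^ σ) (cantor σ).le h2σ
    (fun s hs => by
      rw [← power_mul]
      exact power_le_power_left two_ne_zero ((mul_le_mul_right hs.le σ).trans (mul_eq_self hσi).le))
    (fun N => compl '' N ∪ {sp (⋂₀ N)}) (by
      intro N hN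
      refine (mk_union_le _ _).trans ?_
      refine add_le_of_le h2σ (mk_image_le.trans (hN.le.trans (cantor σ).le)) ?_
      rw [mk_singleton]; exact one_lt_aleph0.le.trans h2σ)
  let M : Set (Set X) := {b | b ∈ M0 ∧ IsClopen b}
  have hM : #M ≤ 2 ^ σ := (mk_le_mk_of_subset fun b hb => hb.1).trans hM0
  have hMc : ∀ b ∈ M, bᶜ ∈ M := by
    intro b hb
    refine ⟨hcl0 {b} (singleton_subset_iff.2 hb.1) ?_ (Or.inl ⟨b, rfl, rfl⟩), hb.2.compl⟩
    rw [mk_singleton]; exact one_lt_aleph0.trans_le hσi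
  have hMs : ∀ N ⊆ M, #N < σ → (∃ b, Spl (⋂₀ N) b) → sp (⋂₀ N) ∈ M := by
    intro N hN hNc h
    exact ⟨hcl0 N (fun b hb => (hN hb).1) hNc (Or.inr rfl), (hsp _ h).1⟩
  let Z : Set M → Set X := fun P => {x | ∀ b : M, b ∈ P ↔ x ∈ b.1}
  have hZsame : ∀ P, ∀ x ∈ Z P, ∀ y ∈ Z P, ∀ b ∈ M, x ∈ b → y ∈ b := by
    intro P x hx y hy b hb hxb
    exact (hy ⟨b, hb⟩).1 ((hx ⟨b, hb⟩).2 hxb)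
  have hZc : ∀ P, IsClosed (Z P) := by
    intro P
    have : Z P = ⋂ b : M, (if b ∈ P then b.1 else b.1ᶜ) := by
      ext x
      simp only [mem_iInter]
      refine forall_congr' fun b => ?_
      by_cases hb : b ∈ P <;> simp [hb]
    rw [this]
    refine isClosed_iInter fun b => ?_
    split_ifs
    · exact b.2.2.isClosed
    · exact b.2.2.compl.isClosed
  have hunspl : ∀ P b, ¬ Spl (Z P) b := by
    rintro P b ⟨hb, hb1, hb2⟩
    have hne : (Z P).Nonempty := by
      by_contra! hemp
      rw [hemp, empty_inter, oo_empty] at hb1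
      exact absurd (one_lt_aleph0.trans_le hν) (not_lt.2 hb1)
    obtain ⟨x, hx⟩ := hne
    have step : ∀ (a : WO σ) (f : ∀ b, b < a → {c : Set X // c ∈ M ∧ x ∈ c}), ∃ c : {c : Set X // c ∈ M ∧ x ∈ c},
        ν ≤ oo ((⋂₀ range (fun b : Iio a => (f b.1 b.2).1)) \ c.1) := by
      intro a f
      let N : Set (Set X) := range (fun b : Iio a => (f b.1 b.2).1)
      have hNM : N ⊆ M := by rintro _ ⟨b, rfl⟩; exact (f b.1 b.2).2.1
      have hNc : #N < σ := mk_range_le.trans_lt (mk_Iio_WO a)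
      have hZN : Z P ⊆ ⋂₀ N := by
        rintro y hy _ ⟨b, rfl⟩
        exact hZsame P x hx y hy _ (f b.1 b.2).2.1 (f b.1 b.2).2.2
      have hex : ∃ b, Spl (⋂₀ N) b := ⟨b, hb, hb1.trans (oo_mono (inter_subset_inter_left _ hZN)),
        hb2.trans (oo_mono (sdiff_subset_sdiff_left hZN))⟩
      have h1 := hsp _ hex
      have h2 := hMs N hNM hNc hex
      by_cases hxs : x ∈ sp (⋂₀ N)
      · exact ⟨⟨_, h2, hxs⟩, h1.2.2⟩
      · refine ⟨⟨_, hMc _ h2, hxs⟩, ?_⟩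
        rw [sdiff_compl]
        exact h1.2.1
    choose F hF using step
    let G : WO σ → {c : Set X // c ∈ M ∧ x ∈ c} := WellFounded.fix (wellFounded_lt (α := WO σ)) F
    have hG : ∀ a, G a = F a (fun b _ => G b) := fun a => WellFounded.fix_eq _ _ _
    let Y : WO σ → Set X := fun a => (⋂₀ range (fun b : Iio a => (G b.1).1)) \ (G a).1
    apply H
    refine ⟨Y, ?_, ?_, ?_⟩
    · intro a
      refine IsClosed.sdiff (isClosed_sInter ?_) (G a).2.1.2.isOpen
      rintro _ ⟨b, rfl⟩
      exact (G b.1).2.1.2.isClosed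
    · have main : ∀ a b, a < b → Disjoint (Y a) (Y b) := by
        intro a b hab
        rw [Set.disjoint_left]
        intro y hya hyb
        exact hya.2 (hyb.1 _ ⟨⟨a, hab⟩, rfl⟩)
      intro a b hab
      rcases lt_or_gt_of_ne hab with h | h
      · exact main a b h
      · exact (main b a h).symm
    · intro a
      have := hF a (fun b _ => G b)
      rw [← hG] at this
      exact this
  have hpt : ∀ P : {P // ν ≤ oo (Z P)}, ∃ x ∈ Z P.1, ∀ b, IsClopen b → x ∈ b → oo (Z P.1 \ b) < ν := by
    rintro ⟨P, hP⟩
    by_contra! hcon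
    choose! b hbc hxb hbo using hcon
    have hlt : ∀ x ∈ Z P, oo (Z P ∩ b x) < ν := by
      intro x hx
      by_contra! hle
      exact hunspl P (b x) ⟨hbc x hx, hle, hbo x hx⟩
    obtain ⟨t, ht⟩ := (hZc P).isCompact.elim_finite_subcover (fun x : Z P => b x.1) (fun x => (hbc x.1 x.2).isOpen)
      (fun x hx => mem_iUnion.2 ⟨⟨x, hx⟩, hxb x hx⟩)
    have h1 := oo_finset_lt hν t (fun x : Z P => Z P ∩ b x.1) (fun x => hlt x.1 x.2)
    have h2 : Z P ⊆ ⋃ x ∈ t, Z P ∩ b x.1 := by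
      intro y hy
      have := ht hy
      simp only [mem_iUnion] at this ⊢
      obtain ⟨i, hi, hyi⟩ := this
      exact ⟨i, hi, hy, hyi⟩
    exact absurd (hP.trans (oo_mono h2)) (not_le.2 h1)
  choose xz hxz hxo using hpt
  have h22 : (2 : Cardinal.{u}) ^ ((2 : Cardinal.{u}) ^ σ) < μ := C.sl.isStrongPrelimit (C.sl.isStrongPrelimit hσμ)
  have hnum : #(Set M) ≤ 2 ^ ((2 : Cardinal.{u}) ^ σ) := by
    rw [mk_set]; exact power_le_power_left two_ne_zero hM
  refine ⟨ν ^ ((2 : Cardinal.{u}) ^ ((2 : Cardinal.{u}) ^ σ)), C.pow _ hνκ _ h22, ?_⟩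
  have hnull : ∀ e, IsClopen e → e ∩ range xz = ∅ → oo e ≤ ν ^ ((2 : Cardinal.{u}) ^ ((2 : Cardinal.{u}) ^ σ)) := by
    intro e he hek
    have hU : e = ⋃ P : Set M, e ∩ Z P := by
      ext y
      simp only [mem_iUnion, mem_inter_iff]
      refine ⟨fun hy => ⟨{b | y ∈ b.1}, hy, fun b => Iff.rfl⟩, fun ⟨_, hy, _⟩ => hy⟩
    have h1 := oo_iUnion_le (fun P : Set M => e ∩ Z P)
    rw [← hU] at h1
    have h2 : ∀ P, oo (e ∩ Z P) ≤ ν := by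
      intro P
      by_cases hP : ν ≤ oo (Z P)
      · have h3 : xz ⟨P, hP⟩ ∈ eᶜ := by
          intro hmem
          have : xz ⟨P, hP⟩ ∈ e ∩ range xz := ⟨hmem, _, rfl⟩
          rw [hek] at this
          exact this
        have h4 := hxo ⟨P, hP⟩ eᶜ he.compl h3
        rw [sdiff_compl, inter_comm] at h4
        exact h4.le
      · exact (oo_mono inter_subset_right).trans (not_le.1 hP).le
    exact h1.trans ((prod_le_pow h2).trans (power_le_power_left (aleph0_pos.trans_le hν).ne' hnum))
  have hsub : (AA X (ν ^ ((2 : Cardinal.{u}) ^ ((2 : Cardinal.{u}) ^ σ))))ᶜ ⊆ closure (range xz) := by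
    intro x hx
    by_contra hxk
    obtain ⟨e, he, hxe, hes⟩ := exists_clopen (isClosed_closure (s := range xz)).isOpen_compl hxk
    apply hx
    refine ⟨e, ⟨he, hnull e he ?_⟩, hxe⟩
    rw [← subset_empty_iff]
    rintro y ⟨hy1, hy2⟩
    exact hes hy1 (subset_closure hy2)
  refine (mk_le_mk_of_subset hsub).trans_lt ((mk_closure_le _).trans_lt ?_)
  apply C.sl.isStrongPrelimit
  apply C.sl.isStrongPrelimit
  refine lt_of_le_of_lt ?_ h22
  exact mk_range_le.trans ((mk_subtype_le _).trans hnum)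

end


theorem max_family {α : Type u} (Q : α → Prop) (D : α → α → Prop) (hD : ∀ a b, D a b → D b a) :
    ∃ N : Set α, (∀ a ∈ N, Q a) ∧ (∀ a ∈ N, ∀ b ∈ N, a ≠ b → D a b) ∧
      ∀ a, Q a → (∀ n ∈ N, D a n) → a ∈ N := by
  obtain ⟨N, hN⟩ := zorn_subset {N : Set α | (∀ a ∈ N, Q a) ∧ (∀ a ∈ N, ∀ b ∈ N, a ≠ b → D a b)} (by
    intro c hc hch
    refine ⟨⋃₀ c, ⟨?_, ?_⟩, fun s hs => subset_sUnion_of_mem hs⟩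
    · rintro a ⟨s, hs, ha⟩
      exact (hc hs).1 a ha
    · rintro a ⟨s, hs, ha⟩ b ⟨t, ht, hb⟩ hab
      rcases hch.total hs ht with h | h
      · exact (hc ht).2 a (h ha) b hb hab
      · exact (hc hs).2 a ha b (h hb) hab)
  refine ⟨N, hN.prop.1, hN.prop.2, fun a ha hn => ?_⟩
  have : insert a N ∈ {N : Set α | (∀ a ∈ N, Q a) ∧ (∀ a ∈ N, ∀ b ∈ N, a ≠ b → D a b)} := by
    refine ⟨?_, ?_⟩
    · rintro x (rfl | hx)
      · exact ha
      · exact hN.prop.1 x hx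
    · rintro x (rfl | hx) y (rfl | hy) hxy
      · exact absurd rfl hxy
      · exact hn y hy
      · exact hD _ _ (hn x hx)
      · exact hN.prop.2 x hx y hy hxy
  exact hN.le_of_ge this (subset_insert a N) (mem_insert a N)

/-- few small subsets -/
theorem mk_small_subsets {α : Type u} {M : Set α} {ψ Λ : Cardinal.{u}} (hψΛ : ψ ≤ Λ) (hΛ : ℵ₀ ≤ Λ)
    (hpow : ∀ s < ψ, (#M) ^ s ≤ Λ) : #{N : Set α | N ⊆ M ∧ #N < ψ} ≤ Λ := by
  have : #{N : Set α | N ⊆ M ∧ #N < ψ} ≤ #(Σ i : WO ψ, (Iio i → M)) := by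
    refine mk_le_of_surjective (f := fun p : (Σ i : WO ψ, (Iio i → M)) =>
      (⟨range fun j => (p.2 j).1, by rintro x ⟨j, rfl⟩; exact (p.2 j).2,
        mk_range_le.trans_lt (mk_Iio_WO p.1)⟩ : {N : Set α | N ⊆ M ∧ #N < ψ})) ?_
    rintro ⟨N, hNM, hN⟩
    obtain ⟨i, hi⟩ := exists_mk_Iio_WO hN
    obtain ⟨e⟩ := Cardinal.eq.1 hi
    refine ⟨⟨i, fun j => ⟨(e j).1, hNM (e j).2⟩⟩, ?_⟩
    apply Subtype.ext
    ext x
    constructor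
    · rintro ⟨j, rfl⟩
      exact (e j).2
    · intro hx
      exact ⟨e.symm ⟨x, hx⟩, by simp⟩
  refine this.trans ?_
  rw [mk_sigma]
  refine (sum_le_sum _ (fun _ => Λ) fun i => ?_).trans ?_
  · rw [← power_def]
    exact hpow _ (mk_Iio_WO i)
  · rw [sum_const', mk_WO]
    exact (mul_le_mul_left hψΛ _).trans (mul_eq_self hΛ).le

section
variable {X : Type u} [TopologicalSpace X]

/-- every discrete family in `W` has size `< r` -/
def NoDisc (r : Cardinal.{u}) (W : Set X) : Prop :=
  ∀ (ι : Type u) (x : ι → X), Disc x → (∀ i, x i ∈ W) → #ι < r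

def Anti (ψ : Cardinal.{u}) (Z : Set X) : Prop :=
  ∀ N : Set (Set X), (∀ b ∈ N, IsClopen b ∧ (b ∩ Z).Nonempty) →
    (∀ b ∈ N, ∀ c ∈ N, b ≠ c → b ∩ c ∩ Z = ∅) → #N < ψ

theorem NoDisc.mono {r : Cardinal.{u}} {W W' : Set X} (h : NoDisc r W) (hs : W' ⊆ W) : NoDisc r W' :=
  fun ι x hx hm => h ι x hx fun i => hs (hm i)

theorem NoDisc.anti {r : Cardinal.{u}} {Z : Set X} (h : NoDisc r Z) : Anti r Z := by
  intro N hN hd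
  choose x hx using fun b : N => (hN b.1 b.2).2
  refine h N x ⟨fun b => b.1, fun b => ⟨(hN b.1 b.2).1.isOpen, ?_, ?_⟩⟩ fun b => (hx b).2
  · rintro _ rfl
    exact (hx b).1
  · intro k hk
    rw [← subset_empty_iff]
    rintro y ⟨hy, rfl⟩
    rw [← hd b.1 b.2 k.1 k.2 (fun e => hk (Subtype.ext e).symm)]
    exact ⟨⟨hy, (hx k).1⟩, (hx k).2⟩

variable [CompactSpace X] [T2Space X] [TotallyDisconnectedSpace X]

theorem reaping {Z c : Set X} {r Λ : Cardinal.{u}} (hr : ℵ₀ ≤ r) (hrΛ : r ≤ Λ)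
    (hd : NoDisc r (closure Z)) (hc : IsClopen c) (hcZ : (c ∩ Z).Nonempty) :
    ∃ R : Set (Set X), #R ≤ Λ ∧ (∀ d ∈ R, IsClopen d ∧ d ⊆ c ∧ (d ∩ Z).Nonempty) ∧
      ∀ b, IsClopen b → ∃ d ∈ R, d ∩ Z ⊆ b ∨ d ∩ b ∩ Z = ∅ := by
  classical
  by_contra hcon
  have hspl : ∀ R : Set (Set X), ∃ b, #R ≤ Λ → (∀ d ∈ R, IsClopen d ∧ d ⊆ c ∧ (d ∩ Z).Nonempty) →
      IsClopen b ∧ ∀ d ∈ R, ¬ d ∩ Z ⊆ b ∧ (d ∩ b ∩ Z).Nonempty := by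
    intro R
    by_contra h
    push Not at h
    apply hcon
    refine ⟨R, (h ∅).1, (h ∅).2.1, fun b hb => ?_⟩
    obtain ⟨d, hd, h1⟩ := (h b).2.2 hb
    refine ⟨d, hd, ?_⟩
    by_cases h2 : d ∩ Z ⊆ b
    · exact Or.inl h2
    · exact Or.inr (h1 h2)
  choose sp hsp using hspl
  let cb : ∀ i : WO r, ((j : WO r) → j < i → Set X) → Finset (Iio i × Bool) → Set X :=
    fun i f u => c ∩ ⋂ p ∈ u, if p.2 then f p.1.1 p.1.2 else (f p.1.1 p.1.2)ᶜ
  let F : ∀ i : WO r, ((j : WO r) → j < i → Set X) → Set X :=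
    fun i f => sp {d | (∃ u, d = cb i f u) ∧ (d ∩ Z).Nonempty}
  obtain ⟨b, hb⟩ : ∃ b : WO r → Set X, ∀ i,
      b i = sp {d | (∃ u, d = cb i (fun j _ => b j) u) ∧ (d ∩ Z).Nonempty} :=
    ⟨WellFounded.fix (wellFounded_lt (α := WO r)) F,
      fun i => WellFounded.fix_eq (wellFounded_lt (α := WO r)) F i⟩
  have hcard : ∀ i : WO r, ∀ f, #{d | (∃ u, d = cb i f u) ∧ (d ∩ Z).Nonempty} ≤ Λ := by
    intro i f
    have h1 : #{d | (∃ u, d = cb i f u) ∧ (d ∩ Z).Nonempty} ≤ #(Finset (Iio i × Bool)) := by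
      refine (mk_le_mk_of_subset (t := range (cb i f)) ?_).trans mk_range_le
      rintro d ⟨⟨u, rfl⟩, _⟩
      exact ⟨u, rfl⟩
    have h2 : #(Iio i × Bool) ≤ r := by
      rw [mk_prod]
      have h3 : lift.{u} #Bool = 2 := by simp
      rw [h3, lift_uzero]
      refine (mul_lt_of_lt hr (mk_Iio_WO i) ?_).le
      exact (natCast_lt_aleph0 (n := 2)).trans_le hr
    refine (h1.trans ?_).trans hrΛ
    rcases finite_or_infinite (Iio i × Bool) with h | h
    · exact (lt_aleph0_of_finite _).le.trans hr
    · rw [mk_finset_of_infinite]; exact h2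
  have hclo : ∀ i, IsClopen (b i) := by
    intro i
    induction i using WellFoundedLT.induction with
    | ind i ih =>
      have := hsp {d | (∃ u, d = cb i (fun j _ => b j) u) ∧ (d ∩ Z).Nonempty} (hcard i (fun j _ => b j)) (by
        rintro d ⟨⟨u, rfl⟩, hne⟩
        refine ⟨?_, inter_subset_left, hne⟩
        refine hc.inter (isClopen_biInter_finset fun p _ => ?_)
        split_ifs
        · exact ih _ p.1.2
        · exact (ih _ p.1.2).compl)
      rw [← hb i] at this
      exact this.1
  have hspl : ∀ i, ∀ u : Finset (Iio i × Bool), (cb i (fun j _ => b j) u ∩ Z).Nonempty →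
      ¬ cb i (fun j _ => b j) u ∩ Z ⊆ b i ∧ (cb i (fun j _ => b j) u ∩ b i ∩ Z).Nonempty := by
    intro i u hne
    have := hsp {d | (∃ u, d = cb i (fun j _ => b j) u) ∧ (d ∩ Z).Nonempty} (hcard i (fun j _ => b j)) (by
        rintro d ⟨⟨u, rfl⟩, hne⟩
        refine ⟨?_, inter_subset_left, hne⟩
        refine hc.inter (isClopen_biInter_finset fun p _ => ?_)
        split_ifs
        · exact hclo _
        · exact (hclo _).compl)
    rw [← hb i] at this
    exact this.2 _ ⟨⟨u, rfl⟩, hne⟩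
  have hind : ∀ g : WO r → Bool, ∀ u : Finset (WO r),
      ((c ∩ ⋂ i ∈ u, if g i then b i else (b i)ᶜ) ∩ Z).Nonempty := by
    intro g u
    induction u using Finset.induction_on_max with
    | empty => simpa using hcZ
    | insert a s hs ih =>
      let u' : Finset (Iio a × Bool) := s.attach.image fun j => (⟨j.1, hs j.1 j.2⟩, g j.1)
      have he : (c ∩ ⋂ i ∈ s, if g i then b i else (b i)ᶜ) = cb a (fun j _ => b j) u' := by
        ext x
        simp only [cb, u', mem_inter_iff, mem_iInter, Finset.mem_image, Finset.mem_attach, true_and]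
        constructor
        · rintro ⟨h1, h2⟩
          refine ⟨h1, ?_⟩
          rintro _ ⟨j, rfl⟩
          exact h2 j.1 j.2
        · rintro ⟨h1, h2⟩
          exact ⟨h1, fun i hi => h2 (⟨i, hs i hi⟩, g i) ⟨⟨i, hi⟩, rfl⟩⟩
      have he2 : (c ∩ ⋂ i ∈ insert a s, if g i then b i else (b i)ᶜ) =
          cb a (fun j _ => b j) u' ∩ (if g a then b a else (b a)ᶜ) := by
        rw [← he, Finset.set_biInter_insert, inter_assoc, inter_comm (⋂ i ∈ s, _)]
      rw [he] at ih
      have := hspl a u' ih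
      rw [he2]
      cases g a with
      | true => simpa using this.2
      | false =>
        obtain ⟨x, hx, hx2⟩ := not_subset.1 this.1
        exact ⟨x, ⟨hx.1, by simpa using hx2⟩, hx.2⟩
  have hpt : ∀ a : WO r, ∃ x, x ∈ closure Z ∧ ∀ i, x ∈ (if i = a then b i else (b i)ᶜ) := by
    intro a
    have := (isClosed_closure (s := Z)).isCompact.inter_iInter_nonempty
      (fun i => if i = a then b i else (b i)ᶜ) (fun i => by
        split_ifs
        · exact (hclo i).isClosed
        · exact (hclo i).compl.isClosed) (fun u => by
        obtain ⟨x, hx, hxZ⟩ := hind (fun i => decide (i = a)) u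
        exact ⟨x, subset_closure hxZ, by simpa using hx.2⟩)
    obtain ⟨x, hx, hx2⟩ := this
    exact ⟨x, hx, fun i => mem_iInter.1 hx2 i⟩
  choose x hx hx2 using hpt
  have := hd (WO r) x ⟨b, fun j => ⟨(hclo j).isOpen, ?_, ?_⟩⟩ hx
  · rw [mk_WO] at this
    exact lt_irrefl _ this
  · rintro _ rfl
    have := hx2 j j
    simpa using this
  · intro k hk
    rw [← subset_empty_iff]
    rintro y ⟨hy, rfl⟩
    have := hx2 k j
    rw [if_neg (Ne.symm hk)] at this
    exact this hy

theorem BA_gen {Z : Set X} {r Λ ψ : Cardinal.{u}} (hr : ℵ₀ ≤ r) (hrΛ : r ≤ Λ) (hψΛ : ψ ≤ Λ)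
    (hpow : ∀ s < ψ, Λ ^ s ≤ Λ)
    (hd : NoDisc r (closure Z)) (ha : Anti ψ Z) : ww Z ≤ Λ := by
  classical
  have hΛ : ℵ₀ ≤ Λ := hr.trans hrΛ
  choose R hR using fun c : Set X => (show ∃ R : Set (Set X), IsClopen c → (c ∩ Z).Nonempty → 
      #R ≤ Λ ∧ (∀ d ∈ R, IsClopen d ∧ d ⊆ c ∧ (d ∩ Z).Nonempty) ∧
      ∀ b, IsClopen b → ∃ d ∈ R, d ∩ Z ⊆ b ∨ d ∩ b ∩ Z = ∅ by
    by_cases h : IsClopen c ∧ (c ∩ Z).Nonempty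
    · obtain ⟨R, hR⟩ := reaping hr hrΛ hd h.1 h.2
      exact ⟨R, fun _ _ => hR⟩
    · exact ⟨∅, fun h1 h2 => absurd ⟨h1, h2⟩ h⟩)
  let good : Set (Set X) → Set X → Prop := fun N c => IsClopen c ∧ (c ∩ Z).Nonempty ∧ ∀ n ∈ N, c ∩ n ∩ Z = ∅
  let Op : Set (Set X) → Set (Set X) := fun N => if h : ∃ c, good N c then R h.choose else ∅
  obtain ⟨M, hM, hcl⟩ := closure_lemma hψΛ hΛ hpow Op (by
    intro N _
    by_cases h : ∃ c, good N c
    · simp only [Op, dif_pos h]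
      exact (hR _ h.choose_spec.1 h.choose_spec.2.1).1
    · simp only [Op, dif_neg h]
      simp)
  have key : ∀ b : Set X, IsClopen b → ∃ N : Set (Set X), N ⊆ M ∧ #N < ψ ∧
      (∀ n ∈ N, n ∩ Z ⊆ b ∨ n ∩ b ∩ Z = ∅) ∧ Z ⊆ closure (⋃₀ N ∩ Z) := by
    intro b hb
    obtain ⟨N, h1, h2, h3⟩ := max_family (fun d : Set X => d ∈ M ∧ IsClopen d ∧ (d ∩ Z).Nonempty ∧
      (d ∩ Z ⊆ b ∨ d ∩ b ∩ Z = ∅)) (fun d e => d ∩ e ∩ Z = ∅) (fun d e h => by rwa [inter_comm e d])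
    have hN := ha N (fun n hn => ⟨(h1 n hn).2.1, (h1 n hn).2.2.1⟩) h2
    have hNM : N ⊆ M := fun n hn => (h1 n hn).1
    refine ⟨N, hNM, hN, fun n hn => (h1 n hn).2.2.2, ?_⟩
    by_contra hnd
    obtain ⟨z, hz, hzc⟩ := not_subset.1 hnd
    obtain ⟨c, hc, hzc1, hcs⟩ := exists_clopen (isClosed_closure (s := ⋃₀ N ∩ Z)).isOpen_compl hzc
    have hg : ∃ c, good N c := ⟨c, hc, ⟨z, hzc1, hz⟩, fun n hn => by
      rw [← subset_empty_iff]
      rintro y ⟨⟨hy1, hy2⟩, hy3⟩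
      exact hcs hy1 (subset_closure ⟨⟨n, hn, hy2⟩, hy3⟩)⟩
    have h4 := hcl N hNM hN
    simp only [Op, dif_pos hg] at h4
    obtain ⟨g1, g2, g3⟩ := hg.choose_spec
    obtain ⟨-, k2, k3⟩ := hR _ g1 g2
    obtain ⟨d, hd, hdb⟩ := k3 b hb
    have hsub : ∀ n ∈ N, d ∩ n ∩ Z = ∅ := by
      intro n hn
      rw [← subset_empty_iff, ← g3 n hn]
      exact inter_subset_inter_left _ (inter_subset_inter_left _ (k2 d hd).2.1)
    have hdN := h3 d ⟨h4 hd, (k2 d hd).1, (k2 d hd).2.2, hdb⟩ hsub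
    have h5 := hsub d hdN
    rw [inter_self] at h5
    exact (k2 d hd).2.2.ne_empty h5
  choose! N hNM hN hdec hden using key
  have h1 := mk_small_subsets hψΛ hΛ (fun s hs => (power_le_power_right hM).trans (hpow s hs))
  have h2 : ww Z ≤ #({N : Set (Set X) | N ⊆ M ∧ #N < ψ} × {N : Set (Set X) | N ⊆ M ∧ #N < ψ}) := by
    unfold ww
    have key : ∀ t : ((fun b => b ∩ Z) '' {b : Set X | IsClopen b} : Set (Set X)),
      ∃ b, IsClopen b ∧ b ∩ Z = t.1 := fun t => t.2
    choose b hb hbt using key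
    refine mk_le_of_injective (f := fun t => (⟨N (b t), hNM _ (hb t), hN _ (hb t)⟩,
      ⟨{n | n ∈ N (b t) ∧ n ∩ Z ⊆ b t}, fun n hn => hNM _ (hb t) hn.1,
        (mk_le_mk_of_subset fun n hn => hn.1).trans_lt (hN _ (hb t))⟩)) ?_
    intro s t hst
    simp only [Prod.mk.injEq, Subtype.mk.injEq] at hst
    obtain ⟨e1, e2⟩ := hst
    apply Subtype.ext
    rw [← hbt s, ← hbt t]
    have aux : ∀ s t, N (b s) = N (b t) → {n | n ∈ N (b s) ∧ n ∩ Z ⊆ b s} = {n | n ∈ N (b t) ∧ n ∩ Z ⊆ b t} →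
        b s ∩ (⋃₀ N (b s) ∩ Z) ⊆ b t ∩ (⋃₀ N (b s) ∩ Z) := by
      rintro s t e1 e2 x ⟨hx, ⟨n, hn, hxn⟩, hxZ⟩
      refine ⟨?_, ⟨n, hn, hxn⟩, hxZ⟩
      rcases hdec _ (hb s) n hn with h | h
      · have : n ∈ {n | n ∈ N (b t) ∧ n ∩ Z ⊆ b t} := e2 ▸ ⟨hn, h⟩
        exact this.2 ⟨hxn, hxZ⟩
      · exact absurd (show x ∈ n ∩ b s ∩ Z from ⟨⟨hxn, hx⟩, hxZ⟩) (by rw [h]; simp)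
    apply clopen_inter_eq_of_dense (hden _ (hb s)) inter_subset_right (hb s) (hb t)
    apply Subset.antisymm
    · exact aux s t e1 e2
    · have := aux t s e1.symm e2.symm
      rwa [← e1] at this
  refine h2.trans ?_
  rw [← mul_def]
  exact (mul_le_mul' h1 h1).trans (mul_eq_self hΛ).le

theorem BA_basic {Z : Set X} {S : Cardinal.{u}} (hS : ℵ₀ ≤ S) (hd : NoDisc (Order.succ S) (closure Z)) :
    ww Z ≤ 2 ^ S := by
  have h1 : Order.succ S ≤ 2 ^ S := Order.succ_le_of_lt (cantor S)
  refine BA_gen (hS.trans (Order.le_succ S)) h1 h1 ?_ hd (hd.mono subset_closure).anti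
  intro s hs
  rw [← power_mul]
  exact power_le_power_left two_ne_zero
    ((mul_le_mul_right (Order.lt_succ_iff.1 hs) S).trans (mul_eq_self hS).le)

end


section
variable {X : Type u} [TopologicalSpace X]

theorem Ctx.sep_lt {μ κ r0 : Cardinal.{u}} (C : Ctx μ κ r0) (NS : oo (univ : Set X) < κ ^ κ.ord.cof)
    {J : Type u} {G : J → Set X} (h : Sep G) (hn : ∀ j, (G j).Nonempty) : #J < r0 := by
  by_contra hJ
  have hJ := not_lt.1 hJ
  have h1 : κ ≤ 2 ^ #J := C.r0_le.trans (power_le_power_left two_ne_zero hJ)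
  have h2 := gap (C.inf_r0.trans hJ) (C.θ_lt_r0.le.trans hJ) C.θ0 h1
  exact absurd NS (not_lt.2 (h2.trans ((two_pow_le_of_sep h hn).trans (oo_mono (subset_univ _)))))

theorem Ctx.noDisc {μ κ r0 : Cardinal.{u}} (C : Ctx μ κ r0) (NS : oo (univ : Set X) < κ ^ κ.ord.cof)
    (W : Set X) : NoDisc r0 W := fun _ _ hx _ => C.sep_lt NS hx fun _ => singleton_nonempty _

theorem Ctx.prod_bound {μ κ r0 : Cardinal.{u}} (C : Ctx μ κ r0) (NS : oo (univ : Set X) < κ ^ κ.ord.cof)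
    (hΛ : (2 : Cardinal.{u}) ^< r0 < κ) {τ : Cardinal.{u}} (hτ : τ < κ) :
    ∃ κs < κ, ∀ (J : Type u) (G : J → Set X), Sep G → (∀ j, (G j).Nonempty) → (∀ j, oo (G j) ≤ τ) →
      (Cardinal.prod fun j => oo (G j)) ≤ κs := by
  obtain ⟨κs, h1, h2⟩ := C.lemmaE hΛ hτ
  exact ⟨κs, h1, fun J G hG hn ht => h2 J _ (C.sep_lt NS hG hn) (fun j => one_le_oo _) ht
    ((prod_oo_le_univ hG).trans_lt NS)⟩

theorem nP_count {Z : Set X} {P : Set X → Prop} {τ ψ Λ b : Cardinal.{u}} (hψΛ : ψ ≤ Λ) (hΛ : ℵ₀ ≤ Λ)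
    (hw : ∀ s < ψ, (ww Z) ^ s ≤ Λ)
    (hP : ∀ S ⊆ Z, P S → ∃ N : Set (Set X), (∀ e ∈ N, IsClopen e ∧ oo e ≤ τ ∧ (e ∩ S).Nonempty) ∧
      (∀ e ∈ N, ∀ f ∈ N, e ≠ f → e ∩ f ∩ S = ∅) ∧ S ⊆ closure (⋃₀ N ∩ S) ∧ #N < ψ)
    (hb : ∀ (J : Type u) (G : J → Set X), Sep G → (∀ j, (G j).Nonempty) → (∀ j, oo (G j) ≤ τ) →
      #J < ψ → (Cardinal.prod fun j => oo (G j)) ≤ b) : nP P Z ≤ Λ * b := by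
  classical
  let M : Set (Set X) := (fun b => b ∩ Z) '' {b : Set X | IsClopen b}
  let sv : Set (Set X) → Set X → Set X := fun ℰ E => E \ ⋃₀ (ℰ \ {E})
  let 𝔈 : Set (Set (Set X)) := {ℰ | ℰ ⊆ M ∧ #ℰ < ψ}
  let ok : Set (Set X) → Prop := fun ℰ => Sep (fun E : ℰ => sv ℰ E.1) ∧ (∀ E : ℰ, (sv ℰ E.1).Nonempty) ∧
    ∀ E : ℰ, oo (sv ℰ E.1) ≤ τ
  have hM : #𝔈 ≤ Λ := mk_small_subsets hψΛ hΛ hw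
  let T := Σ ℰ : {ℰ : 𝔈 // ok ℰ.1}, ∀ E : ℰ.1.1,
    (closure '' {S : Set X | S ⊆ sv ℰ.1.1 E.1 ∧ True} : Set (Set X))
  have h1 : nP P Z ≤ #T := by
    let F : T → Set X := fun p => closure (⋃ E, (p.2 E).1)
    refine le_trans (mk_le_mk_of_subset (t := range F) ?_) mk_range_le
    rintro _ ⟨S, ⟨hSZ, hPS⟩, rfl⟩
    obtain ⟨N, hN1, hN2, hN3, hN4⟩ := hP S hSZ hPS
    let ℰ : Set (Set X) := (fun e => e ∩ Z) '' N
    have hℰM : ℰ ⊆ M := by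
      rintro _ ⟨e, he, rfl⟩
      exact ⟨e, (hN1 e he).1, rfl⟩
    have hE : ℰ ∈ 𝔈 := ⟨hℰM, mk_image_le.trans_lt hN4⟩
    choose e heN heE using fun E : ℰ => E.2
    simp only at heE
    have hsub : ∀ E : ℰ, e E ∩ S ⊆ sv ℰ E.1 := by
      rintro E x ⟨hx1, hx2⟩
      refine ⟨by rw [← heE E]; exact ⟨hx1, hSZ hx2⟩, ?_⟩
      rintro ⟨E', ⟨hE', hne⟩, hx3⟩
      have hx3 : x ∈ e ⟨E', hE'⟩ ∩ Z := by rw [heE ⟨E', hE'⟩]; exact hx3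
      have hne2 : e E ≠ e ⟨E', hE'⟩ := by
        intro h
        apply hne
        have h1 := heE E
        rw [h, heE ⟨E', hE'⟩] at h1
        exact h1
      have := hN2 _ (heN E) _ (heN ⟨E', hE'⟩) hne2
      rw [← mem_empty_iff_false x, ← this]
      exact ⟨⟨hx1, hx3.1⟩, hx2⟩
    have hok : ok ℰ := by
      refine ⟨⟨e, fun E => ⟨(hN1 _ (heN E)).1.isOpen, ?_, ?_⟩⟩, ?_, ?_⟩
      · intro x hx
        have := hx.1
        rw [← heE E] at this
        exact this.1
      · intro E' hne
        rw [← subset_empty_iff]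
        rintro x ⟨hx1, hx2, hx3⟩
        apply hx3
        refine ⟨E.1, ⟨E.2, fun h => hne (Subtype.ext h.symm)⟩, ?_⟩
        rw [← heE E]
        refine ⟨hx1, ?_⟩
        rw [← heE E'] at hx2
        exact hx2.2
      · intro E
        exact (hN1 _ (heN E)).2.2.mono (hsub E)
      · intro E
        refine (oo_mono ?_).trans (hN1 _ (heN E)).2.1
        intro x hx
        have := hx.1
        rw [← heE E] at this
        exact this.1
    refine ⟨⟨⟨⟨ℰ, hE⟩, hok⟩, fun E => ⟨closure (e E ∩ S), _, ⟨hsub E, trivial⟩, rfl⟩⟩, ?_⟩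
    apply Subset.antisymm
    · refine closure_minimal ?_ isClosed_closure
      exact iUnion_subset fun E => closure_mono inter_subset_right
    · refine closure_minimal ?_ isClosed_closure
      refine hN3.trans (closure_mono ?_)
      rintro x ⟨⟨n, hn, hxn⟩, hxS⟩
      refine mem_iUnion.2 ⟨⟨n ∩ Z, n, hn, rfl⟩, subset_closure ⟨?_, hxS⟩⟩
      have : x ∈ e ⟨n ∩ Z, n, hn, rfl⟩ ∩ Z := by rw [heE ⟨n ∩ Z, n, hn, rfl⟩]; exact ⟨hxn, hSZ hxS⟩
      exact this.1
  refine h1.trans ?_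
  rw [mk_sigma]
  refine (sum_le_sum _ (fun _ => b) fun ℰ => ?_).trans ?_
  · rw [mk_pi]
    exact hb _ _ ℰ.2.1 ℰ.2.2.1 ℰ.2.2.2 ℰ.1.2.2
  · rw [sum_const']
    exact mul_le_mul_left ((mk_subtype_le _).trans hM) _

variable [CompactSpace X] [T2Space X] [TotallyDisconnectedSpace X]

/-- maximal families of clopens with disjoint traces -/
theorem dense_family (S : Set X) (Q : Set X → Prop)
    (hQ : ∀ c, IsClopen c → (c ∩ S).Nonempty → ∃ d, IsClopen d ∧ d ⊆ c ∧ (d ∩ S).Nonempty ∧ Q d) :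
    ∃ N : Set (Set X), (∀ e ∈ N, IsClopen e ∧ Q e ∧ (e ∩ S).Nonempty) ∧
      (∀ e ∈ N, ∀ f ∈ N, e ≠ f → e ∩ f ∩ S = ∅) ∧ S ⊆ closure (⋃₀ N ∩ S) := by
  obtain ⟨N, h1, h2, h3⟩ := max_family (fun d : Set X => IsClopen d ∧ Q d ∧ (d ∩ S).Nonempty)
     (fun d e => d ∩ e ∩ S = ∅) (fun d e h => by rwa [inter_comm e d])
  refine ⟨N, h1, h2, ?_⟩
  by_contra hnd
  obtain ⟨z, hz, hzc⟩ := not_subset.1 hnd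
  obtain ⟨c, hc, hzc1, hcs⟩ := exists_clopen (isClosed_closure (s := ⋃₀ N ∩ S)).isOpen_compl hzc
  obtain ⟨d, hd, hdc, hdS, hdQ⟩ := hQ c hc ⟨z, hzc1, hz⟩
  have h4 : ∀ n ∈ N, d ∩ n ∩ S = ∅ := by
    intro n hn
    rw [← subset_empty_iff]
    rintro y ⟨⟨hy1, hy2⟩, hy3⟩
    exact hcs (hdc hy1) (subset_closure ⟨⟨n, hn, hy2⟩, hy3⟩)
  have h5 := h4 d (h3 d ⟨hd, hdQ, hdS⟩ h4)
  rw [inter_self] at h5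
  exact hdS.ne_empty h5

theorem null_sub {τ : Cardinal.{u}} {S c : Set X} (hS : S ⊆ AA X τ) (hc : IsClopen c) (h : (c ∩ S).Nonempty) :
    ∃ d, IsClopen d ∧ d ⊆ c ∧ (d ∩ S).Nonempty ∧ oo d ≤ τ := by
  obtain ⟨x, hx, hxS⟩ := h
  obtain ⟨e, ⟨he, het⟩, hxe⟩ := hS hxS
  exact ⟨c ∩ e, hc.inter he, inter_subset_left, ⟨x, ⟨hx, hxe⟩, hxS⟩, (oo_mono inter_subset_right).trans het⟩

/-- counting closures of subsets of `Z` -/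
theorem oo_count {Z : Set X} {τ ψ Λ b : Cardinal.{u}} (hψΛ : ψ ≤ Λ) (hΛ : ℵ₀ ≤ Λ)
    (hZ : Z ⊆ AA X τ) (hw : ∀ s < ψ, (ww Z) ^ s ≤ Λ) (hd : NoDisc ψ Z)
    (hb : ∀ (J : Type u) (G : J → Set X), Sep G → (∀ j, (G j).Nonempty) → (∀ j, oo (G j) ≤ τ) →
      #J < ψ → (Cardinal.prod fun j => oo (G j)) ≤ b) : oo Z ≤ Λ * b := by
  refine nP_count (τ := τ) hψΛ hΛ hw ?_ hb
  intro S hS _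
  obtain ⟨N, h1, h2, h3⟩ := dense_family S (fun d => oo d ≤ τ)
    (fun c hc h => null_sub (hS.trans hZ) hc h)
  exact ⟨N, h1, h2, h3, (hd.mono hS).anti N (fun b hb => ⟨(h1 b hb).1, (h1 b hb).2.2⟩) h2⟩

/-- counting, case Λ<κ, small weight -/
theorem Ctx.count_small {μ κ r0 : Cardinal.{u}} (C : Ctx μ κ r0) (NS : oo (univ : Set X) < κ ^ κ.ord.cof)
    (hΛ : (2 : Cardinal.{u}) ^< r0 < κ) {τ : Cardinal.{u}} (hτ : τ < κ) {Z : Set X} (hZ : Z ⊆ AA X τ)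
    {r : Cardinal.{u}} (hr : r < r0) (hw : ww Z ≤ 2 ^ r) : oo Z < κ := by
  obtain ⟨κs, h1, h2⟩ := C.prod_bound NS hΛ hτ
  have h3 : oo Z ≤ ((2 : Cardinal.{u}) ^< r0) * κs := by
    refine oo_count r0_le_powerlt (C.inf_r0.trans r0_le_powerlt) hZ ?_ (C.noDisc NS Z)
      (fun J G a b c _ => h2 J G a b c)
    intro s hs
    refine (power_le_power_right hw).trans ?_
    rw [← power_mul]
    exact le_powerlt _ (mul_lt_of_lt C.inf_r0 hr hs)
  exact h3.trans_lt (C.mul_lt hΛ h1)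

end


theorem free_columns {q : Cardinal.{u}} (hq : ℵ₀ ≤ q) {s : Type u} [LinearOrder s] [WellFoundedLT s]
    (hs : #s ≤ q) (W : s → Type u) (hW : ∀ k, (#(W k)).IsRegular)
    (hW2 : ∀ k, Order.succ (Order.succ q) < #(W k))
    (bad : ∀ k, WO (Order.succ (Order.succ q)) → W k → Set (WO (Order.succ (Order.succ q))))
    (hbad : ∀ k ζ j, #(bad k ζ j) ≤ q) :
    ∃ ζ : s → WO (Order.succ (Order.succ q)), ∃ V : ∀ k, Set (W k), (∀ k, #(V k) = #(W k)) ∧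
      ∀ k l, k ≠ l → ∀ j ∈ V k, ζ l ∉ bad k (ζ k) j := by
  classical
  have hq1 : ℵ₀ ≤ Order.succ q := hq.trans (Order.le_succ q)
  have hq2 : ℵ₀ ≤ Order.succ (Order.succ q) := hq1.trans (Order.le_succ _)
  have c1 : (Order.succ q).ord.cof = Order.succ q := (isRegular_succ hq).cof_ord
  have c2 : (Order.succ (Order.succ q)).ord.cof = Order.succ (Order.succ q) := (isRegular_succ hq1).cof_ord
  have lt1 : q < Order.succ q := Order.lt_succ q
  have lt2 : Order.succ q < Order.succ (Order.succ q) := Order.lt_succ _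
  let Q := WO (Order.succ (Order.succ q))
  let P : Q → Q → Prop := fun a ζ => ∀ k, ∃ h : Q, ∃ V : Set (W k), #V = #(W k) ∧
    ∀ j ∈ V, (∀ y ∈ bad k ζ j, y < ζ → y ≤ a) ∧ ∀ y ∈ bad k ζ j, y < h
  have hP : ∃ a, ∀ y, ∃ ζ, P a ζ ∧ y < ζ := by
    by_contra! hcon
    choose g hg using hcon
    have step : ∀ (i : WO (Order.succ q)) (f : ∀ j, j < i → Q), ∃ y, ∀ j (hj : j < i), f j hj < y ∧ g (f j hj) < y := by
      intro i f
      have h0 : #(Iio i) < (Order.succ (Order.succ q)).ord.cof := by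
        rw [c2]; exact (mk_Iio_WO i).trans lt2
      obtain ⟨y1, h1⟩ := exists_bound_WO (fun j : Iio i => f j.1 j.2) h0
      obtain ⟨y2, h2⟩ := exists_bound_WO (fun j : Iio i => g (f j.1 j.2)) h0
      exact ⟨max y1 y2, fun j hj => ⟨lt_max_of_lt_left (h1 ⟨j, hj⟩), lt_max_of_lt_right (h2 ⟨j, hj⟩)⟩⟩
    choose F hF using step
    obtain ⟨f, hf⟩ : ∃ f : WO (Order.succ q) → Q, ∀ i, f i = F i (fun j _ => f j) :=
      ⟨WellFounded.fix (wellFounded_lt (α := WO (Order.succ q))) F,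
        fun i => WellFounded.fix_eq (wellFounded_lt (α := WO (Order.succ q))) F i⟩
    have hf2 : ∀ i j, j < i → f j < f i ∧ g (f j) < f i := by
      intro i j hji
      rw [hf i]
      exact hF i (fun j _ => f j) j hji
    obtain ⟨ζ, hζ, hmin⟩ := WellFounded.has_min (wellFounded_lt (α := Q)) {ζ | ∀ i, f i < ζ}
      (exists_bound_WO f (by rw [c2, mk_WO]; exact lt2))
    have hcof : ∀ y, y < ζ → ∃ i, y ≤ f i := by
      intro y hy
      by_contra! h
      exact hmin y h hy
    have hlo : ∀ k (j : W k), ∃ ξ : WO (Order.succ q), ∀ y ∈ bad k ζ j, y < ζ → y ≤ f ξ := by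
      intro k j
      have : ∀ y : bad k ζ j, ∃ ξ, y.1 < ζ → y.1 ≤ f ξ := by
        intro y
        by_cases h : y.1 < ζ
        · obtain ⟨i, hi⟩ := hcof _ h
          exact ⟨i, fun _ => hi⟩
        · obtain ⟨z⟩ := nonempty_WO hq1
          exact ⟨z, fun h' => absurd h' h⟩
      choose ξ hξ using this
      obtain ⟨i, hi⟩ := exists_bound_WO ξ (by rw [c1]; exact (hbad k ζ j).trans_lt lt1)
      exact ⟨i, fun y hy hyζ => (hξ ⟨y, hy⟩ hyζ).trans (hf2 _ _ (hi ⟨y, hy⟩)).1.le⟩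
    have hhi : ∀ k (j : W k), ∃ h : Q, ∀ y ∈ bad k ζ j, y < h := by
      intro k j
      obtain ⟨i, hi⟩ := exists_bound_WO (fun y : bad k ζ j => y.1)
        (by rw [c2]; exact (hbad k ζ j).trans_lt (lt1.trans lt2))
      exact ⟨i, fun y hy => hi ⟨y, hy⟩⟩
    choose lo hlo using hlo
    choose hi hhi using hhi
    have hpig : ∀ k, ∃ p : WO (Order.succ q) × Q, #(W k) ≤ #((fun j => (lo k j, hi k j)) ⁻¹' {p}) := by
      intro k
      refine infinite_pigeonhole_card _ _ le_rfl (hW k).1 ?_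
      rw [(hW k).cof_ord, ← mul_def, mk_WO, mk_WO]
      exact (mul_lt_of_lt (hW k).1 (lt2.trans (hW2 k)) (hW2 k))
    choose p hp using hpig
    obtain ⟨ξ, hξ⟩ := exists_bound_WO (fun k => (p k).1) (by rw [c1]; exact hs.trans_lt lt1)
    have hPζ : P (f ξ) ζ := by
      intro k
      refine ⟨(p k).2, _, le_antisymm (mk_set_le _) (hp k), ?_⟩
      intro j hj
      have e1 : lo k j = (p k).1 := congrArg Prod.fst hj
      have e2 : hi k j = (p k).2 := congrArg Prod.snd hj
      refine ⟨fun y hy hyz => (hlo k j y hy hyz).trans ?_, fun y hy => e2 ▸ hhi k j y hy⟩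
      rw [e1]
      exact (hf2 _ _ (hξ k)).1.le
    obtain ⟨ξ', hξ'⟩ := exists_gt_WO hq1 ξ
    exact absurd (hg (f ξ) ζ hPζ) (not_le.2 ((hf2 _ _ hξ').2.trans (hζ ξ')))
  obtain ⟨a, ha⟩ := hP
  have hP2 : ∀ ζ, ∃ h : Q, P a ζ → ∀ k, ∃ V : Set (W k), #V = #(W k) ∧
    ∀ j ∈ V, (∀ y ∈ bad k ζ j, y < ζ → y ≤ a) ∧ ∀ y ∈ bad k ζ j, y < h := by
    intro ζ
    by_cases hp : P a ζ
    · choose h V hV hV2 using hp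
      obtain ⟨i, hi⟩ := exists_bound_WO h (by rw [c2]; exact hs.trans_lt (lt1.trans lt2))
      exact ⟨i, fun _ k => ⟨V k, hV k, fun j hj => ⟨(hV2 k j hj).1, fun y hy =>
        ((hV2 k j hj).2 y hy).trans (hi k)⟩⟩⟩
    · exact ⟨a, fun h => absurd h hp⟩
  choose h hh using hP2
  have step : ∀ (i : s) (f : ∀ j, j < i → Q), ∃ y, P a y ∧ a < y ∧ ∀ j (hj : j < i), f j hj < y ∧ h (f j hj) < y := by
    intro i f
    have h0 : #(Iio i) < (Order.succ (Order.succ q)).ord.cof := by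
      rw [c2]; exact ((mk_set_le _).trans hs).trans_lt (lt1.trans lt2)
    obtain ⟨y1, h1⟩ := exists_bound_WO (fun j : Iio i => f j.1 j.2) h0
    obtain ⟨y2, h2⟩ := exists_bound_WO (fun j : Iio i => h (f j.1 j.2)) h0
    obtain ⟨ζ, hζ, hlt⟩ := ha (max a (max y1 y2))
    refine ⟨ζ, hζ, (le_max_left _ _).trans_lt hlt, fun j hj => ⟨(h1 ⟨j, hj⟩).trans_le ?_ |>.trans hlt, 
      (h2 ⟨j, hj⟩).trans_le ?_ |>.trans hlt⟩⟩
    · exact (le_max_left _ _).trans (le_max_right _ _)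
    · exact (le_max_right _ _).trans (le_max_right _ _)
  choose F hF0 hF1 hF2 using step
  obtain ⟨f, hf⟩ : ∃ f : s → Q, ∀ i, f i = F i (fun j _ => f j) :=
      ⟨WellFounded.fix (wellFounded_lt (α := s)) F,
        fun i => WellFounded.fix_eq (wellFounded_lt (α := s)) F i⟩
  have g0 : ∀ i, P a (f i) := fun i => by rw [hf i]; exact hF0 _ _
  have g1 : ∀ i, a < f i := fun i => by rw [hf i]; exact hF1 _ _
  have g2 : ∀ i j, j < i → f j < f i ∧ h (f j) < f i := fun i j hj => by
    rw [hf i]; exact hF2 i (fun j _ => f j) j hj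
  choose V hV hV2 using fun k => hh (f k) (g0 k) k
  refine ⟨f, V, hV, ?_⟩
  intro k l hkl j hj hmem
  rcases lt_or_gt_of_ne hkl with hlt | hlt
  · exact absurd ((hV2 k j hj).2 _ hmem) (not_lt.2 (g2 l k hlt).2.le)
  · exact absurd ((hV2 k j hj).1 _ hmem (g2 k l hlt).1) (not_le.2 (g1 l))



section
variable {X : Type u} [TopologicalSpace X]

theorem Ctx.exists_T {κ r0 : Cardinal.{u}} (hΛ : κ ≤ (2 : Cardinal.{u}) ^< r0) {χ : Cardinal.{u}}
    (h : χ < κ) : ∃ T < r0, χ < 2 ^ T := by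
  by_contra! hcon
  exact absurd (hΛ.trans (powerlt_le.2 fun T hT => hcon T hT)) (not_le.2 h)

theorem Ctx.succ_r0 {μ κ r0 : Cardinal.{u}} (C : Ctx μ κ r0) (hΛ : κ ≤ (2 : Cardinal.{u}) ^< r0) {T : Cardinal.{u}}
    (h : T < r0) : Order.succ T < r0 := by
  refine lt_of_le_of_ne (Order.succ_le_of_lt h) fun e => ?_
  refine absurd (hΛ.trans (powerlt_le.2 fun S hS => ?_)) (not_le.2 (C.lt_r0 T h))
  rw [← e] at hS
  exact power_le_power_left two_ne_zero (Order.lt_succ_iff.1 hS)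

theorem Disc.comp {ι ι' : Type u} {x : ι → X} (h : Disc x) {f : ι' → ι} (hf : Function.Injective f) :
    Disc (x ∘ f) := Sep.comp (G := fun i => ({x i} : Set X)) h hf

variable [CompactSpace X] [T2Space X] [TotallyDisconnectedSpace X]

theorem Ctx.row {μ κ r0 τ : Cardinal.{u}} (C : Ctx μ κ r0)
    (hΛ : κ ≤ (2 : Cardinal.{u}) ^< r0) (hτ : τ < κ)
    (hoA : κ ≤ oo (AA X τ)) {T : Cardinal.{u}} (hT : T < r0) (hTi : ℵ₀ ≤ T)
    (hA : #((AA X τ)ᶜ : Set X) ≤ T) :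
    ∃ x : WO (Order.succ T) → X, Disc x ∧ ∀ i, x i ∈ AA X τ := by
  classical
  have hnd : ¬ NoDisc (Order.succ T) (univ : Set X) := by
    intro hnd
    have hw : ww (univ : Set X) ≤ 2 ^ T := BA_basic hTi (by rwa [closure_univ])
    obtain ⟨T', hT', hτ'⟩ := Ctx.exists_T hΛ hτ
    set U := max T T' with hU
    have hUr : U < r0 := max_lt hT hT'
    have hUi : ℵ₀ ≤ U := hTi.trans (le_max_left _ _)
    have hsq : ∀ s < Order.succ U, ((2 : Cardinal.{u}) ^ U) ^ s ≤ 2 ^ U := by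
      intro s hs
      rw [← power_mul]
      exact power_le_power_left two_ne_zero
        ((mul_le_mul_right (Order.lt_succ_iff.1 hs) U).trans (mul_eq_self hUi).le)
    have := oo_count (Z := AA X τ) (τ := τ) (ψ := Order.succ U) (Λ := 2 ^ U) (b := 2 ^ U)
      (Order.succ_le_of_lt (cantor U)) (hUi.trans (cantor U).le) subset_rfl (by
        intro s hs
        refine le_trans (power_le_power_right ?_) (hsq s hs)
        exact (ww_mono (subset_univ _)).trans (hw.trans (power_le_power_left two_ne_zero (le_max_left _ _))))
      (fun ι x hx _ => (hnd ι x hx fun _ => mem_univ _).trans_le (Order.succ_le_succ (le_max_left _ _))) (by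
        intro J G _ _ hGt hJ
        refine (prod_le_pow hGt).trans (le_trans (power_le_power_right ?_) (hsq _ hJ))
        exact hτ'.le.trans (power_le_power_left two_ne_zero (le_max_right _ _)))
    have h2 := C.lt_r0 U hUr
    exact absurd (hoA.trans this) (not_le.2 (C.mul_lt h2 h2))
  unfold NoDisc at hnd
  push Not at hnd
  obtain ⟨ι, x, hx, -, hι⟩ := hnd
  have hbad : #{i // ¬ x i ∈ AA X τ} ≤ T := by
    refine le_trans ?_ hA
    refine mk_le_of_injective (f := fun i => (⟨x i.1, i.2⟩ : ((AA X τ)ᶜ : Set X))) ?_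
    intro i j hij
    exact Subtype.ext (hx.injective (congrArg Subtype.val hij))
  have hgood : Order.succ T ≤ #{i // x i ∈ AA X τ} := by
    by_contra hlt
    have hlt := not_le.1 hlt
    have e : #ι = #{i // x i ∈ AA X τ} + #{i // ¬ x i ∈ AA X τ} := by
      rw [add_def]
      exact mk_congr (Equiv.sumCompl _).symm
    rw [e] at hι
    exact absurd hι (not_le.2 (add_lt_of_lt (hTi.trans (Order.le_succ T)) hlt (Order.lt_succ_of_le hbad)))
  rw [← mk_WO (Order.succ T)] at hgood
  obtain ⟨f⟩ := hgood
  refine ⟨fun i => x (f i).1, hx.comp (f := fun i => (f i).1) (fun i j h => f.injective (Subtype.ext h)), fun i => (f i).2⟩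

theorem Ctx.caseF {μ κ r0 τ : Cardinal.{u}} (C : Ctx μ κ r0) (NS : oo (univ : Set X) < κ ^ κ.ord.cof)
    (hΛ : κ ≤ (2 : Cardinal.{u}) ^< r0) (hτ : τ < κ) (hA : #((AA X τ)ᶜ : Set X) < μ)
    (hoA : κ ≤ oo (AA X τ)) : False := by
  classical
  obtain ⟨s, hs, hsc⟩ := exists_cofinal_WO κ
  -- the size q
  obtain ⟨q0, hq0, hq0τ⟩ := Ctx.exists_T hΛ hτ
  set q := max q0 κ.ord.cof with hq
  have hqr : q < r0 := max_lt hq0 C.θ_lt_r0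
  have hqτ : τ < 2 ^ q := hq0τ.trans_le (power_le_power_left two_ne_zero (le_max_left _ _))
  have hqi : ℵ₀ ≤ q := C.inf_θ.trans (le_max_right _ _)
  have hsq : #s ≤ q := hsc.le.trans (le_max_right _ _)
  have hqq : Order.succ (Order.succ q) < r0 := C.succ_r0 hΛ (C.succ_r0 hΛ hqr)
  have hT : ∀ i : s, ∃ T < r0, #((AA X τ)ᶜ : Set X) ≤ T ∧ Order.succ (Order.succ q) ≤ T ∧
      #(Iic i.1) ^ κ.ord.cof ≤ 2 ^ T := by
    intro i
    obtain ⟨T, hT, h2⟩ := Ctx.exists_T hΛ (C.pow _ (mk_Iic_WO C.inf i.1) _ C.cof)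
    refine ⟨max T (max #((AA X τ)ᶜ : Set X) (Order.succ (Order.succ q))),
      max_lt hT (max_lt (hA.trans_le C.μ_le_r0) hqq),
      (le_max_left _ _).trans (le_max_right _ _), (le_max_right _ _).trans (le_max_right _ _),
      h2.le.trans (power_le_power_left two_ne_zero (le_max_left _ _))⟩
  choose T hTr hTA hTq hTκ using hT
  have hq1 : ℵ₀ ≤ Order.succ (Order.succ q) := hqi.trans ((Order.le_succ q).trans (Order.le_succ _))
  have hTi : ∀ i, ℵ₀ ≤ T i := fun i => hq1.trans (hTq i)
  let Q := WO (Order.succ (Order.succ q))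
  let W : s → Type u := fun i => WO (Order.succ (T i))
  have hrow : ∀ i : s, ∃ x : Q × W i → X, Disc x ∧ ∀ p, x p ∈ AA X τ := by
    intro i
    obtain ⟨x, hx, hxA⟩ := C.row hΛ hτ hoA (hTr i) (hTi i) (hTA i)
    have : #(Q × W i) ≤ #(WO (Order.succ (T i))) := by
      rw [← mul_def, mk_WO, mk_WO]
      exact (mul_le_mul_left ((hTq i).trans (Order.le_succ _)) _).trans
        (mul_eq_self ((hTi i).trans (Order.le_succ _))).le
    obtain ⟨f⟩ := this
    exact ⟨x ∘ f, hx.comp f.injective, fun p => hxA _⟩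
  choose x hx hxA using hrow
  -- null clopen neighbourhoods
  have hnb : ∀ i p, ∃ e : Set X, IsClopen e ∧ oo e ≤ τ ∧ x i p ∈ e ∧ ∀ p', p' ≠ p → x i p' ∉ e := by
    intro i p
    obtain ⟨v, hv⟩ := hx i
    obtain ⟨hvo, hxv, hvd⟩ := hv p
    obtain ⟨a, ⟨ha, hat⟩, hxa⟩ := hxA i p
    obtain ⟨e, he, hxe, hes⟩ := exists_clopen (hvo.inter ha.isOpen) (show x i p ∈ v p ∩ a from ⟨hxv rfl, hxa⟩)
    refine ⟨e, he, (oo_mono (hes.trans inter_subset_right)).trans hat, hxe, fun p' hne hmem => ?_⟩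
    have : x i p' ∈ v p ∩ {x i p'} := ⟨(hes hmem).1, rfl⟩
    rw [hvd p' hne] at this
    exact this
  choose e he heτ hxe hed using hnb
  have hfew : ∀ i p k, #{p' // x k p' ∈ e i p} ≤ q := by
    intro i p k
    by_contra hlt
    have hlt := not_le.1 hlt
    have hd : Disc (fun p' : {p' // x k p' ∈ e i p} => x k p'.1) :=
      (hx k).comp (f := fun p' : {p' // x k p' ∈ e i p} => p'.1) Subtype.val_injective
    have h1 := two_pow_le_of_sep hd fun _ => singleton_nonempty _
    have h2 : oo (⋃ p' : {p' // x k p' ∈ e i p}, {x k p'.1}) ≤ τ := by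
      refine (oo_mono (iUnion_subset fun p' => ?_)).trans (heτ i p)
      exact singleton_subset_iff.2 p'.2
    exact absurd (hqτ.trans_le ((power_le_power_left two_ne_zero hlt.le).trans (h1.trans h2))) (lt_irrefl _)
  obtain ⟨ζ, V, hV, hfree⟩ := free_columns hqi hsq W
    (fun k => by rw [mk_WO]; exact isRegular_succ (hTi k))
    (fun k => by rw [mk_WO]; exact Order.lt_succ_of_le (hTq k))
    (fun k z j => {z' | ∃ l, l ≠ k ∧ ∃ j', x l (z', j') ∈ e k (z, j)}) (by
      intro k z j
      have : #{z' | ∃ l, l ≠ k ∧ ∃ j', x l (z', j') ∈ e k (z, j)} ≤ #(Σ l : s, {p' // x l p' ∈ e k (z, j)}) := by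
        refine le_trans (mk_le_mk_of_subset (t := range fun r : (Σ l : s, {p' // x l p' ∈ e k (z, j)}) => r.2.1.1) ?_)
          mk_range_le
        rintro z' ⟨l, -, j', h⟩
        exact ⟨⟨l, (z', j'), h⟩, rfl⟩
      refine this.trans ?_
      rw [mk_sigma]
      refine (sum_le_sum _ (fun _ => q) fun l => hfew _ _ l).trans ?_
      rw [sum_const']
      exact (mul_le_mul_left hsq _).trans (mul_eq_self hqi).le)
  have hsep : Disc (fun r : (Σ k : s, V k) => x r.1 (ζ r.1, r.2.1)) := by
    refine ⟨fun r => e r.1 (ζ r.1, r.2.1), fun r => ⟨(he _ _).isOpen, ?_, ?_⟩⟩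
    · rintro _ rfl
      exact hxe _ _
    · rintro ⟨l, j'⟩ hne
      obtain ⟨k, j⟩ := r
      rw [← subset_empty_iff]
      rintro y ⟨hy, rfl⟩
      by_cases hkl : k = l
      · subst hkl
        refine hed k (ζ k, j.1) (ζ k, j'.1) ?_ hy
        intro h
        apply hne
        rw [Sigma.mk.injEq]
        exact ⟨rfl, heq_of_eq (Subtype.ext (Prod.ext_iff.1 h).2)⟩
      · exact hfree k l hkl j.1 j.2 ⟨l, Ne.symm hkl, j'.1, hy⟩
  have h1 := two_pow_le_of_sep hsep fun _ => singleton_nonempty _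
  have h2 : κ ^ κ.ord.cof ≤ 2 ^ #(Σ k : s, V k) := by
    refine (pow_le_prod_cofinal κ.ord.cof hs).trans ?_
    rw [mk_sigma, power_sum]
    refine prod_le_prod _ _ fun k => (hTκ k).trans (power_le_power_left two_ne_zero ?_)
    rw [hV k, mk_WO]
    exact Order.le_succ _
  exact absurd NS (not_lt.2 (h2.trans (h1.trans (oo_mono (subset_univ _)))))

end


section
variable {X : Type u} [TopologicalSpace X]

def small (r0 : Cardinal.{u}) (Z : Set X) : Prop := ∃ r < r0, ww Z ≤ 2 ^ r

theorem small.mono {r0 : Cardinal.{u}} {Y Z : Set X} (h : small r0 Z) (hs : Y ⊆ Z) : small r0 Y := by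
  obtain ⟨r, h1, h2⟩ := h
  exact ⟨r, h1, (ww_mono hs).trans h2⟩

theorem ww_union_le (Y Z : Set X) : ww (Y ∪ Z) ≤ ww Y * ww Z := by
  have h := ww_iUnion_le (fun b : ULift.{u} Bool => cond b.down Y Z)
  have e : (⋃ b : ULift.{u} Bool, cond b.down Y Z) = Y ∪ Z := by
    ext x; simp [or_comm]
  rw [e] at h
  refine h.trans ?_
  rw [prod_split _ (fun b : ULift.{u} Bool => b.down = true)]
  refine mul_le_mul' ?_ ?_
  · refine (prod_le_pow (τ := ww Y) ?_).trans ?_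
    · rintro ⟨⟨b⟩, hb⟩
      simp only at hb
      subst hb
      exact le_rfl
    · have : #{b : ULift.{u} Bool // b.down = true} = 1 := by
        rw [eq_one_iff_unique]
        exact ⟨⟨fun a b => by
          obtain ⟨⟨a⟩, ha⟩ := a
          obtain ⟨⟨b⟩, hb⟩ := b
          simp only at ha hb
          subst ha; subst hb; rfl⟩, ⟨⟨⟨true⟩, rfl⟩⟩⟩
      rw [this, power_one]
  · refine (prod_le_pow (τ := ww Z) ?_).trans ?_
    · rintro ⟨⟨b⟩, hb⟩
      simp only [Bool.not_eq_true] at hb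
      subst hb
      exact le_rfl
    · have : #{b : ULift.{u} Bool // ¬ b.down = true} = 1 := by
        rw [eq_one_iff_unique]
        exact ⟨⟨fun a b => by
          obtain ⟨⟨a⟩, ha⟩ := a
          obtain ⟨⟨b⟩, hb⟩ := b
          simp only [Bool.not_eq_true] at ha hb
          subst ha; subst hb; rfl⟩, ⟨⟨⟨false⟩, by simp⟩⟩⟩
      rw [this, power_one]

theorem sup_lt_r0 {r0 : Cardinal.{u}} {J : Type u} (r : J → Cardinal.{u}) (hr : ∀ j, r j < r0)
    (hJ : #J < r0.ord.cof) : ∃ R < r0, ∀ j, r j ≤ R := by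
  choose i hi using fun j => exists_mk_Iio_WO (hr j)
  obtain ⟨m, hm⟩ := exists_bound_WO i hJ
  refine ⟨#(Iio m), mk_Iio_WO m, fun j => ?_⟩
  rw [← hi j]
  exact mk_le_mk_of_subset (Iio_subset_Iio (hm j).le)

/-- union of few small sets -/
theorem small_iUnion {r0 : Cardinal.{u}} (hr0 : ℵ₀ ≤ r0) {J : Type u} (S : J → Set X) (hS : ∀ j, small r0 (S j))
    (hJ : #J < r0.ord.cof) : small r0 (⋃ j, S j) := by
  choose r hr hw using hS
  obtain ⟨R, hR, hle⟩ := sup_lt_r0 r hr hJ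
  refine ⟨R * #J, mul_lt_of_lt hr0 hR (hJ.trans_le (cof_le_self r0)), ?_⟩
  refine (ww_iUnion_le S).trans ?_
  rw [power_mul]
  exact prod_le_pow fun j => (hw j).trans (power_le_power_left two_ne_zero (hle j))

theorem small_of_card {r0 : Cardinal.{u}} {Y : Set X} (h : #Y < r0) : small r0 Y := ⟨_, h, ww_le_two_pow Y⟩

variable [CompactSpace X] [T2Space X] [TotallyDisconnectedSpace X]

def AntiOn (S : Set X) (N : Set (Set X)) : Prop :=
  (∀ e ∈ N, IsClopen e ∧ (e ∩ S).Nonempty) ∧ ∀ e ∈ N, ∀ f ∈ N, e ≠ f → e ∩ f ∩ S = ∅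

theorem Ctx.glue {μ κ r0 : Cardinal.{u}} (C : Ctx μ κ r0) (NS : oo (univ : Set X) < κ ^ κ.ord.cof)
    {S : Set X} {N : Set (Set X)} (hN : AntiOn S N) {s : Set (WO r0)} (hs : IsCofinal s)
    (f : s → Set X) (hf : Function.Injective f) (hfN : ∀ i, f i ∈ N) :
    ∃ i : s, ww (f i ∩ S) ≤ 2 ^ max ℵ₀ #(Iic i.1) := by
  by_contra! hcon
  have h1 : ∀ i : s, ¬ NoDisc (Order.succ (max ℵ₀ #(Iic i.1))) (closure (f i ∩ S)) := fun i h =>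
    absurd (BA_basic (le_max_left _ _) h) (not_le.2 (hcon i))
  unfold NoDisc at h1
  push Not at h1
  choose J x hx hxm hJ using h1
  have hW : Sep (fun i : s => closure (f i ∩ S)) := by
    refine ⟨f, fun i => ⟨(hN.1 _ (hfN i)).1.isOpen, ?_, fun k hk => ?_⟩⟩
    · exact closure_minimal inter_subset_left (hN.1 _ (hfN i)).1.isClosed
    · have h2 := (hN.1 _ (hfN i)).1.isOpen.inter_closure (t := f k ∩ S)
      rw [← inter_assoc, hN.2 _ (hfN i) _ (hfN k) (fun h => hk (hf h).symm), closure_empty] at h2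
      exact subset_empty_iff.1 h2
  have h3 := hW.sigma (J := J) (G := fun i j => {x i j}) hx (fun i j => singleton_subset_iff.2 (hxm i j))
  have h4 := C.sep_lt NS h3 fun _ => singleton_nonempty _
  refine absurd h4 (not_lt.2 ?_)
  have h5 : r0 ≤ #(⋃ i : s, Iic i.1) := by
    have : (⋃ i : s, Iic i.1) = (univ : Set (WO r0)) := by
      rw [eq_univ_iff_forall]
      intro y
      obtain ⟨z, hz, hyz⟩ := hs y
      exact mem_iUnion.2 ⟨⟨z, hz⟩, hyz⟩
    rw [this, mk_univ, mk_WO]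
  refine h5.trans ((mk_iUnion_le_sum_mk).trans ?_)
  rw [mk_sigma]
  exact sum_le_sum _ _ fun i => (le_max_right _ _).trans ((Order.le_succ _).trans (hJ i))

theorem Ctx.nonsmall_lt {μ κ r0 : Cardinal.{u}} (C : Ctx μ κ r0) (NS : oo (univ : Set X) < κ ^ κ.ord.cof)
    {S : Set X} {N : Set (Set X)} (hN : AntiOn S N) (hns : ∀ e ∈ N, ¬ small r0 (e ∩ S)) : #N < r0.ord.cof := by
  by_contra hlt
  have hlt := not_lt.1 hlt
  obtain ⟨s, hs, hsc⟩ := exists_cofinal_WO r0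
  rw [← hsc] at hlt
  obtain ⟨f⟩ := hlt
  obtain ⟨i, hi⟩ := C.glue NS hN hs (fun i => (f i).1) (fun a b h => f.injective (Subtype.ext h)) (fun i => (f i).2)
  exact hns _ (f i).2 ⟨_, max_lt (C.inf_θ.trans_lt C.θ_lt_r0) (mk_Iic_WO C.inf_r0 i.1), hi⟩

theorem Ctx.small_lt {μ κ r0 : Cardinal.{u}} (C : Ctx μ κ r0) (NS : oo (univ : Set X) < κ ^ κ.ord.cof)
    {S : Set X} {N : Set (Set X)} (hN : AntiOn S N) (hns : ∀ e ∈ N, small r0 (e ∩ S)) : small r0 (⋃₀ N ∩ S) := by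
  obtain ⟨s, hs, hsc⟩ := exists_cofinal_WO r0
  have hr0 : ℵ₀ < r0 := C.inf_θ.trans_lt C.θ_lt_r0
  have hNr : #N < r0 := ((C.noDisc NS S).anti N hN.1 hN.2)
  -- uniform bound
  have key : ∃ R < r0, ∀ e : N, ww (e.1 ∩ S) ≤ 2 ^ R := by
    have h1 : ∃ i : s, #{e : N | ¬ ww (e.1 ∩ S) ≤ 2 ^ max ℵ₀ #(Iic i.1)} < r0.ord.cof := by
      by_contra hcon'
      have hcon : ∀ i : s, r0.ord.cof ≤ #{e : N | ¬ ww (e.1 ∩ S) ≤ 2 ^ max ℵ₀ #(Iic i.1)} :=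
        fun i => not_lt.1 fun h => hcon' ⟨i, h⟩
      obtain ⟨f, hf, hf2⟩ := exists_injective_choice (I := s) (J := N)
        (fun i => {e : N | ¬ ww (e.1 ∩ S) ≤ 2 ^ max ℵ₀ #(Iic i.1)}) (fun i => by rw [hsc]; exact hcon i)
      obtain ⟨i, hi⟩ := C.glue NS hN hs (fun i => (f i).1) (fun a b h => hf (Subtype.ext h)) (fun i => (f i).2)
      exact hf2 i hi
    obtain ⟨i, hi⟩ := h1
    choose r hr hw using fun e : N => hns e.1 e.2
    obtain ⟨R, hR, hle⟩ := sup_lt_r0 (fun e : {e : N | ¬ ww (e.1 ∩ S) ≤ 2 ^ max ℵ₀ #(Iic i.1)} => r e.1)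
      (fun e => hr _) hi
    refine ⟨max R (max ℵ₀ #(Iic i.1)), max_lt hR (max_lt hr0 (mk_Iic_WO C.inf_r0 i.1)), fun e => ?_⟩
    by_cases h : ww (e.1 ∩ S) ≤ 2 ^ max ℵ₀ #(Iic i.1)
    · exact h.trans (power_le_power_left two_ne_zero (le_max_right _ _))
    · exact (hw e).trans (power_le_power_left two_ne_zero ((hle ⟨e, h⟩).trans (le_max_left _ _)))
  obtain ⟨R, hR, hle⟩ := key
  refine ⟨R * #N, mul_lt_of_lt C.inf_r0 hR hNr, ?_⟩
  have e : ⋃₀ N ∩ S = ⋃ e : N, e.1 ∩ S := by rw [sUnion_eq_iUnion, iUnion_inter]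
  rw [e, power_mul]
  exact (ww_iUnion_le _).trans (prod_le_pow hle)

/-- the second kind of sets -/
def kind2 (r0 τ : Cardinal.{u}) (S : Set X) : Prop := ∃ N : Set (Set X),
  (∀ e ∈ N, IsClopen e ∧ oo e ≤ τ ∧ (e ∩ S).Nonempty) ∧
      (∀ e ∈ N, ∀ f ∈ N, e ≠ f → e ∩ f ∩ S = ∅) ∧ S ⊆ closure (⋃₀ N ∩ S) ∧ #N < r0.ord.cof

theorem Ctx.decomp {μ κ r0 τ : Cardinal.{u}} (C : Ctx μ κ r0) (NS : oo (univ : Set X) < κ ^ κ.ord.cof)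
    {S : Set X} (hS : S ⊆ AA X τ) : ∃ S1 S2 : Set X, S1 ⊆ S ∧ S2 ⊆ S ∧ S ⊆ closure (S1 ∪ S2) ∧ small r0 S1 ∧
      kind2 r0 τ S2 ∧ Anti r0.ord.cof S2 := by
  obtain ⟨N, h1, h2, h3⟩ := dense_family S (fun d => oo d ≤ τ ∧ (small r0 (d ∩ S) ∨
    ∀ c, IsClopen c → (c ∩ (d ∩ S)).Nonempty → ¬ small r0 (c ∩ (d ∩ S)))) (by
      intro c hc hcS
      obtain ⟨d, hd, hdc, hdS, hdt⟩ := null_sub hS hc hcS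
      by_cases h : ∃ c', IsClopen c' ∧ (c' ∩ (d ∩ S)).Nonempty ∧ small r0 (c' ∩ (d ∩ S))
      · obtain ⟨c', hc', hne, hsm⟩ := h
        refine ⟨c' ∩ d, hc'.inter hd, inter_subset_right.trans hdc, by rwa [inter_assoc],
          (oo_mono inter_subset_right).trans hdt, Or.inl (by rwa [inter_assoc])⟩
      · push Not at h
        exact ⟨d, hd, hdc, hdS, hdt, Or.inr h⟩)
  let N1 : Set (Set X) := {e | e ∈ N ∧ small r0 (e ∩ S)}
  let N2 : Set (Set X) := {e | e ∈ N ∧ ¬ small r0 (e ∩ S)}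
  have a1 : AntiOn S N1 := ⟨fun e he => ⟨(h1 e he.1).1, (h1 e he.1).2.2⟩,
    fun e he f hf hne => h2 e he.1 f hf.1 hne⟩
  have a2 : AntiOn S N2 := ⟨fun e he => ⟨(h1 e he.1).1, (h1 e he.1).2.2⟩,
    fun e he f hf hne => h2 e he.1 f hf.1 hne⟩
  have htr : ∀ e ∈ N2, e ∩ (⋃₀ N2 ∩ S) = e ∩ S := by
    intro e he
    ext x
    exact ⟨fun h => ⟨h.1, h.2.2⟩, fun h => ⟨h.1, ⟨e, he, h.1⟩, h.2⟩⟩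
  refine ⟨⋃₀ N1 ∩ S, ⋃₀ N2 ∩ S, inter_subset_right, inter_subset_right, ?_,
    C.small_lt NS a1 fun e he => he.2, ?_, ?_⟩
  · refine h3.trans (closure_mono ?_)
    rintro x ⟨⟨n, hn, hxn⟩, hxS⟩
    by_cases h : small r0 (n ∩ S)
    · exact Or.inl ⟨⟨n, ⟨hn, h⟩, hxn⟩, hxS⟩
    · exact Or.inr ⟨⟨n, ⟨hn, h⟩, hxn⟩, hxS⟩
  · refine ⟨N2, fun e he => ⟨(h1 e he.1).1, (h1 e he.1).2.1.1, ?_⟩, ?_, ?_, C.nonsmall_lt NS a2 fun e he => he.2⟩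
    · rw [htr e he]
      exact (h1 e he.1).2.2
    · intro e he f hf hne
      rw [← subset_empty_iff, ← h2 e he.1 f hf.1 hne]
      exact inter_subset_inter_right _ inter_subset_right
    · rw [← inter_assoc, inter_self]
      exact subset_closure
  · intro M hM hMd
    refine C.nonsmall_lt NS (S := ⋃₀ N2 ∩ S) ⟨hM, hMd⟩ ?_
    intro b hb hsm
    obtain ⟨x, hxb, ⟨e, he, hxe⟩, hxS⟩ := (hM b hb).2
    rcases (h1 e he.1).2.1.2 with h | h
    · exact he.2 h
    · refine h b (hM b hb).1 ⟨x, hxb, hxe, hxS⟩ (hsm.mono ?_)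
      rintro y ⟨hy1, hy2, hy3⟩
      exact ⟨hy1, ⟨e, he, hy2⟩, hy3⟩

theorem Ctx.nstar {μ κ r0 τ : Cardinal.{u}} (C : Ctx μ κ r0) (NS : oo (univ : Set X) < κ ^ κ.ord.cof)
    (hΛ : (2 : Cardinal.{u}) ^< r0 < κ) (hτ : τ < κ) (hoA : κ ≤ oo (AA X τ)) : κ ≤ nP (small r0) (AA X τ) := by
  have hr0 : ℵ₀ < r0 := C.inf_θ.trans_lt C.θ_lt_r0
  have hψ : r0.ord.cof ≤ (2 : Cardinal.{u}) ^< r0 := (cof_le_self r0).trans r0_le_powerlt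
  have hΛi : ℵ₀ ≤ (2 : Cardinal.{u}) ^< r0 := C.inf_r0.trans r0_le_powerlt
  have hwA : ww (AA X τ) ≤ (2 : Cardinal.{u}) ^< r0 := by
    obtain ⟨S1, S2, h1, h2, h3, ⟨r, hr, hw⟩, -, h6⟩ := C.decomp (τ := τ) NS subset_rfl
    have hw2 : ww S2 ≤ (2 : Cardinal.{u}) ^< r0 :=
      BA_gen C.inf_r0 r0_le_powerlt hψ (fun s hs => powerlt_pow hr0 hs) (C.noDisc NS _) h6
    refine (ww_closure_le h3 (union_subset h1 h2)).trans ((ww_union_le _ _).trans ?_)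
    exact (mul_le_mul' (hw.trans (le_powerlt _ hr)) hw2).trans (mul_eq_self hΛi).le
  obtain ⟨κs, hκs, hb⟩ := C.prod_bound NS hΛ hτ
  have h2 : nP (kind2 r0 τ) (AA X τ) ≤ (2 : Cardinal.{u}) ^< r0 * κs := by
    refine nP_count (τ := τ) hψ hΛi (fun s hs => (power_le_power_right hwA).trans (powerlt_pow hr0 hs))
      (fun S _ h => h) (fun J G a b c _ => hb J G a b c)
  have h3 : oo (AA X τ) ≤ nP (small r0) (AA X τ) * nP (kind2 r0 τ) (AA X τ) := by
    unfold oo nP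
    rw [mul_def]
    refine le_trans (mk_le_mk_of_subset (t := range fun p :
      (closure '' {S : Set X | S ⊆ AA X τ ∧ small r0 S} : Set (Set X)) ×
      (closure '' {S : Set X | S ⊆ AA X τ ∧ kind2 r0 τ S} : Set (Set X)) => p.1.1 ∪ p.2.1) ?_) mk_range_le
    rintro _ ⟨S, ⟨hS, -⟩, rfl⟩
    obtain ⟨S1, S2, h1, h2, h3, h4, h5, -⟩ := C.decomp (τ := τ) NS hS
    refine ⟨(⟨closure S1, S1, ⟨h1.trans hS, h4⟩, rfl⟩, ⟨closure S2, S2, ⟨h2.trans hS, h5⟩, rfl⟩), ?_⟩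
    simp only
    rw [← closure_union]
    exact Subset.antisymm (closure_mono (union_subset h1 h2)) (closure_minimal h3 isClosed_closure)
  by_contra hlt
  have hlt := not_le.1 hlt
  exact absurd (hoA.trans h3) (not_le.2 (C.mul_lt hlt (h2.trans_lt (C.mul_lt hΛ hκs))))

end


section
variable {X : Type u} [TopologicalSpace X]

/-- A tree of choices gives many closed sets. -/
theorem tree_lemma {I : Type u} [LinearOrder I] [WellFoundedLT I] (D : I → Type u)
    (V : Set X × Set X → Prop)
    (step : ∀ (ξ : I) (h : Iio ξ → Set X × Set X), (∀ ζ, V (h ζ)) → ∃ (G : D ξ → Set X) (W : Set X),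
      IsOpen W ∧ (∀ t, V (G t, W) ∧ G t ⊆ W ∧ (∀ ζ, Disjoint (G t) (h ζ).2) ∧
        Disjoint (G t) (closure (⋃ ζ, (h ζ).1))) ∧ Function.Injective (fun t => closure (G t))) :
    Cardinal.prod (fun ξ => #(D ξ)) ≤ oo (univ : Set X) := by
  have step' : ∀ (ξ : I) (h : Iio ξ → Set X × Set X), ∃ (G : D ξ → Set X) (W : Set X), (∀ ζ, V (h ζ)) →
      IsOpen W ∧ (∀ t, V (G t, W) ∧ G t ⊆ W ∧ (∀ ζ, Disjoint (G t) (h ζ).2) ∧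
        Disjoint (G t) (closure (⋃ ζ, (h ζ).1))) ∧ Function.Injective (fun t => closure (G t)) := by
    intro ξ h
    by_cases hv : ∀ ζ, V (h ζ)
    · obtain ⟨G, W, hh⟩ := step ξ h hv
      exact ⟨G, W, fun _ => hh⟩
    · exact ⟨fun _ => ∅, ∅, fun h => absurd h hv⟩
  choose G W hGW using step'
  have hq : ∀ f : (∀ ξ, D ξ), ∃ q : I → Set X × Set X, ∀ ξ, q ξ =
      (G ξ (fun ζ => q ζ.1) (f ξ), W ξ (fun ζ => q ζ.1)) := by
    intro f
    let F : ∀ ξ : I, (∀ ζ, ζ < ξ → Set X × Set X) → Set X × Set X := fun ξ h =>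
      (G ξ (fun ζ => h ζ.1 ζ.2) (f ξ), W ξ (fun ζ => h ζ.1 ζ.2))
    exact ⟨WellFounded.fix (wellFounded_lt (α := I)) F,
      fun i => WellFounded.fix_eq (wellFounded_lt (α := I)) F i⟩
  choose q hq using hq
  have hV : ∀ f ξ, V (q f ξ) := by
    intro f ξ
    induction ξ using WellFoundedLT.induction with
    | ind ξ ih =>
      have := (hGW ξ (fun ζ => q f ζ.1) (fun ζ => ih ζ.1 ζ.2)).2.1 (f ξ)
      rw [hq f ξ]
      exact this.1
  have hagree : ∀ f g ξ, (∀ ζ < ξ, f ζ = g ζ) → ∀ ζ < ξ, q f ζ = q g ζ := by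
    intro f g ξ hfg ζ
    induction ζ using WellFoundedLT.induction with
    | ind ζ ih =>
      intro hζ
      have e : (fun ζ' : Iio ζ => q f ζ'.1) = fun ζ' : Iio ζ => q g ζ'.1 :=
        funext fun ζ' => ih ζ'.1 ζ'.2 (lt_trans ζ'.2 hζ)
      rw [hq f ζ, hq g ζ, e, hfg ζ hζ]
  -- key local computation
  have key : ∀ f ξ, (q f ξ).1 ⊆ W ξ (fun ζ => q f ζ.1) \ closure (⋃ ζ : Iio ξ, (q f ζ.1).1) ∧
      (W ξ (fun ζ => q f ζ.1) \ closure (⋃ ζ : Iio ξ, (q f ζ.1).1)) ∩ closure (⋃ ζ, (q f ζ).1) ⊆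
        closure (q f ξ).1 := by
    intro f ξ
    have h1 := hGW ξ (fun ζ => q f ζ.1) (fun ζ => hV f ζ.1)
    have e1 : (q f ξ).1 = G ξ (fun ζ => q f ζ.1) (f ξ) := by rw [hq f ξ]
    refine ⟨?_, ?_⟩
    · rw [e1]
      intro x hx
      exact ⟨(h1.2.1 (f ξ)).2.1 hx, fun hc => disjoint_left.1 (h1.2.1 (f ξ)).2.2.2 hx hc⟩
    · refine ((h1.1.sdiff isClosed_closure).inter_closure).trans (closure_mono ?_)
      rintro x ⟨⟨hxW, hxc⟩, hx⟩
      obtain ⟨ζ, hζ⟩ := mem_iUnion.1 hx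
      rcases lt_trichotomy ζ ξ with hlt | rfl | hlt
      · exact absurd (subset_closure (mem_iUnion.2 ⟨⟨ζ, hlt⟩, hζ⟩)) hxc
      · exact hζ
      · have h2 := (hGW ζ (fun ζ => q f ζ.1) (fun ζ => hV f ζ.1)).2.1 (f ζ)
        have e2 : (q f ζ).1 = G ζ (fun ζ => q f ζ.1) (f ζ) := by rw [hq f ζ]
        have e3 : (q f ξ).2 = W ξ (fun ζ => q f ζ.1) := by rw [hq f ξ]
        rw [e2] at hζ
        have h3 := disjoint_left.1 (h2.2.2.1 ⟨ξ, hlt⟩) hζ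
        simp only [e3] at h3
        exact absurd hxW h3
  have hinj : Function.Injective (fun f : (∀ ξ, D ξ) => (closure (⋃ ζ, (q f ζ).1) : Set X)) := by
    intro f g hfg
    by_contra hne
    have hne' : ∃ ξ, f ξ ≠ g ξ := Function.ne_iff.1 hne
    obtain ⟨ξ, hξ, hmin⟩ := WellFounded.has_min (wellFounded_lt (α := I)) {ξ | f ξ ≠ g ξ} hne'
    have hlow : ∀ ζ < ξ, f ζ = g ζ := fun ζ hζ => by
      by_contra h
      exact hmin ζ h hζ
    have e : (fun ζ' : Iio ξ => q f ζ'.1) = fun ζ' : Iio ξ => q g ζ'.1 :=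
      funext fun ζ' => hagree f g ξ hlow ζ'.1 ζ'.2
    have eU : (⋃ ζ : Iio ξ, (q f ζ.1).1) = ⋃ ζ : Iio ξ, (q g ζ.1).1 :=
      congrArg (fun h : Iio ξ → Set X × Set X => ⋃ ζ, (h ζ).1) e
    have kf := key f ξ
    have kg := key g ξ
    rw [e, eU] at kf
    simp only at hfg
    have hsub1 : closure (q f ξ).1 ⊆ closure (q g ξ).1 := by
      refine closure_minimal (fun x hx => kg.2 ⟨kf.1 hx, ?_⟩) isClosed_closure
      rw [← hfg]
      exact subset_closure (mem_iUnion.2 ⟨ξ, hx⟩)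
    have hsub2 : closure (q g ξ).1 ⊆ closure (q f ξ).1 := by
      refine closure_minimal (fun x hx => kf.2 ⟨kg.1 hx, ?_⟩) isClosed_closure
      rw [hfg]
      exact subset_closure (mem_iUnion.2 ⟨ξ, hx⟩)
    have heq := Subset.antisymm hsub1 hsub2
    have e1 : (q f ξ).1 = G ξ (fun ζ => q g ζ.1) (f ξ) := by rw [hq f ξ, e]
    have e2 : (q g ξ).1 = G ξ (fun ζ => q g ζ.1) (g ξ) := by rw [hq g ξ]
    rw [e1, e2] at heq
    exact hξ ((hGW ξ (fun ζ => q g ζ.1) (fun ζ => hV g ζ.1)).2.2 heq)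
  rw [← mk_pi]
  unfold oo nP
  exact mk_le_of_injective (f := fun f : (∀ ξ, D ξ) =>
    (⟨closure (⋃ ζ, (q f ζ).1), _, ⟨subset_univ _, trivial⟩, rfl⟩ : (closure '' {S : Set X | S ⊆ univ ∧ True} : Set (Set X))))
    (fun f g h => hinj (congrArg Subtype.val h))

theorem small_her {r0 : Cardinal.{u}} : ∀ S T : Set X, S ⊆ T → small r0 T → small r0 S :=
  fun _ _ h hT => hT.mono h

theorem nP_empty {P : Set X → Prop} : nP P (∅ : Set X) ≤ 1 := nP_le_oo.trans oo_empty.le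

theorem small.closure {r0 : Cardinal.{u}} {L : Set X} (h : small r0 L) : small r0 (closure L) := by
  obtain ⟨r, hr, hw⟩ := h
  exact ⟨r, hr, (ww_closure_le subset_rfl subset_closure).trans hw⟩

/-- minimal increasing family with big union -/
theorem Ctx.min_family {μ κ r0 τ : Cardinal.{u}} (C : Ctx μ κ r0) (hτ : τ < κ) {P : Set X → Prop}
    (hP : ∀ S T : Set X, S ⊆ T → P T → P S)
    (hoA : κ ≤ nP P (AA X τ)) : ∃ (ρ : Cardinal.{u}) (A : WO ρ → Set X), ℵ₀ ≤ ρ ∧ ρ.ord.cof = ρ ∧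
      κ.ord.cof ≤ ρ ∧ Monotone A ∧ (∀ i, IsOpen (A i) ∧ A i ⊆ AA X τ ∧ nP P (A i) < κ) ∧ κ ≤ nP P (⋃ i, A i) := by
  have h1κ : 1 < κ := one_lt_aleph0.trans_le C.inf
  let O : Set (Set X) := {U | IsOpen U ∧ U ⊆ AA X τ ∧ nP P U < κ}
  obtain ⟨ρ, ⟨J, F, hJ, hF, hFκ⟩, hmin⟩ := exists_least (P := fun ρ => ∃ (J : Type u) (F : J → Set X), #J = ρ ∧
      (∀ j, F j ∈ O) ∧ κ ≤ nP P (⋃ j, F j)) (by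
    refine ⟨_, {e : Set X | IsClopen e ∧ oo e ≤ τ}, fun e => e.1, rfl, fun e => ⟨e.2.1.isOpen, ?_, ?_⟩, ?_⟩
    · exact subset_sUnion_of_mem e.2
    · exact nP_le_oo.trans_lt (e.2.2.trans_lt hτ)
    · rw [← sUnion_eq_iUnion]; exact hoA)
  have hsm : ∀ (J : Type u) (F : J → Set X), #J < ρ → (∀ j, F j ∈ O) → (⋃ j, F j) ∈ O := by
    intro J F hJ hF
    refine ⟨isOpen_iUnion fun j => (hF j).1, iUnion_subset fun j => (hF j).2.1, ?_⟩
    by_contra h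
    exact hmin _ hJ ⟨J, F, rfl, hF, not_lt.1 h⟩
  have hinf : ℵ₀ ≤ ρ := by
    by_contra h
    rw [not_le] at h
    have hfin : Finite J := by rw [← lt_aleph0_iff_finite, hJ]; exact h
    have : ∀ s : Set J, s.Finite → nP P (⋃ j ∈ s, F j) < κ := by
      intro s hs
      induction s, hs using Set.Finite.induction_on with
      | empty => simpa using nP_empty.trans_lt h1κ
      | insert _ _ ih =>
        rw [biUnion_insert]
        exact (nP_union_le hP _ _).trans_lt (C.mul_lt (hF _).2.2 ih)
    have h2 := this univ finite_univ
    rw [biUnion_univ] at h2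
    exact absurd hFκ (not_le.2 h2)
  obtain ⟨e⟩ : Nonempty (WO ρ ≃ J) := Cardinal.eq.1 (by rw [mk_WO, hJ])
  let A : WO ρ → Set X := fun i => ⋃ k : Iio i, F (e k.1)
  have hA : ∀ i, A i ∈ O := fun i => hsm _ _ (mk_Iio_WO i) fun k => hF _
  have hAU : (⋃ i, A i) = ⋃ j, F j := by
    refine Subset.antisymm (iUnion_subset fun i => iUnion_subset fun k => subset_iUnion F _) ?_
    refine iUnion_subset fun j => ?_
    obtain ⟨i, hi⟩ := exists_gt_WO hinf (e.symm j)
    intro x hx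
    exact mem_iUnion.2 ⟨i, mem_iUnion.2 ⟨⟨e.symm j, hi⟩, by simpa using hx⟩⟩
  have hAm : Monotone A := by
    intro i j hij x hx
    obtain ⟨k, hk⟩ := mem_iUnion.1 hx
    exact mem_iUnion.2 ⟨⟨k.1, lt_of_lt_of_le k.2 hij⟩, hk⟩
  have hAκ : κ ≤ nP P (⋃ i, A i) := by rw [hAU]; exact hFκ
  refine ⟨ρ, A, hinf, ?_, ?_, hAm, hA, hAκ⟩
  · refine le_antisymm (cof_le_self ρ) ?_
    by_contra h
    rw [not_le] at h
    obtain ⟨s, hs, hsc⟩ := exists_cofinal_WO ρ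
    have h3 := hsm s (fun i => A i.1) (hsc ▸ h) fun i => hA i.1
    refine absurd hAκ (not_le.2 ((nP_mono ?_).trans_lt h3.2.2))
    refine iUnion_subset fun i => ?_
    obtain ⟨k, hk, hik⟩ := hs i
    exact (hAm hik).trans (subset_iUnion (fun i : s => A i.1) ⟨k, hk⟩)
  · by_contra h
    rw [not_le] at h
    obtain ⟨χ, hχ, hle⟩ := sup_lt_r0 (r0 := κ) (fun j => nP P (F j)) (fun j => (hF j).2.2) (hJ ▸ h)
    refine absurd hFκ (not_le.2 (((nP_iUnion_le hP F).trans (prod_le_pow hle)).trans_lt ?_))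
    rw [hJ]
    exact C.pow _ hχ _ (h.trans C.cof)

/-- cardinal arithmetic for the tree case -/
theorem Ctx.exists_π {μ κ r0 ρ : Cardinal.{u}} (C : Ctx μ κ r0) (hρ : ℵ₀ ≤ ρ) (hθ : κ.ord.cof ≤ ρ) (hr : ρ < r0) :
    ∃ p : Cardinal.{u}, ℵ₀ ≤ p ∧ (∀ χ < p, χ ^ ρ < κ) ∧ (∀ χ < p, χ ^ ρ < p) ∧ p.ord.cof ≤ ρ ∧
      p.ord.cof ≤ r0.ord.cof ∧ κ ^ κ.ord.cof ≤ p ^ p.ord.cof := by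
  have hρ0 : ρ ≠ 0 := (aleph0_pos.trans_le hρ).ne'
  obtain ⟨p, hp, hmin⟩ := exists_least (P := fun p => κ ≤ p ^ ρ)
    ⟨κ, self_le_power κ (one_le_aleph0.trans hρ)⟩
  have hpκ : p ≤ κ := by
    by_contra h
    exact hmin κ (not_le.1 h) (self_le_power κ (one_le_aleph0.trans hρ))
  have h1 : ∀ χ < p, χ ^ ρ < κ := fun χ h => not_le.1 (hmin χ h)
  have h2 : ∀ χ < p, χ ^ ρ < p := by
    intro χ h
    by_contra hc
    have h3 : p ^ ρ ≤ (χ ^ ρ) ^ ρ := power_le_power_right (not_lt.1 hc)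
    rw [← power_mul, mul_eq_self hρ] at h3
    exact absurd (hp.trans h3) (not_le.2 (h1 χ h))
  have h2p : 2 < p := by
    by_contra h
    exact absurd (hp.trans (power_le_power_right (not_lt.1 h))) (not_le.2 (C.lt_r0 ρ hr))
  have hρp : ρ < p := (cantor ρ).trans (h2 2 h2p)
  have hpi : ℵ₀ ≤ p := hρ.trans hρp.le
  have hCρ : p.ord.cof ≤ ρ := by
    by_contra h
    rw [not_le] at h
    have h3 := BF hpi h fun χ hχ => (h2 χ hχ).le
    have h4 : p = κ := le_antisymm hpκ (hp.trans h3)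
    rw [h4] at h
    exact absurd hθ (not_le.2 h)
  refine ⟨p, hpi, h1, h2, hCρ, ?_, ?_⟩
  · by_contra h
    rw [not_le] at h
    have h3 : ∀ r < r0, (2 : Cardinal.{u}) ^ r < p := by
      intro r hr'
      by_contra hc
      have h4 : p ^ ρ ≤ ((2 : Cardinal.{u}) ^ r) ^ ρ := power_le_power_right (not_lt.1 hc)
      rw [← power_mul] at h4
      exact absurd (hp.trans h4) (not_le.2 (C.lt_r0 _ (mul_lt_of_lt C.inf_r0 hr' hr)))
    obtain ⟨s, hs, hsc⟩ := exists_cofinal_WO r0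
    obtain ⟨χ, hχ, hle⟩ := sup_lt_r0 (r0 := p) (fun i : s => (2 : Cardinal.{u}) ^ #(Iic i.1))
      (fun i => h3 _ (mk_Iic_WO C.inf_r0 i.1)) (hsc ▸ h)
    have h5 : r0 ≤ Cardinal.sum (fun i : s => #(Iic i.1)) := by
      have : (⋃ i : s, Iic i.1) = (univ : Set (WO r0)) := by
        rw [eq_univ_iff_forall]
        intro y
        obtain ⟨z, hz, hyz⟩ := hs y
        exact mem_iUnion.2 ⟨⟨z, hz⟩, hyz⟩
      have h6 : r0 = #(⋃ i : s, Iic i.1) := by rw [this, mk_univ, mk_WO]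
      exact h6.le.trans mk_iUnion_le_sum_mk
    have h7 : κ ≤ (max χ 1) ^ ρ := by
      refine C.r0_le.trans ((power_le_power_left two_ne_zero h5).trans ?_)
      rw [power_sum]
      refine (prod_le_pow hle).trans ?_
      rw [hsc]
      exact (power_le_power_right (le_max_left _ _)).trans
        (power_le_power_left (zero_lt_one.trans_le (le_max_right χ 1)).ne' (h.le.trans hCρ))
    exact absurd h7 (not_le.2 (h1 _ (max_lt hχ (one_lt_aleph0.trans_le hpi))))
  · exact (gap hρ hθ (aleph0_pos.trans_le C.inf_θ).ne' hp).trans (PW hpi fun χ hχ => (h2 χ hχ).le)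

variable [CompactSpace X] [T2Space X] [TotallyDisconnectedSpace X]

/-- removing a small-closure piece keeps things big -/
theorem Ctx.rest_big {μ κ r0 τ : Cardinal.{u}} (C : Ctx μ κ r0) (NS : oo (univ : Set X) < κ ^ κ.ord.cof)
    (hΛ : (2 : Cardinal.{u}) ^< r0 < κ) (hτ : τ < κ) {P : Set X → Prop}
    (hP : ∀ S T : Set X, S ⊆ T → P T → P S) {Z A L : Set X} (hZ : Z ⊆ AA X τ) (hZκ : κ ≤ nP P Z)
    (hA : nP P A < κ) (hL : small r0 L) : κ ≤ nP P (Z \ (A ∪ closure L)) := by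
  by_contra h
  rw [not_le] at h
  have h1 : Z ⊆ (Z \ (A ∪ closure L)) ∪ (A ∪ Z ∩ closure L) := by
    intro x hx
    by_cases h1 : x ∈ A
    · exact Or.inr (Or.inl h1)
    by_cases h2 : x ∈ closure L
    · exact Or.inr (Or.inr ⟨hx, h2⟩)
    · exact Or.inl ⟨hx, fun h => h.elim h1 h2⟩
  obtain ⟨r, hr, hw⟩ := (hL.closure).mono (inter_subset_right : Z ∩ closure L ⊆ closure L)
  have h2 : nP P (Z ∩ closure L) < κ :=
    nP_le_oo.trans_lt (C.count_small NS hΛ hτ (inter_subset_left.trans hZ) hr hw)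
  refine absurd (hZκ.trans (nP_mono h1)) (not_le.2 ?_)
  exact (nP_union_le hP _ _).trans_lt (C.mul_lt h ((nP_union_le hP _ _).trans_lt (C.mul_lt hA h2)))

theorem Ctx.caseG {μ κ r0 τ : Cardinal.{u}} (C : Ctx μ κ r0) (NS : oo (univ : Set X) < κ ^ κ.ord.cof)
    (hΛ : (2 : Cardinal.{u}) ^< r0 < κ) (hτ : τ < κ) (hoA : κ ≤ oo (AA X τ)) : False := by
  have h1κ : 1 < κ := one_lt_aleph0.trans_le C.inf
  obtain ⟨ρ, A, hρ, hreg, hθ, hAm, hA, hZ⟩ := C.min_family hτ (small_her (r0 := r0)) (C.nstar NS hΛ hτ hoA)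
  have hZA : (⋃ i, A i) ⊆ AA X τ := iUnion_subset fun i => (hA i).2.1
  rcases le_or_gt r0 ρ with hr | hr
  · -- a long discrete sequence
    let F : ∀ i : WO r0, (∀ j, j < i → X × WO ρ) → Set (X × WO ρ) := fun i h =>
      {p | p.1 ∈ A p.2 ∧ (∀ j (hj : j < i), p.1 ∉ A (h j hj).2) ∧
        p.1 ∉ closure (⋃ j : Iio i, {(h j.1 j.2).1})}
    have hF : ∀ i h, (F i h).Nonempty := by
      intro i h
      obtain ⟨α, hα⟩ := exists_bound_WO (fun j : Iio i => (h j.1 j.2).2)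
        (by rw [hreg]; exact (mk_Iio_WO i).trans_le hr)
      have hL : small r0 (⋃ j : Iio i, {(h j.1 j.2).1} : Set X) := by
        apply small_of_card
        rw [iUnion_singleton_eq_range]
        exact mk_range_le.trans_lt (mk_Iio_WO i)
      have h2 := C.rest_big NS hΛ hτ (small_her (r0 := r0)) hZA hZ (hA α).2.2 hL
      rcases eq_empty_or_nonempty ((⋃ i, A i) \ (A α ∪ closure (⋃ j : Iio i, {(h j.1 j.2).1}))) with h3 | h3
      · rw [h3] at h2
        exact absurd (h2.trans nP_empty) (not_le.2 h1κ)
      · obtain ⟨x, hx, hx2⟩ := h3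
        obtain ⟨b, hb⟩ := mem_iUnion.1 hx
        refine ⟨(x, b), hb, fun j hj hxj => hx2 (Or.inl (hAm (hα ⟨j, hj⟩).le hxj)), fun hc => hx2 (Or.inr hc)⟩
    obtain ⟨f, hf⟩ : ∃ f : WO r0 → X × WO ρ, ∀ i, f i = (hF i (fun j _ => f j)).choose :=
      ⟨WellFounded.fix (wellFounded_lt (α := WO r0)) (fun i h => (hF i h).choose),
        fun i => WellFounded.fix_eq (wellFounded_lt (α := WO r0)) (fun i h => (hF i h).choose) i⟩
    have hf' : ∀ i, f i ∈ F i (fun j _ => f j) := fun i => by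
      have h := (hF i (fun j _ => f j)).choose_spec
      rw [← hf i] at h
      exact h
    have hS : Sep (fun i => {(f i).1} : WO r0 → Set X) := by
      refine ⟨fun i => A (f i).2 \ closure (⋃ j : Iio i, {(f j.1).1}), fun i =>
        ⟨(hA _).1.sdiff isClosed_closure, ?_, fun k hk => ?_⟩⟩
      · exact singleton_subset_iff.2 ⟨(hf' i).1, (hf' i).2.2⟩
      · rw [inter_singleton_eq_empty]
        rintro ⟨h1, h2⟩
        rcases lt_or_gt_of_ne hk with h | h
        · exact h2 (subset_closure (mem_iUnion.2 ⟨⟨k, h⟩, rfl⟩))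
        · exact (hf' k).2.1 i h h1
    have := C.sep_lt NS hS fun _ => singleton_nonempty _
    rw [mk_WO] at this
    exact lt_irrefl _ this
  · -- the tree
    obtain ⟨p, hpi, hp1, hp2, hCρ, hCψ, hfin⟩ := C.exists_π hρ hθ hr
    obtain ⟨s, hs, hsc⟩ := exists_cofinal_WO p
    obtain ⟨σ⟩ : Nonempty (WO p.ord.cof ≃ s) := Cardinal.eq.1 (by rw [mk_WO, hsc])
    let ν : WO p.ord.cof → Cardinal.{u} := fun ξ => #(Iic (σ ξ).1) ^ p.ord.cof
    have hne : ∀ x : WO p, #(Iic x) ≠ 0 := fun x => mk_ne_zero_iff.2 ⟨⟨x, le_refl x⟩⟩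
    have hν : ∀ ξ, ν ξ ^ ρ < κ := by
      intro ξ
      refine hp1 _ (lt_of_le_of_lt ?_ (hp2 _ (mk_Iic_WO hpi (σ ξ).1)))
      exact power_le_power_left (hne _) hCρ
    have htree := tree_lemma (X := X) (I := WO p.ord.cof) (fun ξ => (ν ξ).out)
      (fun q => small r0 q.1 ∧ ∃ b, q.2 = A b) (by
        intro ξ h hV
        have hlt : #(Iio ξ) < p.ord.cof := mk_Iio_WO ξ
        choose b hb using fun ζ => (hV ζ).2
        obtain ⟨α, hα⟩ := exists_bound_WO b (by rw [hreg]; exact hlt.trans_le hCρ)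
        have hL : small r0 (⋃ ζ, (h ζ).1) :=
          small_iUnion C.inf_r0 _ (fun ζ => (hV ζ).1) (hlt.trans_le hCψ)
        have h2 := C.rest_big NS hΛ hτ (small_her (r0 := r0)) hZA hZ (hA α).2.2 hL
        set L := closure (⋃ ζ, (h ζ).1) with hLdef
        have h3 : ∃ β, ν ξ ≤ nP (small r0) (A β \ (A α ∪ L)) := by
          by_contra hc
          push Not at hc
          rw [iUnion_sdiff] at h2
          refine absurd (h2.trans ((nP_iUnion_le small_her _).trans (prod_le_pow fun β => (hc β).le))) ?_
          rw [mk_WO]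
          exact not_le.2 (hν ξ)
        obtain ⟨β, hβ⟩ := h3
        rw [← mk_out (ν ξ)] at hβ
        obtain ⟨g⟩ := hβ
        have hg : ∀ t, ∃ S : Set X, (S ⊆ A β \ (A α ∪ L) ∧ small r0 S) ∧ closure S = (g t).1 := fun t => (g t).2
        choose S hS hSg using hg
        refine ⟨S, A β, (hA β).1, fun t => ⟨⟨(hS t).2, β, rfl⟩, fun x hx => ((hS t).1 hx).1, fun ζ => ?_, ?_⟩, ?_⟩
        · rw [hb ζ]
          exact disjoint_left.2 fun x hx hxb => ((hS t).1 hx).2 (Or.inl (hAm (hα ζ).le hxb))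
        · exact disjoint_left.2 fun x hx hxb => ((hS t).1 hx).2 (Or.inr hxb)
        · intro t t' htt
          simp only [hSg] at htt
          exact g.injective (Subtype.ext htt))
    simp only [mk_out] at htree
    have h4 : p ^ p.ord.cof ≤ Cardinal.prod ν := by
      refine (pow_le_prod_cofinal p.ord.cof hs).trans ?_
      have h5 := prod_comp_le (χ := ν) (fun ξ => Cardinal.one_le_iff_ne_zero.2 (power_ne_zero _ (hne _))) σ.symm.injective
      simpa [ν] using h5
    exact absurd (hfin.trans (h4.trans htree)) (not_le.2 NS)

end


theorem mainM {X : Type u} [TopologicalSpace X] [CompactSpace X] [T2Space X] [TotallyDisconnectedSpace X]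
    {μ κ : Cardinal.{u}} (sl : μ.IsStrongLimit) (inf : ℵ₀ ≤ κ) (cof : κ.ord.cof < μ)
    (pow : ∀ χ < κ, ∀ s < μ, χ ^ s < κ) (h : κ ≤ oo (univ : Set X)) : κ ^ κ.ord.cof ≤ oo (univ : Set X) := by
  obtain ⟨r0, hr0, hmin⟩ := exists_least (P := fun r => κ ≤ 2 ^ r) ⟨κ, (cantor κ).le⟩
  have C : Ctx μ κ r0 := ⟨sl, inf, cof, pow, hr0, fun r hr => not_le.1 (hmin r hr)⟩
  by_contra NS
  have NS := not_le.1 NS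
  by_cases H : ∀ ν < κ, ∃ Z : WO (big κ.ord.cof) → Set X, (∀ j, IsClosed (Z j)) ∧
      (∀ j k, j ≠ k → Disjoint (Z j) (Z k)) ∧ ∀ j, ν ≤ oo (Z j)
  · exact absurd (C.R1 H) (not_le.2 NS)
  · obtain ⟨ν, H⟩ := not_forall.1 H
    obtain ⟨hν, H⟩ := Classical.not_imp.1 H
    obtain ⟨τ, hτ, hA⟩ := C.R2 (ν := max ν ℵ₀) (max_lt hν C.aleph0_lt) (le_max_right _ _) (by
      rintro ⟨Z, h1, h2, h3⟩
      exact H ⟨Z, h1, h2, fun j => (le_max_left _ _).trans (h3 j)⟩)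
    have hoA : κ ≤ oo (AA X τ) := by
      by_contra hc
      have hc := not_le.1 hc
      have h1 : oo (univ : Set X) ≤ oo (AA X τ) * oo ((AA X τ)ᶜ) := by
        rw [← union_compl_self (AA X τ)]
        exact oo_union_le _ _
      exact absurd (h.trans h1) (not_le.2 (C.mul_lt hc ((oo_le_two_pow _).trans_lt (C.two_pow hA))))
    rcases le_or_gt κ ((2 : Cardinal.{u}) ^< r0) with hΛ | hΛ
    · exact C.caseF NS hΛ hτ hA hoA
    · exact C.caseG NS hΛ hτ hoA

theorem final_arith {X : Type u} [TopologicalSpace X] [CompactSpace X] [T2Space X] [TotallyDisconnectedSpace X]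
    {μ : Cardinal.{u}} (sl : μ.IsStrongLimit) (hinf : ℵ₀ ≤ μ) (hsing : μ.ord.cof < μ)
    (h : μ ≤ oo (univ : Set X)) : oo (univ : Set X) = oo (univ : Set X) ^ μ := by
  have h1 : 1 ≤ μ := one_le_aleph0.trans hinf
  refine le_antisymm (self_le_power _ h1) ?_
  by_contra hlt
  have hlt := not_le.1 hlt
  set l := oo (univ : Set X) with hl
  have h2μ : (2 : Cardinal.{u}) ^ μ ≤ l := by
    have h2 := mainM (X := X) sl hinf hsing (fun χ hχ s hs => by
      have : χ ^ s ≤ 2 ^ (max ℵ₀ (max χ s)) := by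
        refine (power_le_power_right (cantor χ).le).trans ?_
        rw [← power_mul]
        refine power_le_power_left two_ne_zero ?_
        refine (mul_le_mul' ((le_max_left χ s).trans (le_max_right ℵ₀ _))
          ((le_max_right χ s).trans (le_max_right ℵ₀ _))).trans ?_
        rw [mul_eq_self (le_max_left _ _)]
      refine this.trans_lt (sl.isStrongPrelimit (max_lt ?_ (max_lt hχ hs)))
      exact (aleph0_le_cof hinf).trans_lt hsing) h
    refine le_trans ?_ h2
    obtain ⟨s, hs, hsc⟩ := exists_cofinal_WO μ
    have h5 : μ ≤ Cardinal.sum (fun i : s => #(Iic i.1)) := by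
      have : (⋃ i : s, Iic i.1) = (univ : Set (WO μ)) := by
        rw [eq_univ_iff_forall]
        intro y
        obtain ⟨z, hz, hyz⟩ := hs y
        exact mem_iUnion.2 ⟨⟨z, hz⟩, hyz⟩
      have h6 : μ = #(⋃ i : s, Iic i.1) := by rw [this, mk_univ, mk_WO]
      exact h6.le.trans mk_iUnion_le_sum_mk
    refine (power_le_power_left two_ne_zero h5).trans ?_
    rw [power_sum, ← hsc]
    exact prod_le_pow fun i => (sl.isStrongPrelimit (mk_Iic_WO hinf i.1)).le
  obtain ⟨κ, hκ, hmin⟩ := exists_least (P := fun κ => l < κ ^ μ) ⟨l, hlt⟩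
  have hκl : κ ≤ l := by
    by_contra hc
    exact hmin l (not_le.1 hc) hlt
  have hp0 : ∀ χ < κ, χ ^ μ ≤ l := fun χ hχ => not_lt.1 (hmin χ hχ)
  have hp1 : ∀ χ < κ, χ ^ μ < κ := by
    intro χ hχ
    by_contra hc
    have h3 : κ ^ μ ≤ (χ ^ μ) ^ μ := power_le_power_right (not_lt.1 hc)
    rw [← power_mul, mul_eq_self hinf] at h3
    exact absurd (hκ.trans_le h3) (not_lt.2 (hp0 χ hχ))
  have h2κ : 2 < κ := by
    by_contra hc
    exact absurd (hκ.trans_le (power_le_power_right (not_lt.1 hc))) (not_lt.2 h2μ)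
  have hμκ : μ < κ := (cantor μ).trans (hp1 2 h2κ)
  have hκi : ℵ₀ ≤ κ := hinf.trans hμκ.le
  have hc : κ.ord.cof ≤ μ := by
    by_contra hc
    exact absurd (hκ.trans_le (BF hκi (not_le.1 hc) fun χ hχ => (hp1 χ hχ).le)) (not_lt.2 hκl)
  have hc' : κ.ord.cof < μ := by
    refine lt_of_le_of_ne hc fun he => ?_
    have := (cof_isRegular hκi).cof_ord
    rw [he] at this
    exact hsing.ne this
  have hM := mainM (X := X) sl hκi hc' (fun χ hχ s hs => by
    refine lt_of_le_of_lt ?_ (hp1 (max χ 1) (max_lt hχ (one_lt_aleph0.trans_le hκi)))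
    exact (power_le_power_right (le_max_left _ _)).trans
        (power_le_power_left (zero_lt_one.trans_le (le_max_right χ 1)).ne' hs.le)) hκl
  exact absurd ((hκ.trans_le (PW hκi fun χ hχ => (hp1 χ hχ).le)).trans_le hM) (lt_irrefl _)



section
variable (B : Type u) [BooleanAlgebra B]

/-- The Stone space as a subset of the Cantor cube. -/
def stone : Set (B → Bool) := {f | f ⊥ = false ∧ (∀ a b, f (a ⊔ b) = (f a || f b)) ∧ ∀ a, f aᶜ = !(f a)}

theorem isClosed_stone : IsClosed (stone B) := by
  have h : stone B = {f | f ⊥ = false} ∩ ((⋂ a, ⋂ b, {f | f (a ⊔ b) = (f a || f b)}) ∩ ⋂ a, {f | f aᶜ = !(f a)}) := by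
    ext f
    simp [stone]
  rw [h]
  have hn : Continuous (fun b : Bool => !b) := continuous_of_discreteTopology
  have ho : Continuous (fun b : Bool × Bool => (b.1 || b.2)) := continuous_of_discreteTopology
  refine (isClosed_eq (continuous_apply _) continuous_const).inter ((isClosed_iInter fun a => isClosed_iInter fun b =>
    isClosed_eq (continuous_apply _) (ho.comp (f := fun f : B → Bool => (f a, f b)) ((continuous_apply a).prodMk (continuous_apply b)))).inter
    (isClosed_iInter fun a => isClosed_eq (continuous_apply _) (hn.comp (continuous_apply a))))

instance : CompactSpace (stone B) := isCompact_iff_compactSpace.1 (isClosed_stone B).isCompact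

variable {B}

theorem stone_inf (f : stone B) (a b : B) : f.1 (a ⊓ b) = (f.1 a && f.1 b) := by
  have h : a ⊓ b = (aᶜ ⊔ bᶜ)ᶜ := by simp
  rw [h, f.2.2.2, f.2.2.1, f.2.2.2, f.2.2.2]
  simp

theorem stone_top (f : stone B) : f.1 ⊤ = true := by
  rw [← compl_bot, f.2.2.2, f.2.1]; rfl

theorem stone_basis (U : Set (stone B)) (hU : IsOpen U) (x : stone B) (hx : x ∈ U) :
    ∃ a : B, x.1 a = true ∧ ∀ g : stone B, g.1 a = true → g ∈ U := by
  obtain ⟨V, hV, rfl⟩ := isOpen_induced_iff.1 hU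
  obtain ⟨F, u, hu, hsub⟩ := isOpen_pi_iff.1 hV x.1 hx
  have key : ∀ F : Finset B, ∃ a : B, x.1 a = true ∧ ∀ g : stone B, g.1 a = true → ∀ b ∈ F, g.1 b = x.1 b := by
    classical
    intro F
    induction F using Finset.induction_on with
    | empty => exact ⟨⊤, stone_top x, fun g _ b hb => by simp at hb⟩
    | insert c F _ ih =>
      obtain ⟨a, ha, hag⟩ := ih
      cases hc : x.1 c with
      | true =>
        refine ⟨a ⊓ c, by rw [stone_inf, ha, hc]; rfl, fun g hg b hb => ?_⟩
        rw [stone_inf, Bool.and_eq_true] at hg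
        rcases Finset.mem_insert.1 hb with rfl | hb
        · rw [hc, hg.2]
        · exact hag g hg.1 b hb
      | false =>
        refine ⟨a ⊓ cᶜ, by rw [stone_inf, ha, x.2.2.2, hc]; rfl, fun g hg b hb => ?_⟩
        rw [stone_inf, Bool.and_eq_true, g.2.2.2] at hg
        rcases Finset.mem_insert.1 hb with rfl | hb
        · rw [hc]; simpa using hg.2
        · exact hag g hg.1 b hb
  obtain ⟨a, ha, hag⟩ := key F
  refine ⟨a, ha, fun g hg => hsub fun b hb => ?_⟩
  rw [hag g hg b hb]
  exact (hu b hb).2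

theorem stone_sep (I : Set B) (hne : I.Nonempty) (hd : ∀ a ∈ I, ∀ b : B, b ≤ a → b ∈ I)
    (hs : ∀ a ∈ I, ∀ b ∈ I, a ⊔ b ∈ I) (c : B) (hc : c ∉ I) :
    ∃ f : stone B, (∀ a ∈ I, f.1 a = false) ∧ f.1 c = true := by
  classical
  let J : Order.Ideal B := ⟨⟨I, fun a b hba ha => hd a ha b hba⟩, hne,
    fun a ha b hb => ⟨a ⊔ b, hs a ha b hb, le_sup_left, le_sup_right⟩⟩
  have hdis : Disjoint ((Order.PFilter.principal c : Order.PFilter B) : Set B) (J : Set B) := by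
    refine disjoint_left.2 fun x hx hxJ => hc (hd x hxJ c ?_)
    exact Order.PFilter.mem_principal.1 hx
  obtain ⟨P, hP, hJP, hPd⟩ := DistribLattice.prime_ideal_of_disjoint_filter_ideal hdis
  have hbot : (⊥ : B) ∈ P := P.bot_mem
  have htop : (⊤ : B) ∉ P := fun h => hP.toIsProper.ne_univ (by
    ext x; simp only [mem_univ, iff_true]; exact P.lower le_top h)
  refine ⟨⟨fun a => decide (a ∉ P), ?_, ?_, ?_⟩, ?_, ?_⟩
  · simp
  · intro a b
    rw [← Bool.decide_or, decide_eq_decide, ← not_and_or, not_iff_not]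
    exact Order.Ideal.sup_mem_iff
  · intro a
    rw [← decide_not, decide_eq_decide, not_iff_not]
    constructor
    · intro h h2
      apply htop
      rw [← sup_compl_eq_top (x := a)]
      exact Order.Ideal.sup_mem h2 h
    · intro h
      exact hP.compl_mem_of_notMem h
  · intro a ha
    simpa using hJP ha
  · have : c ∉ P := fun h => disjoint_left.1 hPd (Order.PFilter.mem_principal.2 le_rfl) h
    simpa using this

def IsId (I : Set B) : Prop := I.Nonempty ∧ (∀ a ∈ I, ∀ b : B, b ≤ a → b ∈ I) ∧ ∀ a ∈ I, ∀ b ∈ I, a ⊔ b ∈ I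

theorem mk_ideals : #{I : Set B | IsId I} = oo (univ : Set (stone B)) := by
  unfold oo nP
  refine le_antisymm ?_ ?_
  · let K : Set B → Set (stone B) := fun I => {f | ∀ a ∈ I, f.1 a = false}
    have hK : ∀ I, IsClosed (K I) := by
      intro I
      have : K I = ⋂ a ∈ I, {f : stone B | f.1 a = false} := by ext f; simp [K]
      rw [this]
      exact isClosed_biInter fun a _ => isClosed_eq ((continuous_apply a).comp continuous_subtype_val) continuous_const
    have hsub : ∀ I J : Set B, IsId I → IsId J → K I = K J → J ⊆ I := by
      intro I J hI hJ h c hcJ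
      by_contra hc
      obtain ⟨f, hf, hfc⟩ := stone_sep I hI.1 hI.2.1 hI.2.2 c hc
      have : f ∈ K J := h ▸ hf
      rw [this c hcJ] at hfc
      exact absurd hfc (by simp)
    refine mk_le_of_injective (f := fun I : {I : Set B | IsId I} =>
      (⟨K I.1, K I.1, ⟨subset_univ _, trivial⟩, (hK _).closure_eq⟩ :
        (closure '' {S : Set (stone B) | S ⊆ univ ∧ True} : Set (Set (stone B))))) ?_
    intro I J h
    have h' : K I.1 = K J.1 := congrArg Subtype.val h
    exact Subtype.ext (Subset.antisymm (hsub _ _ J.2 I.2 h'.symm) (hsub _ _ I.2 J.2 h'))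
  · let N : Set (stone B) → Set B := fun K => {a | ∀ f ∈ K, f.1 a = false}
    have hN : ∀ K, IsId (N K) := by
      intro K
      refine ⟨⟨⊥, fun f _ => f.2.1⟩, fun a ha b hba f hf => ?_, fun a ha b hb f hf => ?_⟩
      · have h1 : f.1 a = (f.1 b || f.1 a) := by rw [← f.2.2.1, sup_eq_right.2 hba]
        rw [ha f hf] at h1
        simpa using h1.symm
      · rw [f.2.2.1, ha f hf, hb f hf]; rfl
    have hsub : ∀ K K' : Set (stone B), IsClosed K' → N K = N K' → K ⊆ K' := by
      intro K K' hK' h x hx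
      by_contra hxK
      obtain ⟨a, ha, hag⟩ := stone_basis K'ᶜ hK'.isOpen_compl x hxK
      have h1 : a ∈ N K' := by
        intro f hf
        by_contra hfa
        exact hag f (by simpa using hfa) hf
      rw [← h] at h1
      rw [h1 x hx] at ha
      exact absurd ha (by simp)
    refine mk_le_of_injective (f := fun K : (closure '' {S : Set (stone B) | S ⊆ univ ∧ True} : Set (Set (stone B))) =>
      (⟨N K.1, hN _⟩ : {I : Set B | IsId I})) ?_
    have hcl : ∀ K : (closure '' {S : Set (stone B) | S ⊆ univ ∧ True} : Set (Set (stone B))), IsClosed K.1 := by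
      rintro ⟨_, S, -, rfl⟩
      exact isClosed_closure
    intro K K' h
    have h' : N K.1 = N K'.1 := congrArg Subtype.val h
    exact Subtype.ext (Subset.antisymm (hsub _ _ (hcl _) h') (hsub _ _ (hcl _) h'.symm))

theorem mk_le_ideals : #B ≤ #{I : Set B | IsId I} := by
  refine mk_le_of_injective (f := fun a : B => (⟨Iic a, ⟨a, le_refl a⟩, fun x hx b hb => le_trans hb hx,
    fun x hx y hy => sup_le hx hy⟩ : {I : Set B | IsId I})) ?_
  intro a b h
  have h' : Iic a = Iic b := congrArg Subtype.val h
  exact Iic_injective h'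

end


end ClosedCount
end


open Cardinal

/-- If `μ` is a singular strong limit cardinal, `B` is a Boolean algebra of
cardinality `≥ μ` and `λ` is the number of ideals of `B`, then `λ = λ^μ`. -/
theorem stmt5 (μ : Cardinal.{u}) (hsl : μ.IsStrongLimit)
    (hinf : Cardinal.aleph0 ≤ μ) (hsing : μ.ord.cof < μ)
    (B : Type u) [BooleanAlgebra B] (hB : μ ≤ #B)
    (lam : Cardinal.{u})
    (hlam : lam = #{I : Set B | I.Nonempty ∧ (∀ a ∈ I, ∀ b : B, b ≤ a → b ∈ I) ∧
      ∀ a ∈ I, ∀ b ∈ I, a ⊔ b ∈ I}) :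
    lam = lam ^ μ := by
  have h1 : lam = ClosedCount.oo (Set.univ : Set (ClosedCount.stone B)) := by
    rw [hlam]
    exact ClosedCount.mk_ideals
  have h2 : μ ≤ lam := by
    rw [hlam]
    exact hB.trans ClosedCount.mk_le_ideals
  rw [h1] at h2 ⊢
  exact ClosedCount.final_arith hsl hinf hsing h2
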